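/- arXiv:1710.11494 — 3 statements merged into one kernel-verified Lean document; each statement's English description precedes it below -/
import Mathlib

section
/- Let T be the truncated Fourier–Plancherel operator on L²(ℝ⁺) and let z ∈ ℂ lie outside the segment [−e^{iπ/4}/√2, e^{iπ/4}/√2]. Then the operator z·I − T is invertible in the Banach algebra of bounded linear operators on L²(ℝ⁺), and setting d = dist(z², [0, i/2]) > 0 one has (2|z|² + 1)/d² − 2/(2|z|² + 1) ≤ ‖(z·I − T)⁻¹‖² ≤ (2|z|² + 1)/d². -/
open MeasureTheory Set

/-- Lebesgue measure restricted to `(0,∞)`. -/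
noncomputable def m0 : Measure ℝ := volume.restrict (Ioi (0:ℝ))

section Aux

open Filter Topology FourierTransform

open Filter Topology FourierTransform


lemma fourier_L1L2 (f : Lp ℂ 2 (volume : Measure ℝ)) (hf : Integrable (⇑f) volume) :
    (⇑(Lp.fourierTransformₗᵢ ℝ ℂ f) : ℝ → ℂ) =ᵐ[volume] 𝓕 (⇑f : ℝ → ℂ) := by
  have hc : Continuous (𝓕 (⇑f : ℝ → ℂ)) :=
    VectorFourier.fourierIntegral_continuous Real.continuous_fourierChar
      (by exact continuous_inner) hf
  apply ae_eq_of_integral_contDiff_smul_eq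
  · exact (Lp.memLp _).locallyIntegrable (by norm_num)
  · exact hc.locallyIntegrable
  intro g gs gc
  have hg₁ : HasCompactSupport (Complex.ofRealCLM ∘ g) := gc.comp_left rfl
  have hg₂ : ContDiff ℝ ((⊤ : ℕ∞) : WithTop ℕ∞) (Complex.ofRealCLM ∘ g) := by fun_prop
  set φ := hg₁.toSchwartzMap hg₂ with hφ
  have h1 := congrArg (fun d => d φ) (Lp.fourier_toTemperedDistribution_eq f)
  simp only [TemperedDistribution.fourier_apply, Lp.toTemperedDistribution_apply] at h1
  have h2 := VectorFourier.integral_fourierIntegral_smul_eq_flip (L := innerₗ ℝ) (μ := volume)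
    (ν := volume) Real.continuous_fourierChar continuous_inner φ.integrable hf
  have h3 : ∀ x, (g x) • (Lp.fourierTransformₗᵢ ℝ ℂ f) x = φ x • (𝓕 f : Lp ℂ 2 (volume : Measure ℝ)) x := by
    intro x; simp [φ]; left; rfl
  have h4 : ∀ x, (g x) • 𝓕 (⇑f : ℝ → ℂ) x = φ x • (VectorFourier.fourierIntegral Real.fourierChar volume (innerₗ ℝ).flip f x) := by
    intro x; simp [φ]; left; rfl
  simp_rw [h3, h4]
  rw [← h1, ← h2]
  rfl

lemma gint_aux {σ b : ℝ} (hσ : 0 < σ) (hb : 0 < b) :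
    IntegrableOn (fun t : ℝ => t ^ (σ - 1) * Real.exp (-(b * t))) (Ioi 0) := by
  have := integrableOn_rpow_mul_exp_neg_mul_rpow (p := 1) (s := σ - 1) (by linarith) one_pos hb
  simpa using this

lemma gnorm {a : ℂ} {r : ℂ} {t : ℝ} (ht : t ∈ Ioi (0:ℝ)) :
    ‖(t : ℂ) ^ (a - 1) * Complex.exp (-(r * t))‖ = t ^ (a.re - 1) * Real.exp (-(r.re * t)) := by
  rw [norm_mul, Complex.norm_cpow_eq_rpow_re_of_pos ht, Complex.norm_exp]
  simp

lemma gmeas {a : ℂ} {r : ℂ} : AEStronglyMeasurable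
    (fun t : ℝ => (t : ℂ) ^ (a - 1) * Complex.exp (-(r * t))) (volume.restrict (Ioi 0)) := by
  refine ContinuousOn.aestronglyMeasurable ?_ measurableSet_Ioi
  intro t ht
  refine ContinuousAt.continuousWithinAt ?_
  refine ContinuousAt.mul ?_ (by fun_prop)
  exact Complex.continuousAt_ofReal_cpow_const _ _ (Or.inr (ne_of_gt ht))

lemma gint {a : ℂ} {r : ℂ} (ha : 0 < a.re) (hr : 0 < r.re) :
    IntegrableOn (fun t : ℝ => (t : ℂ) ^ (a - 1) * Complex.exp (-(r * t))) (Ioi 0) := by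
  refine Integrable.mono' (gint_aux ha hr) gmeas ?_
  filter_upwards [ae_restrict_mem measurableSet_Ioi] with t ht
  rw [gnorm ht]

lemma gamma_complex {a : ℂ} {r : ℂ} (ha : 0 < a.re) (hr : 0 < r.re) :
    ∫ (t : ℝ) in Ioi 0, (t : ℂ) ^ (a - 1) * Complex.exp (-(r * t)) =
      (1 / r) ^ a * Complex.Gamma a := by
  set U : Set ℂ := {r | 0 < r.re} with hU
  have hUo : IsOpen U := isOpen_lt continuous_const Complex.continuous_re
  have hUc : IsPreconnected U := (convex_halfSpace_re_gt 0).isPreconnected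
  have d1 : DifferentiableOn ℂ (fun r : ℂ => ∫ (t : ℝ) in Ioi 0,
      (t : ℂ) ^ (a - 1) * Complex.exp (-(r * t))) U := by
    intro r0 hr0
    have hr0' : 0 < r0.re := hr0
    have key := hasDerivAt_integral_of_dominated_loc_of_deriv_le
      (μ := volume.restrict (Ioi (0:ℝ)))
      (F := fun (r : ℂ) (t : ℝ) => (t : ℂ) ^ (a - 1) * Complex.exp (-(r * t)))
      (F' := fun (r : ℂ) (t : ℝ) => (t : ℂ) ^ (a - 1) * (Complex.exp (-(r * t)) * (-t)))
      (x₀ := r0) (s := Metric.ball r0 (r0.re / 2))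
      (bound := fun t => t ^ ((a.re + 1) - 1) * Real.exp (-(r0.re / 2 * t)))
      (Metric.ball_mem_nhds _ (by positivity))
      (Eventually.of_forall fun r => gmeas) (gint ha hr0') ?_ ?_ (gint_aux (by linarith) (by positivity)) ?_
    · exact key.2.differentiableAt.differentiableWithinAt
    · refine ((gmeas (a := a) (r := r0)).mul
        (g := fun t : ℝ => -(t:ℂ)) (by fun_prop)).congr ?_
      exact Eventually.of_forall fun t => by simp [mul_assoc]
    · filter_upwards [ae_restrict_mem measurableSet_Ioi] with t ht r hr
      have ht' : 0 < t := ht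
      rw [← mul_assoc, norm_mul, gnorm ht]
      have h1 : r0.re / 2 ≤ r.re := by
        have := Complex.abs_re_le_norm (r - r0)
        rw [Metric.mem_ball, dist_eq_norm] at hr
        have h2 := abs_le.1 (this.trans hr.le)
        simp at h2; linarith
      have : t ^ ((a.re + 1) - 1) = t ^ (a.re - 1) * t := by
        rw [← Real.rpow_add_one ht'.ne']; ring_nf
      rw [this]
      have : ‖(-t : ℂ)‖ = t := by simp [abs_of_pos ht']
      rw [this, mul_assoc, mul_assoc, mul_comm t]
      gcongr
    · filter_upwards [ae_restrict_mem measurableSet_Ioi] with t ht r hr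
      have : HasDerivAt (fun r : ℂ => -(r * t)) (-t : ℂ) r := by
        simpa using ((hasDerivAt_id r).mul_const (t:ℂ)).fun_neg
      exact (this.cexp).const_mul _
  have d2 : DifferentiableOn ℂ (fun r : ℂ => (1 / r) ^ a * Complex.Gamma a) U := by
    intro r hr
    have hr' : 0 < r.re := hr
    have hr0 : r ≠ 0 := by rintro rfl; simp at hr'
    refine DifferentiableAt.differentiableWithinAt ?_
    refine DifferentiableAt.mul_const (DifferentiableAt.cpow_const ?_ ?_) _
    · fun_prop (disch := exact hr0)
    · left
      simp only [one_div, Complex.inv_re]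
      exact div_pos hr' (Complex.normSq_pos.2 hr0)
  have := (d1.analyticOnNhd hUo).eqOn_of_preconnected_of_frequently_eq (d2.analyticOnNhd hUo) hUc
    (z₀ := 1) (by simp [hU]) ?_
  · exact this hr
  · have h1 : Tendsto (fun n : ℕ => ((1 + 1 / ((n:ℝ) + 1) : ℝ) : ℂ)) atTop (𝓝[≠] 1) := by
      rw [tendsto_nhdsWithin_iff]
      constructor
      · have := (tendsto_one_div_add_atTop_nhds_zero_nat (𝕜 := ℝ)).const_add 1
        rw [add_zero] at this
        exact_mod_cast (Complex.continuous_ofReal.tendsto 1).comp this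
      · refine Eventually.of_forall fun n => ?_
        simp only [mem_compl_iff, mem_singleton_iff]
        norm_cast
        have : 0 < 1 / ((n:ℝ) + 1) := by positivity
        push_cast; linarith
    refine h1.frequently (Eventually.of_forall fun n => ?_).frequently
    exact Complex.integral_cpow_mul_exp_neg_mul_Ioi ha (by positivity)

noncomputable def GG (ω : ℝ) : ℂ :=
  (Real.sqrt (2 * Real.pi) : ℂ)⁻¹ * (Complex.exp (Complex.I * Real.pi / 2 * (1/2 - 2 * Real.pi * ω * Complex.I))
    * Complex.Gamma (1/2 - 2 * Real.pi * ω * Complex.I))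

lemma GG_cont : Continuous GG := by
  unfold GG
  refine Continuous.mul continuous_const (Continuous.mul (by fun_prop) ?_)
  rw [continuous_iff_continuousAt]
  intro ω
  have h1 : ContinuousAt Complex.Gamma (1/2 - 2 * Real.pi * ω * Complex.I) := by
    refine (Complex.differentiableAt_Gamma _ fun m h => ?_).continuousAt
    have := congrArg Complex.re h
    simp at this
    have h0 : (0:ℝ) ≤ m := by positivity
    linarith
  exact ContinuousAt.comp (f := fun ω : ℝ => (1/2 - 2 * Real.pi * ω * Complex.I : ℂ)) h1 (by fun_prop)

lemma Gamma_half (ω : ℝ) : Complex.Gamma (1/2 - 2 * Real.pi * ω * Complex.I) *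
    Complex.Gamma (1/2 + 2 * Real.pi * ω * Complex.I) = Real.pi / (Real.cosh (2 * Real.pi^2 * ω) : ℂ) := by
  have := Complex.Gamma_mul_Gamma_one_sub (1/2 - 2 * Real.pi * ω * Complex.I)
  rw [show (1:ℂ) - (1/2 - 2 * Real.pi * ω * Complex.I) = 1/2 + 2 * Real.pi * ω * Complex.I by ring] at this
  rw [this]
  congr 1
  rw [show (Real.pi : ℂ) * (1/2 - 2 * Real.pi * ω * Complex.I) = Real.pi/2 - (2 * Real.pi^2 * ω : ℂ) * Complex.I by ring,
    Complex.sin_pi_div_two_sub, Complex.cos_mul_I]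
  push_cast; rfl

lemma sq2pi : (Real.sqrt (2 * Real.pi) : ℂ)⁻¹ * (Real.sqrt (2 * Real.pi) : ℂ)⁻¹ = (2 * (Real.pi:ℂ))⁻¹ := by
  rw [← mul_inv, ← Complex.ofReal_mul, Real.mul_self_sqrt (by positivity)]; push_cast; rfl

lemma GG_mul (ω : ℝ) : GG ω * GG (-ω) = ((1 / (2 * Real.cosh (2 * Real.pi^2 * ω)) : ℝ) : ℂ) * Complex.I := by
  have h := Gamma_half ω
  have e : Complex.exp (Complex.I * Real.pi / 2 * (1/2 - 2 * Real.pi * ω * Complex.I)) *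
    Complex.exp (Complex.I * Real.pi / 2 * (1/2 + 2 * Real.pi * ω * Complex.I)) = Complex.I := by
    rw [← Complex.exp_add]
    refine Eq.trans (congrArg Complex.exp ?_) Complex.exp_pi_div_two_mul_I
    ring
  unfold GG
  push_cast
  rw [show (1/2 - 2 * Real.pi * (-ω:ℂ) * Complex.I) = 1/2 + 2 * Real.pi * ω * Complex.I by ring]
  calc _ = ((Real.sqrt (2 * Real.pi) : ℂ)⁻¹ * (Real.sqrt (2 * Real.pi) : ℂ)⁻¹) *
        (Complex.exp (Complex.I * Real.pi / 2 * (1/2 - 2 * Real.pi * ω * Complex.I)) *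
    Complex.exp (Complex.I * Real.pi / 2 * (1/2 + 2 * Real.pi * ω * Complex.I))) *
      (Complex.Gamma (1/2 - 2 * Real.pi * ω * Complex.I) *
    Complex.Gamma (1/2 + 2 * Real.pi * ω * Complex.I)) := by ring
    _ = _ := by
      rw [h, e, sq2pi]
      have : (Real.pi : ℂ) ≠ 0 := by exact_mod_cast Real.pi_ne_zero
      have : (Complex.cosh (2 * Real.pi^2 * ω)) ≠ 0 := by
        have := (Real.cosh_pos (2 * Real.pi^2 * ω)).ne'
        exact_mod_cast this
      push_cast
      field_simp

lemma GG_norm (ω : ℝ) : ‖GG ω‖ ^ 2 = Real.exp (2 * Real.pi^2 * ω) / (2 * Real.cosh (2 * Real.pi^2 * ω)) := by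
  have hG : ‖Complex.Gamma (1/2 - 2 * Real.pi * ω * Complex.I)‖ ^ 2 = Real.pi / Real.cosh (2 * Real.pi^2 * ω) := by
    have h := Gamma_half ω
    have hc : (1/2 + 2 * Real.pi * ω * Complex.I : ℂ) = (starRingEnd ℂ) (1/2 - 2 * Real.pi * ω * Complex.I) := by
      have h2 : (starRingEnd ℂ) 2 = 2 := Complex.conj_ofReal 2
      simp [h2]
    rw [hc, Complex.Gamma_conj, Complex.mul_conj, Complex.normSq_eq_norm_sq] at h
    exact_mod_cast h
  unfold GG
  rw [norm_mul, norm_mul, mul_pow, mul_pow, hG, Complex.norm_exp]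
  have : (Complex.I * Real.pi / 2 * (1/2 - 2 * Real.pi * ω * Complex.I)).re = Real.pi^2 * ω := by
    rw [show Complex.I * Real.pi / 2 * (1/2 - 2 * Real.pi * ω * Complex.I) =
      ((Real.pi^2 * ω : ℝ) : ℂ) + ((Real.pi/4 : ℝ) : ℂ) * Complex.I by
        push_cast; ring_nf; rw [Complex.I_sq]; ring]
    rw [Complex.add_re, Complex.ofReal_re, Complex.re_ofReal_mul, Complex.I_re, mul_zero, add_zero]
  rw [this, ← Real.exp_nat_mul, norm_inv, Complex.norm_real, Real.norm_of_nonneg (by positivity), inv_pow,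
    Real.sq_sqrt (by positivity)]
  have := Real.pi_pos
  have := Real.cosh_pos (2 * Real.pi^2 * ω)
  push_cast
  rw [show 2 * (Real.pi^2 * ω) = 2 * Real.pi^2 * ω by ring]
  field_simp

lemma GG_sum (ω : ℝ) : ‖GG ω‖ ^ 2 + ‖GG (-ω)‖ ^ 2 = 1 := by
  rw [GG_norm, GG_norm, show 2 * Real.pi^2 * (-ω) = -(2 * Real.pi^2 * ω) by ring, Real.cosh_neg,
    ← add_div, Real.cosh_eq]
  have := Real.exp_pos (2 * Real.pi^2 * ω)
  have := Real.exp_pos (-(2 * Real.pi^2 * ω))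
  field_simp

lemma GG_le (ω : ℝ) : ‖GG ω‖ ≤ 1 := by
  have := GG_sum ω
  nlinarith [norm_nonneg (GG ω), norm_nonneg (GG (-ω)), sq_nonneg ‖GG (-ω)‖]

/-- the two-term operators -/
lemma exists_op (φ ψ : ℝ → ℂ) (hφ : Measurable φ) (hψ : Measurable ψ) (C : ℝ)
    (hφC : ∀ t, ‖φ t‖ ≤ C) (hψC : ∀ t, ‖ψ t‖ ≤ C) :
    ∃ L : Lp ℂ 2 (volume : Measure ℝ) →L[ℂ] Lp ℂ 2 (volume : Measure ℝ),
      ∀ h, (⇑(L h) : ℝ → ℂ) =ᵐ[volume] fun t => φ t * h t + ψ t * h (-t) := by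
  have mp : MeasurePreserving (fun t : ℝ => -t) volume volume := Measure.measurePreserving_neg volume
  have m1 : ∀ (φ : ℝ → ℂ) (hφ : Measurable φ) (hφC : ∀ t, ‖φ t‖ ≤ C),
      ∃ L : Lp ℂ 2 (volume : Measure ℝ) →L[ℂ] Lp ℂ 2 (volume : Measure ℝ),
      ∀ h, (⇑(L h) : ℝ → ℂ) =ᵐ[volume] fun t => φ t * h t := by
    intro φ hφ hφC
    have hm : ∀ h : Lp ℂ 2 (volume : Measure ℝ), MemLp (fun t => φ t * h t) 2 volume := fun h =>
      (Lp.memLp h).of_le_mul (hφ.aestronglyMeasurable.mul (Lp.aestronglyMeasurable h))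
        (c := C) (Eventually.of_forall fun t => by
          rw [norm_mul]; exact mul_le_mul_of_nonneg_right (hφC t) (norm_nonneg _))
    refine ⟨LinearMap.mkContinuous
      { toFun := fun h => (hm h).toLp
        map_add' := ?_
        map_smul' := ?_ } C ?_, ?_⟩
    · intro f g
      apply Lp.ext
      filter_upwards [(hm (f + g)).coeFn_toLp, (hm f).coeFn_toLp, (hm g).coeFn_toLp,
        Lp.coeFn_add f g, Lp.coeFn_add (hm f).toLp (hm g).toLp] with t h1 h2 h3 h4 h5
      rw [h1, h5, Pi.add_apply, h2, h3, h4, Pi.add_apply]; ring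
    · intro c f
      apply Lp.ext
      filter_upwards [(hm (c • f)).coeFn_toLp, (hm f).coeFn_toLp,
        Lp.coeFn_smul c f, Lp.coeFn_smul c (hm f).toLp] with t h1 h2 h3 h4
      simp only [RingHom.id_apply]
      rw [h1, h4, Pi.smul_apply, h2, h3, Pi.smul_apply, smul_eq_mul, smul_eq_mul]; ring
    · intro h
      refine Lp.norm_le_mul_norm_of_ae_le_mul ?_
      filter_upwards [(hm h).coeFn_toLp] with t h1
      change ‖((hm h).toLp) t‖ ≤ _
      rw [h1, norm_mul]; exact mul_le_mul_of_nonneg_right (hφC t) (norm_nonneg _)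
    · intro h
      exact (hm h).coeFn_toLp
  obtain ⟨L1, h1⟩ := m1 φ hφ hφC
  obtain ⟨L2, h2⟩ := m1 ψ hψ hψC
  refine ⟨L1 + L2 ∘L (Lp.compMeasurePreservingₗᵢ ℂ (fun t : ℝ => -t) mp).toContinuousLinearMap, fun h => ?_⟩
  have h3 := h2 (Lp.compMeasurePreservingₗᵢ ℂ (fun t : ℝ => -t) mp h)
  filter_upwards [h1 h, h3, Lp.coeFn_compMeasurePreserving h mp,
    Lp.coeFn_add (L1 h) (L2 (Lp.compMeasurePreservingₗᵢ ℂ (fun t : ℝ => -t) mp h))] with t a1 a2 a3 a4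
  simp only [_root_.add_apply, ContinuousLinearMap.comp_apply,
    LinearIsometry.coe_toContinuousLinearMap]
  rw [a4, Pi.add_apply, a1, a2]
  congr 2

lemma lint_exp (g : ℝ → ENNReal) : ∫⁻ t, g t ∂m0 = ∫⁻ u, ENNReal.ofReal (Real.exp u) * g (Real.exp u) := by
  have := lintegral_image_eq_lintegral_abs_deriv_mul (s := univ) (f := Real.exp) (f' := Real.exp)
    MeasurableSet.univ (fun x _ => (Real.hasDerivAt_exp x).hasDerivWithinAt) Real.exp_injective.injOn g
  simpa [m0, Real.range_exp, abs_of_pos (Real.exp_pos _)] using this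

lemma qmp_exp : Measure.QuasiMeasurePreserving Real.exp volume m0 := by
  refine ⟨Real.measurable_exp, ?_⟩
  refine Measure.AbsolutelyContinuous.mk fun s hs h => ?_
  rw [Measure.map_apply Real.measurable_exp hs]
  have h1 := lint_exp (s.indicator 1)
  rw [lintegral_indicator_one hs, h] at h1
  have h2 := (lintegral_eq_zero_iff (by
    refine Measurable.mul (by fun_prop) ?_
    exact (measurable_one.indicator hs).comp Real.measurable_exp)).1 h1.symm
  rw [← nonpos_iff_eq_zero]
  refine le_of_eq (measure_eq_zero_iff_ae_notMem.2 ?_)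
  filter_upwards [h2] with u hu hus
  have hus' : Real.exp u ∈ s := hus
  simp [hus'] at hu
  exact absurd hu (not_le.2 (Real.exp_pos u))

lemma qmp_log : Measure.QuasiMeasurePreserving Real.log m0 volume := by
  refine ⟨Real.measurable_log, ?_⟩
  refine Measure.AbsolutelyContinuous.mk fun s hs h => ?_
  rw [Measure.map_apply Real.measurable_log hs]
  have h1 := lint_exp ((Real.log ⁻¹' s).indicator 1)
  rw [lintegral_indicator_one (Real.measurable_log hs)] at h1
  rw [h1, lintegral_eq_zero_iff]
  · filter_upwards [measure_eq_zero_iff_ae_notMem.1 h] with u hu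
    simp [hu]
  · refine Measurable.mul (by fun_prop) ?_
    exact (measurable_one.indicator (Real.measurable_log hs)).comp Real.measurable_exp

lemma eLp_exp (x : ℝ → ℂ) : eLpNorm (fun u => (Real.exp (u/2) : ℂ) * x (Real.exp u)) 2 volume = eLpNorm x 2 m0 := by
  rw [eLpNorm_eq_lintegral_rpow_enorm_toReal (by norm_num) (by norm_num),
    eLpNorm_eq_lintegral_rpow_enorm_toReal (by norm_num) (by norm_num), lint_exp]
  congr 2
  ext u
  rw [enorm_mul, ENNReal.mul_rpow_of_nonneg _ _ (by norm_num)]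
  congr 1
  rw [← ofReal_norm, Complex.norm_real, Real.norm_of_nonneg (Real.exp_pos _).le,
    ENNReal.ofReal_rpow_of_pos (Real.exp_pos _), ← Real.exp_mul]
  congr 2
  simp

lemma exists_V : ∃ V : Lp ℂ 2 m0 ≃ₗᵢ[ℂ] Lp ℂ 2 (volume : Measure ℝ),
    ∀ x, (⇑(V x) : ℝ → ℂ) =ᵐ[volume] fun u => (Real.exp (u/2) : ℂ) * x (Real.exp u) := by
  have hm : ∀ x : Lp ℂ 2 m0, MemLp (fun u => (Real.exp (u/2) : ℂ) * x (Real.exp u)) 2 (volume : Measure ℝ) := by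
    intro x
    refine ⟨?_, ?_⟩
    · refine Measurable.aestronglyMeasurable (Measurable.mul (by fun_prop) ?_)
      exact (Lp.stronglyMeasurable x).measurable.comp Real.measurable_exp
    · rw [eLp_exp]; exact (Lp.memLp x).2
  let V0 : Lp ℂ 2 m0 →ₗᵢ[ℂ] Lp ℂ 2 (volume : Measure ℝ) :=
    { toFun := fun h => (hm h).toLp
      map_add' := by
        intro f g
        apply Lp.ext
        filter_upwards [(hm (f + g)).coeFn_toLp, (hm f).coeFn_toLp, (hm g).coeFn_toLp,
          qmp_exp.ae (Lp.coeFn_add f g), Lp.coeFn_add (hm f).toLp (hm g).toLp] with t h1 h2 h3 h4 h5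
        rw [h1, h5, Pi.add_apply, h2, h3, h4, Pi.add_apply]; ring
      map_smul' := by
        intro c f
        apply Lp.ext
        filter_upwards [(hm (c • f)).coeFn_toLp, (hm f).coeFn_toLp,
          qmp_exp.ae (Lp.coeFn_smul c f), Lp.coeFn_smul c (hm f).toLp] with t h1 h2 h3 h4
        simp only [RingHom.id_apply]
        rw [h1, h4, Pi.smul_apply, h2, h3, Pi.smul_apply, smul_eq_mul, smul_eq_mul]; ring
      norm_map' := by
        intro x
        change ‖(hm x).toLp‖ = _
        rw [Lp.norm_toLp, eLp_exp, Lp.norm_def] }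
  have hV0 : ∀ x, (⇑(V0 x) : ℝ → ℂ) =ᵐ[volume] fun u => (Real.exp (u/2) : ℂ) * x (Real.exp u) :=
    fun x => (hm x).coeFn_toLp
  have hs : Function.Surjective V0 := by
    intro f
    have e : (fun u : ℝ => (Real.exp (u/2) : ℂ) *
        ((Real.exp (-(Real.log (Real.exp u))/2) : ℂ) * f (Real.log (Real.exp u)))) = f := by
      ext u
      rw [Real.log_exp, ← mul_assoc, ← Complex.ofReal_mul, ← Real.exp_add]
      ring_nf; simp
    have hx : MemLp (fun t : ℝ => (Real.exp (-(Real.log t)/2) : ℂ) * f (Real.log t)) 2 m0 := by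
      refine ⟨?_, ?_⟩
      · refine Measurable.aestronglyMeasurable (Measurable.mul (by fun_prop) ?_)
        exact (Lp.stronglyMeasurable f).measurable.comp Real.measurable_log
      · rw [← eLp_exp, e]; exact (Lp.memLp f).2
    refine ⟨hx.toLp, ?_⟩
    apply Lp.ext
    filter_upwards [hV0 hx.toLp, qmp_exp.ae hx.coeFn_toLp] with u h1 h2
    rw [h1, h2]
    exact congrFun e u
  exact ⟨LinearIsometryEquiv.ofSurjective V0 hs, hV0⟩


lemma norm_sq_L2 {μ : Measure ℝ} (h : Lp ℂ 2 μ) : ‖h‖ ^ 2 = ∫ t, ‖h t‖ ^ 2 ∂μ := by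
  have h1 : inner ℂ h h = ∫ t, inner ℂ (h t) (h t) ∂μ := L2.inner_def h h
  have h2 : ∀ t, inner ℂ (h t) (h t) = ((‖h t‖ ^ 2 : ℝ) : ℂ) := fun t => by
    rw [inner_self_eq_norm_sq_to_K]; norm_cast
  simp_rw [h2] at h1
  rw [integral_complex_ofReal, inner_self_eq_norm_sq_to_K] at h1
  apply Complex.ofReal_injective
  rw [← h1]
  push_cast
  rfl

lemma integrable_sq_L2 {μ : Measure ℝ} (h : Lp ℂ 2 μ) : Integrable (fun t => ‖h t‖ ^ 2) μ :=
  (Lp.memLp h).integrable_norm_pow (by norm_num)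

lemma int_exp (F : ℝ → ℂ) : ∫ t in Ioi (0:ℝ), F t = ∫ u, (Real.exp u : ℂ) * F (Real.exp u) := by
  have := integral_image_eq_integral_abs_deriv_smul (s := univ) (f := Real.exp) (f' := Real.exp)
    MeasurableSet.univ (fun x _ => (Real.hasDerivAt_exp x).hasDerivWithinAt) Real.exp_injective.injOn F
  simpa [Real.range_exp, abs_of_pos (Real.exp_pos _)] using this

lemma integrable_exp {E : Type*} [NormedAddCommGroup E] [NormedSpace ℝ E] (F : ℝ → E) : IntegrableOn F (Ioi (0:ℝ)) ↔
    Integrable (fun u => Real.exp u • F (Real.exp u)) := by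
  have := integrableOn_image_iff_integrableOn_abs_deriv_smul (s := univ) (f := Real.exp) (f' := Real.exp)
    MeasurableSet.univ (fun x _ => (Real.hasDerivAt_exp x).hasDerivWithinAt) Real.exp_injective.injOn F
  simpa [Real.range_exp, abs_of_pos (Real.exp_pos _)] using this

lemma inner_int {s r : ℂ} (hs : 0 < s.re) (hr : 0 < r.re) :
    ∫ v : ℝ, Complex.exp (v * s) * Complex.exp (-(r * Real.exp v)) = (1 / r) ^ s * Complex.Gamma s := by
  rw [← gamma_complex hs hr, int_exp]
  congr 1; ext v
  rw [← mul_assoc]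
  congr 1
  rw [Complex.cpow_def_of_ne_zero (by exact_mod_cast (Real.exp_pos v).ne'), ← Complex.ofReal_log (Real.exp_pos v).le,
    Real.log_exp, Complex.ofReal_exp, ← Complex.exp_add]
  congr 1; ring

lemma int_half {b : ℝ} (hb : 0 < b) : Integrable (fun v : ℝ => Real.exp (v / 2) * Real.exp (-(b * Real.exp v))) := by
  have := (integrable_exp _).1 (gint_aux (σ := 1/2) (by norm_num) hb)
  refine this.congr (Eventually.of_forall fun v => ?_)
  simp only [smul_eq_mul]
  rw [← mul_assoc, ← Real.exp_mul, ← Real.exp_add]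
  congr 2; ring

lemma cpow_lim (u : ℝ) (s : ℂ) : ((Real.exp (-u) : ℂ) * Complex.I) ^ s =
    Complex.exp (-(u * s)) * Complex.exp (Complex.I * Real.pi / 2 * s) := by
  have h0 : (Real.exp (-u) : ℂ) * Complex.I ≠ 0 := by
    refine mul_ne_zero ?_ Complex.I_ne_zero
    exact_mod_cast (Real.exp_pos _).ne'
  rw [Complex.cpow_def_of_ne_zero h0, Complex.log_ofReal_mul (Real.exp_pos _) Complex.I_ne_zero,
    Real.log_exp, Complex.log_I, ← Complex.exp_add]
  congr 1; push_cast; ring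

lemma cpow_bound {ε : ℝ} (u : ℝ) {s : ℂ} (hs : s.re = 1/2) :
    ‖(1 / ((ε:ℂ) - Complex.I * Real.exp u)) ^ s‖ ≤ Real.exp (-(u/2)) * Real.exp (Real.pi * |s.im|) := by
  refine (Complex.norm_cpow_le _ _).trans ?_
  rw [div_eq_mul_inv, ← Real.exp_neg, hs]
  have h1 : ‖(1 / ((ε:ℂ) - Complex.I * Real.exp u))‖ ≤ Real.exp (-u) := by
    rw [norm_div, norm_one, Real.exp_neg, one_div]
    refine inv_anti₀ (Real.exp_pos _) ?_
    have := Complex.abs_im_le_norm ((ε:ℂ) - Complex.I * Real.exp u)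
    have h2 : ((ε:ℂ) - Complex.I * Real.exp u).im = -Real.exp u := by
      rw [Complex.sub_im, Complex.ofReal_im, mul_comm, Complex.im_ofReal_mul, Complex.I_im]; ring
    rwa [h2, abs_neg, abs_of_pos (Real.exp_pos u)] at this
  gcongr
  · calc _ ≤ (Real.exp (-u)) ^ (1/2:ℝ) := by gcongr
      _ = _ := by rw [← Real.exp_mul]; congr 1; ring
  · have h2 := Complex.abs_arg_le_pi (1 / ((ε:ℂ) - Complex.I * Real.exp u))
    calc _ ≤ |Complex.arg (1 / ((ε:ℂ) - Complex.I * Real.exp u)) * s.im| := neg_le_abs _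
      _ ≤ _ := by rw [abs_mul]; gcongr


lemma fub (f : ℝ → ℂ) (fc : Continuous f) (fs : HasCompactSupport f) {ε : ℝ} (hε : 0 < ε) (ω : ℝ) :
    ∫ v : ℝ, Complex.exp (↑(-2 * Real.pi * v * ω) * Complex.I) * ((Real.exp (-(ε * Real.exp v)) : ℂ) *
      ((Real.sqrt (2 * Real.pi) : ℂ)⁻¹ * ∫ u : ℝ, f u * (Real.exp ((u + v)/2) : ℂ) *
        Complex.exp (Complex.I * Real.exp v * Real.exp u))) =
    (Real.sqrt (2 * Real.pi) : ℂ)⁻¹ * ∫ u : ℝ, f u * (Real.exp (u/2) : ℂ) *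
      ((1 / ((ε:ℂ) - Complex.I * Real.exp u)) ^ (1/2 - 2 * Real.pi * ω * Complex.I : ℂ) *
        Complex.Gamma (1/2 - 2 * Real.pi * ω * Complex.I)) := by
  have h0 : ∀ v u : ℝ, Complex.exp (↑(-2 * Real.pi * v * ω) * Complex.I) * ((Real.exp (-(ε * Real.exp v)) : ℂ) *
      ( (f u * (Real.exp ((u + v)/2) : ℂ) *
        Complex.exp (Complex.I * Real.exp v * Real.exp u)))) =
      f u * (Real.exp (u/2) : ℂ) * (Complex.exp (v * (1/2 - 2 * Real.pi * ω * Complex.I : ℂ)) *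
        Complex.exp (-(((ε:ℂ) - Complex.I * Real.exp u) * Real.exp v))) := by
    intro v u
    have : Complex.exp (↑(-2 * Real.pi * v * ω) * Complex.I) * ((Real.exp (-(ε * Real.exp v)) : ℂ) *
      ((Real.exp ((u + v)/2) : ℂ) * Complex.exp (Complex.I * Real.exp v * Real.exp u))) =
      (Real.exp (u/2) : ℂ) * (Complex.exp (v * (1/2 - 2 * Real.pi * ω * Complex.I : ℂ)) *
        Complex.exp (-(((ε:ℂ) - Complex.I * Real.exp u) * Real.exp v))) := by
      rw [Complex.ofReal_exp (-(ε * Real.exp v)), Complex.ofReal_exp ((u+v)/2), Complex.ofReal_exp (u/2)]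
      simp only [← Complex.exp_add]
      congr 1
      push_cast
      ring
    linear_combination f u * this
  have hfi : Integrable (fun u : ℝ => ‖f u‖ * Real.exp (u/2)) := by
    refine Continuous.integrable_of_hasCompactSupport (by fun_prop) ?_
    exact (fs.norm).mul_right
  calc _ = (Real.sqrt (2 * Real.pi) : ℂ)⁻¹ * ∫ v : ℝ, ∫ u : ℝ,
      f u * (Real.exp (u/2) : ℂ) * (Complex.exp (v * (1/2 - 2 * Real.pi * ω * Complex.I : ℂ)) *
        Complex.exp (-(((ε:ℂ) - Complex.I * Real.exp u) * Real.exp v))) := by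
        rw [← integral_const_mul]
        congr 1; ext v
        simp_rw [← h0]
        rw [integral_const_mul, integral_const_mul]
        ring
    _ = (Real.sqrt (2 * Real.pi) : ℂ)⁻¹ * ∫ u : ℝ, ∫ v : ℝ,
      f u * (Real.exp (u/2) : ℂ) * (Complex.exp (v * (1/2 - 2 * Real.pi * ω * Complex.I : ℂ)) *
        Complex.exp (-(((ε:ℂ) - Complex.I * Real.exp u) * Real.exp v))) := by
        congr 1
        apply integral_integral_swap
        refine ((int_half hε).mul_prod hfi).mono' ?_ ?_
        · refine Continuous.aestronglyMeasurable ?_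
          unfold Function.uncurry
          fun_prop
        · refine Eventually.of_forall fun ⟨v, u⟩ => le_of_eq ?_
          simp only [Function.uncurry]
          rw [norm_mul, norm_mul, norm_mul, Complex.norm_exp, Complex.norm_exp, Complex.norm_real,
            Real.norm_of_nonneg (Real.exp_pos _).le, mul_comm]
          congr 3
          · simp; ring
          · rw [← neg_mul, Complex.re_mul_ofReal]; simp
    _ = _ := by
      congr 1; congr 1; ext u
      rw [integral_const_mul, inner_int]
      · simp
      · simpa using hε

lemma fub_lim (f : ℝ → ℂ) (fc : Continuous f) (fs : HasCompactSupport f) (ω : ℝ) :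
    Tendsto (fun n : ℕ => (Real.sqrt (2 * Real.pi) : ℂ)⁻¹ * ∫ u : ℝ, f u * (Real.exp (u/2) : ℂ) *
      ((1 / (((1 / ((n:ℝ) + 1) : ℝ) :ℂ) - Complex.I * Real.exp u)) ^ (1/2 - 2 * Real.pi * ω * Complex.I : ℂ) *
        Complex.Gamma (1/2 - 2 * Real.pi * ω * Complex.I))) atTop (𝓝 (GG ω * 𝓕 f (-ω))) := by
  set s : ℂ := (1/2 - 2 * Real.pi * ω * Complex.I : ℂ) with hs
  have e : GG ω * 𝓕 f (-ω) = (Real.sqrt (2 * Real.pi) : ℂ)⁻¹ * ∫ u : ℝ, f u * (Real.exp (u/2) : ℂ) *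
      (((Real.exp (-u) : ℂ) * Complex.I) ^ s * Complex.Gamma s) := by
    rw [GG, ← hs, Real.fourier_real_eq_integral_exp_smul, mul_assoc, ← integral_const_mul]
    congr 2; ext u
    rw [cpow_lim, smul_eq_mul]
    have : Complex.exp (↑(-2 * Real.pi * u * -ω) * Complex.I) = (Real.exp (u/2) : ℂ) * Complex.exp (-(u * s)) := by
      rw [Complex.ofReal_exp, ← Complex.exp_add, hs]
      congr 1; push_cast; ring
    rw [this]; ring
  rw [e]
  refine Tendsto.const_mul _ ?_
  have hre : s.re = 1/2 := by simp [hs]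
  refine tendsto_integral_of_dominated_convergence
    (fun u => ‖f u‖ * (Real.exp (Real.pi * |s.im|) * ‖Complex.Gamma s‖)) ?_ ?_ ?_ ?_
  · intro n
    refine Continuous.aestronglyMeasurable ?_
    refine Continuous.mul (by fun_prop) (Continuous.mul ?_ continuous_const)
    have hn : (0:ℝ) < 1 / ((n:ℝ) + 1) := by positivity
    have hr : ∀ u : ℝ, (((1 / ((n:ℝ) + 1) : ℝ) :ℂ) - Complex.I * Real.exp u).re = 1 / ((n:ℝ) + 1) := by
      intro u; rw [Complex.sub_re, Complex.ofReal_re, Complex.re_mul_ofReal]; simp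
    have hne : ∀ u : ℝ, (((1 / ((n:ℝ) + 1) : ℝ) :ℂ) - Complex.I * Real.exp u) ≠ 0 := by
      intro u h
      have := hr u; rw [h] at this; simp at this; linarith [this, (by positivity : (0:ℝ) < (n:ℝ) + 1)]
    refine Continuous.cpow (by exact Continuous.div continuous_const (by fun_prop) hne) continuous_const fun u => Or.inl ?_
    rw [one_div, Complex.inv_re, hr]
    exact div_pos hn (Complex.normSq_pos.2 (hne u))
  · exact (fc.norm.integrable_of_hasCompactSupport fs.norm).mul_const _
  · intro n
    refine Eventually.of_forall fun u => ?_
    rw [norm_mul, norm_mul, norm_mul, Complex.norm_real, Real.norm_of_nonneg (Real.exp_pos _).le]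
    calc _ ≤ ‖f u‖ * Real.exp (u/2) * ((Real.exp (-(u/2)) * Real.exp (Real.pi * |s.im|)) * ‖Complex.Gamma s‖) := by
          gcongr
          exact cpow_bound u hre
      _ = (Real.exp (u/2) * Real.exp (-(u/2))) * (‖f u‖ * (Real.exp (Real.pi * |s.im|) * ‖Complex.Gamma s‖)) := by ring
      _ = _ := by rw [← Real.exp_add]; simp
  · refine Eventually.of_forall fun u => ?_
    refine Tendsto.const_mul _ (Tendsto.mul_const _ ?_)
    have he : (1 / ((0:ℂ) - Complex.I * Real.exp u)) = (Real.exp (-u) : ℂ) * Complex.I := by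
      have h1 : (Real.exp u : ℂ) ≠ 0 := by exact_mod_cast (Real.exp_pos u).ne'
      rw [Real.exp_neg, Complex.ofReal_inv, zero_sub, one_div, inv_neg, mul_inv, Complex.inv_I]
      ring
    have hc : ContinuousAt (fun x : ℂ => x ^ s) ((Real.exp (-u) : ℂ) * Complex.I) := by
      refine continuousAt_cpow_const (Or.inr ?_)
      rw [Complex.im_ofReal_mul]; simp
    refine hc.tendsto.comp ?_
    rw [← he]
    refine Tendsto.div tendsto_const_nhds (Tendsto.sub_const ?_ _) ?_
    · have := (Complex.continuous_ofReal.tendsto 0).comp (tendsto_one_div_add_atTop_nhds_zero_nat (𝕜 := ℝ))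
      rw [Complex.ofReal_zero] at this
      exact this
    · rw [zero_sub, neg_ne_zero]
      refine mul_ne_zero Complex.I_ne_zero ?_
      exact_mod_cast (Real.exp_pos u).ne'


lemma core (f : ℝ → ℂ) (fc : Continuous f) (fs : HasCompactSupport f)
    (g : Lp ℂ 2 (volume : Measure ℝ))
    (hg : (⇑g : ℝ → ℂ) =ᵐ[volume] fun v => (Real.sqrt (2 * Real.pi) : ℂ)⁻¹ * ∫ u : ℝ, f u * (Real.exp ((u + v)/2) : ℂ) *
        Complex.exp (Complex.I * Real.exp v * Real.exp u)) :
    (⇑(Lp.fourierTransformₗᵢ ℝ ℂ g) : ℝ → ℂ) =ᵐ[volume] fun ω => GG ω * 𝓕 f (-ω) := by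
  set ε : ℕ → ℝ := fun n => 1 / ((n:ℝ) + 1) with hε
  have εpos : ∀ n, 0 < ε n := fun n => by simp only [hε]; positivity
  have εlim : Tendsto ε atTop (𝓝 0) := tendsto_one_div_add_atTop_nhds_zero_nat
  set C : ℝ := ‖(Real.sqrt (2 * Real.pi) : ℂ)⁻¹‖ * ∫ u, ‖f u‖ * Real.exp (u/2) with hC
  have gb : ∀ᵐ v : ℝ, ‖g v‖ ≤ C * Real.exp (v/2) := by
    filter_upwards [hg] with v hv
    rw [hv, norm_mul, hC, mul_assoc]
    gcongr
    rw [← integral_mul_const]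
    refine (norm_integral_le_integral_norm _).trans (le_of_eq ?_)
    congr 1; ext u
    rw [norm_mul, norm_mul, Complex.norm_real, Real.norm_of_nonneg (Real.exp_pos _).le, Complex.norm_exp,
      mul_assoc ‖f u‖, mul_assoc ‖f u‖]
    congr 1
    rw [Complex.re_mul_ofReal, Complex.re_mul_ofReal, Complex.I_re, zero_mul, zero_mul, Real.exp_zero, mul_one,
      ← Real.exp_add]
    congr 1; ring
  have hmeas : ∀ n, AEStronglyMeasurable (fun v => (Real.exp (-(ε n * Real.exp v)) : ℂ) * g v) volume := fun n =>
    AEStronglyMeasurable.mul (by fun_prop) (Lp.aestronglyMeasurable g)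
  have hle : ∀ n v, ‖(Real.exp (-(ε n * Real.exp v)) : ℂ)‖ ≤ 1 := by
    intro n v
    rw [Complex.norm_real, Real.norm_of_nonneg (Real.exp_pos _).le, Real.exp_le_one_iff]
    have := mul_pos (εpos n) (Real.exp_pos v); linarith
  have hmem : ∀ n, MemLp (fun v => (Real.exp (-(ε n * Real.exp v)) : ℂ) * g v) 2 volume := fun n =>
    (Lp.memLp g).of_le (hmeas n) (Eventually.of_forall fun v => by
      rw [norm_mul]; exact mul_le_of_le_one_left (norm_nonneg _) (hle n v))
  have hint : ∀ n, Integrable (fun v => (Real.exp (-(ε n * Real.exp v)) : ℂ) * g v) volume := by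
    intro n
    refine ((int_half (εpos n)).const_mul C).mono' (hmeas n) ?_
    filter_upwards [gb] with v hv
    rw [norm_mul, Complex.norm_real, Real.norm_of_nonneg (Real.exp_pos _).le]
    calc _ ≤ Real.exp (-(ε n * Real.exp v)) * (C * Real.exp (v/2)) := by gcongr
      _ = _ := by ring
  -- convergence in L2
  have hconv : Tendsto (fun n => (hmem n).toLp) atTop (𝓝 g) := by
    rw [tendsto_iff_norm_sub_tendsto_zero]
    have h2 : Tendsto (fun n => ‖(hmem n).toLp - g‖ ^ 2) atTop (𝓝 0) := by
      have e : ∀ n, ‖(hmem n).toLp - g‖ ^ 2 = ∫ v, ‖((Real.exp (-(ε n * Real.exp v)) : ℂ) - 1) * g v‖ ^ 2 := by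
        intro n
        rw [norm_sq_L2]
        refine integral_congr_ae ?_
        filter_upwards [Lp.coeFn_sub (hmem n).toLp g, (hmem n).coeFn_toLp] with v h1 h2
        rw [h1, Pi.sub_apply, h2]
        congr 2; ring
      simp_rw [e]
      have h0 : (0:ℝ) = ∫ v : ℝ, (0:ℝ) := by simp
      rw [h0]
      refine tendsto_integral_of_dominated_convergence (fun v => 4 * ‖g v‖ ^ 2) ?_
        ((integrable_sq_L2 g).const_mul 4) ?_ ?_
      · intro n
        refine AEStronglyMeasurable.pow (AEStronglyMeasurable.norm ?_) 2
        exact AEStronglyMeasurable.mul (by fun_prop) (Lp.aestronglyMeasurable g)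
      · intro n
        refine Eventually.of_forall fun v => ?_
        rw [Real.norm_of_nonneg (by positivity), norm_mul, mul_pow]
        have h1 : ‖(Real.exp (-(ε n * Real.exp v)) : ℂ) - 1‖ ≤ 2 := by
          refine (norm_sub_le _ _).trans ?_
          rw [norm_one]; linarith [hle n v]
        have h2 : ‖(Real.exp (-(ε n * Real.exp v)) : ℂ) - 1‖ ^ 2 ≤ 4 := by
          nlinarith [norm_nonneg ((Real.exp (-(ε n * Real.exp v)) : ℂ) - 1)]
        gcongr
      · refine Eventually.of_forall fun v => ?_
        have hcont : Continuous (fun e : ℝ => ‖((Real.exp (-(e * Real.exp v)) : ℂ) - 1) * g v‖ ^ 2) := by fun_prop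
        have := (hcont.tendsto 0).comp εlim
        simpa [Function.comp_def] using this
    have := (Real.continuous_sqrt.tendsto 0).comp h2
    simpa [Function.comp_def, Real.sqrt_sq (norm_nonneg _)] using this
  have hF := ((Lp.fourierTransformₗᵢ ℝ ℂ).continuous.tendsto g).comp hconv
  obtain ⟨ns, hns, hlim⟩ := (tendstoInMeasure_of_tendsto_Lp hF).exists_seq_tendsto_ae
  have hform : ∀ n, ∀ᵐ ω : ℝ, (Lp.fourierTransformₗᵢ ℝ ℂ (hmem n).toLp) ω =
      (Real.sqrt (2 * Real.pi) : ℂ)⁻¹ * ∫ u : ℝ, f u * (Real.exp (u/2) : ℂ) *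
      ((1 / ((ε n:ℂ) - Complex.I * Real.exp u)) ^ (1/2 - 2 * Real.pi * ω * Complex.I : ℂ) *
        Complex.Gamma (1/2 - 2 * Real.pi * ω * Complex.I)) := by
    intro n
    filter_upwards [fourier_L1L2 (hmem n).toLp ((hint n).congr (hmem n).coeFn_toLp.symm)] with ω hω
    rw [hω, ← fub f fc fs (εpos n) ω, Real.fourier_real_eq_integral_exp_smul]
    refine integral_congr_ae ?_
    filter_upwards [(hmem n).coeFn_toLp, hg] with v h1 h2
    rw [h1, h2, smul_eq_mul]
  filter_upwards [hlim, ae_all_iff.2 hform] with ω h1 h2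
  refine tendsto_nhds_unique h1 ?_
  have := (fub_lim f fc fs ω).comp hns.tendsto_atTop
  refine this.congr fun i => ?_
  simp only [Function.comp]
  rw [h2]


lemma qmp_neg : Measure.QuasiMeasurePreserving (fun t : ℝ => -t) volume volume :=
  (Measure.measurePreserving_neg volume).quasiMeasurePreserving

lemma exists_Phi (T : Lp ℂ 2 m0 →L[ℂ] Lp ℂ 2 m0)
    (hT : ∀ x : Lp ℂ 2 m0, Integrable (⇑x) m0 →
      (⇑(T x) : ℝ → ℂ) =ᵐ[m0] fun t =>
        (Real.sqrt (2 * Real.pi) : ℂ)⁻¹ *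
          ∫ ξ in Ioi (0:ℝ), x ξ * Complex.exp (Complex.I * t * ξ)) :
    ∃ Φ : Lp ℂ 2 m0 ≃ₗᵢ[ℂ] Lp ℂ 2 (volume : Measure ℝ),
      ∀ x, (⇑(Φ (T x)) : ℝ → ℂ) =ᵐ[volume] fun ω => GG ω * (Φ x) (-ω) := by
  obtain ⟨V, hV⟩ := exists_V
  obtain ⟨S, hS⟩ := exists_op (fun _ => 0) GG measurable_const GG_cont.measurable 1 (by simp) GG_le
  have key : ∀ f : Lp ℂ 2 (volume : Measure ℝ),
      Lp.fourierTransformₗᵢ ℝ ℂ (V (T (V.symm f))) = S (Lp.fourierTransformₗᵢ ℝ ℂ f) := by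
    intro f
    have hd := Lp.dense_hasCompactSupport_contDiff (E := ℝ) (F := ℂ) (μ := volume) (p := 2) (by norm_num)
    refine hd.induction (P := fun f => Lp.fourierTransformₗᵢ ℝ ℂ (V (T (V.symm f))) = S (Lp.fourierTransformₗᵢ ℝ ℂ f)) ?_ ?_ f
    · rintro f ⟨f0, hff, fs, fsm⟩
      have fc : Continuous f0 := fsm.continuous
      set x := V.symm f with hx
      have hVx : ∀ᵐ u : ℝ, (Real.exp (u/2) : ℂ) * x (Real.exp u) = f0 u := by
        have := hV x
        rw [hx, V.apply_symm_apply] at this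
        filter_upwards [this, hff] with u h1 h2
        rw [← h1, h2]
      have hx2 : ∀ᵐ u : ℝ, (Real.exp u : ℂ) * x (Real.exp u) = (Real.exp (u/2) : ℂ) * f0 u := by
        filter_upwards [hVx] with u h
        rw [← h, ← mul_assoc, ← Complex.ofReal_mul, ← Real.exp_add]
        ring_nf
      have hxi : Integrable (⇑x) m0 := by
        refine (integrable_exp _).2 ?_
        have : Integrable (fun u : ℝ => (Real.exp (u/2) : ℂ) * f0 u) :=
          Continuous.integrable_of_hasCompactSupport (by fun_prop) fs.mul_left
        refine this.congr ?_
        filter_upwards [hx2] with u h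
        rw [← h, Complex.real_smul]
      have hc := core f0 fc fs (V (T x)) ?_
      · have hfi : Integrable (⇑f) volume :=
          (fc.integrable_of_hasCompactSupport fs).congr hff.symm
        have hF : 𝓕 (⇑f : ℝ → ℂ) = 𝓕 f0 := by
          ext ω
          rw [Real.fourier_real_eq, Real.fourier_real_eq]
          refine integral_congr_ae ?_
          filter_upwards [hff] with u hu
          rw [hu]
        apply Lp.ext
        filter_upwards [hc, hS (Lp.fourierTransformₗᵢ ℝ ℂ f), qmp_neg.ae (fourier_L1L2 f hfi)] with ω h1 h2 h3
        rw [h1, h2, h3, hF]; ring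
      · filter_upwards [hV (T x), qmp_exp.ae (hT x hxi)] with v h1 h2
        rw [h1, h2, int_exp, mul_left_comm, ← integral_const_mul]
        congr 1
        refine integral_congr_ae ?_
        filter_upwards [hx2] with u h
        rw [← mul_assoc (Real.exp u : ℂ), h, add_div, Real.exp_add]
        push_cast; ring
    · exact isClosed_eq (by fun_prop) (by fun_prop)
  refine ⟨V.trans (Lp.fourierTransformₗᵢ ℝ ℂ), fun x => ?_⟩
  have := key (V x)
  rw [V.symm_apply_apply] at this
  simp only [LinearIsometryEquiv.trans_apply]
  rw [this]
  filter_upwards [hS (Lp.fourierTransformₗᵢ ℝ ℂ (V x))] with ω h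
  rw [h]; ring


lemma seg_mem_iff (w : ℂ) : w ∈ segment ℝ 0 (Complex.I / 2) ↔
    ∃ k : ℝ, 0 ≤ k ∧ k ≤ 1/2 ∧ w = (k : ℂ) * Complex.I := by
  rw [segment_eq_image]
  constructor
  · rintro ⟨t, ⟨h0, h1⟩, rfl⟩
    refine ⟨t/2, by linarith, by linarith, ?_⟩
    simp
    ring
  · rintro ⟨k, h0, h1, rfl⟩
    refine ⟨2*k, ⟨by linarith, by linarith⟩, ?_⟩
    simp
    ring

lemma seg_compact : IsCompact (segment ℝ (0:ℂ) (Complex.I / 2)) := by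
  rw [segment_eq_image]
  exact isCompact_Icc.image (by fun_prop)

lemma seg_nonempty : (segment ℝ (0:ℂ) (Complex.I / 2)).Nonempty := ⟨0, left_mem_segment _ _ _⟩

lemma exp_quarter_sq : (Complex.exp (Complex.I * Real.pi / 4))^2 = Complex.I := by
  rw [← Complex.exp_nat_mul]
  have : ((2:ℕ):ℂ) * (Complex.I * Real.pi / 4) = Real.pi / 2 * Complex.I := by push_cast; ring
  rw [this, Complex.exp_pi_div_two_mul_I]

lemma dpos (z : ℂ) (hz : z ∉ segment ℝ (-(Complex.exp (Complex.I * Real.pi / 4) / (Real.sqrt 2 : ℂ)))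
      (Complex.exp (Complex.I * Real.pi / 4) / (Real.sqrt 2 : ℂ))) :
    0 < Metric.infDist (z ^ 2) (segment ℝ 0 (Complex.I / 2)) := by
  rw [← seg_compact.isClosed.notMem_iff_infDist_pos seg_nonempty]
  intro h
  obtain ⟨k, h0, h1, hk⟩ := (seg_mem_iff _).1 h
  apply hz
  set e := Complex.exp (Complex.I * Real.pi / 4) with he
  have h2 : z^2 = ((Real.sqrt k : ℂ) * e)^2 := by
    rw [mul_pow, exp_quarter_sq, hk, ← Complex.ofReal_pow, Real.sq_sqrt h0]
  have s2 : (Real.sqrt 2 : ℂ) * (Real.sqrt 2 : ℂ) = 2 := by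
    rw [← Complex.ofReal_mul, Real.mul_self_sqrt (by norm_num)]; norm_num
  have s2' : (Real.sqrt 2 : ℂ) ≠ 0 := by intro h; rw [h] at s2; norm_num at s2
  have hb : Real.sqrt k * Real.sqrt 2 ≤ 1 := by
    rw [← Real.sqrt_mul h0]
    exact Real.sqrt_le_one.2 (by linarith)
  have hb0 : 0 ≤ Real.sqrt k * Real.sqrt 2 := by positivity
  have main : ∀ s : ℝ, -1 ≤ s → s ≤ 1 → z = ((s : ℂ) / Real.sqrt 2) * e →
     z ∈ segment ℝ (-(e / (Real.sqrt 2 : ℂ))) (e / (Real.sqrt 2 : ℂ)) := by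
    intro s hs1 hs2 hzs
    rw [segment_eq_image]
    refine ⟨(1+s)/2, ⟨by linarith, by linarith⟩, ?_⟩
    rw [hzs]
    simp
    field_simp
    ring
  rcases sq_eq_sq_iff_eq_or_eq_neg.1 h2 with h | h
  · refine main (Real.sqrt k * Real.sqrt 2) (by linarith) hb ?_
    rw [h]; push_cast; field_simp
  · refine main (-(Real.sqrt k * Real.sqrt 2)) (by linarith) (by linarith) ?_
    rw [h]; push_cast; field_simp

noncomputable def DD (z : ℂ) (ω : ℝ) : ℂ := z^2 - GG ω * GG (-ω)

lemma DD_neg (z : ℂ) (ω : ℝ) : DD z (-ω) = DD z ω := by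
  unfold DD; rw [neg_neg, mul_comm (GG (-ω))]

lemma DD_cont (z : ℂ) : Continuous (DD z) := by
  unfold DD
  have := GG_cont
  fun_prop

lemma DD_ge (z : ℂ) (ω : ℝ) : Metric.infDist (z ^ 2) (segment ℝ 0 (Complex.I / 2)) ≤ ‖DD z ω‖ := by
  unfold DD
  rw [← dist_eq_norm]
  apply Metric.infDist_le_dist_of_mem
  rw [seg_mem_iff]
  refine ⟨_, ?_, ?_, GG_mul ω⟩
  · have := Real.cosh_pos (2 * Real.pi^2 * ω); positivity
  · have := Real.one_le_cosh (2 * Real.pi^2 * ω)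
    rw [div_le_div_iff₀ (by positivity) (by norm_num)]; linarith

lemma exists_Q (z : ℂ) (hd : 0 < Metric.infDist (z ^ 2) (segment ℝ 0 (Complex.I / 2))) :
    ∃ Q : Lp ℂ 2 (volume : Measure ℝ) →L[ℂ] Lp ℂ 2 (volume : Measure ℝ),
     ∀ h, ⇑(Q h) =ᵐ[volume] fun t => (z / DD z t) * h t + (GG t / DD z t) * h (-t) := by
  set d := Metric.infDist (z ^ 2) (segment ℝ 0 (Complex.I / 2)) with hdd
  have hm := (DD_cont z).measurable
  have hG := GG_cont.measurable
  refine exists_op (fun t => z / DD z t) (fun t => GG t / DD z t) (by fun_prop) (by fun_prop)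
    ((‖z‖+1)/d) ?_ ?_
  · intro t
    rw [norm_div]
    have := DD_ge z t
    have := norm_nonneg z
    gcongr
    linarith
  · intro t
    rw [norm_div]
    have := DD_ge z t
    have := norm_nonneg z
    have := GG_le t
    gcongr
    linarith

lemma cs2 (z G b a : ℂ) : ‖z*a+G*b‖^2 ≤ (‖z‖^2+‖G‖^2)*(‖a‖^2+‖b‖^2) := by
  have h1 : ‖z*a+G*b‖ ≤ ‖z‖*‖a‖+‖G‖*‖b‖ := by
    rw [← norm_mul, ← norm_mul]; exact norm_add_le _ _
  calc _ ≤ (‖z‖*‖a‖+‖G‖*‖b‖)^2 := by gcongr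
    _ ≤ _ := by nlinarith [sq_nonneg (‖z‖*‖b‖-‖G‖*‖a‖)]

lemma Q_upper (z : ℂ) (hd : 0 < Metric.infDist (z ^ 2) (segment ℝ 0 (Complex.I / 2)))
    (h : Lp ℂ 2 (volume : Measure ℝ)) (g : Lp ℂ 2 (volume : Measure ℝ))
    (hg : ⇑g =ᵐ[volume] fun t => (z / DD z t) * h t + (GG t / DD z t) * h (-t)) :
    ‖g‖^2 ≤ (2*‖z‖^2+1) / Metric.infDist (z ^ 2) (segment ℝ 0 (Complex.I / 2))^2 * ‖h‖^2 := by
  set d := Metric.infDist (z ^ 2) (segment ℝ 0 (Complex.I / 2)) with hdd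
  have n1 : ∀ g : Lp ℂ 2 (volume : Measure ℝ), 2 * ‖g‖^2 = ∫ t, (‖g t‖^2 + ‖g (-t)‖^2) := by
    intro g
    rw [integral_add (integrable_sq_L2 g) (integrable_sq_L2 g).comp_neg,
      integral_neg_eq_self (fun t => ‖g t‖^2), ← norm_sq_L2 g]
    ring
  have key : 2 * ‖g‖^2 ≤ (2*‖z‖^2+1) / d^2 * (2 * ‖h‖^2) := by
    rw [n1 g, n1 h, ← integral_const_mul]
    apply integral_mono_ae ((integrable_sq_L2 g).add (integrable_sq_L2 g).comp_neg)
      (((integrable_sq_L2 h).add (integrable_sq_L2 h).comp_neg).const_mul _)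
    filter_upwards [hg, qmp_neg.ae hg] with t h1 h2

    simp only [Pi.add_apply]
    rw [h1, h2, DD_neg, neg_neg]
    have e1 : ∀ G a b : ℂ, z / DD z t * a + G / DD z t * b = (z*a+G*b)/ DD z t := by
      intros; ring
    rw [e1, e1, norm_div, norm_div, div_pow, div_pow, ← add_div, div_mul_eq_mul_div]
    have h3 := DD_ge z t
    have c1 := cs2 z (GG t) (h (-t)) (h t)
    have c2 := cs2 z (GG (-t)) (h t) (h (-t))
    have c3 := GG_sum t
    gcongr
    have : ‖GG t‖^2 = 1 - ‖GG (-t)‖^2 := by linarith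
    rw [this] at c1
    linarith
  linarith

lemma inv_left (z : ℂ) (hd : 0 < Metric.infDist (z ^ 2) (segment ℝ 0 (Complex.I / 2)))
    (g h k : Lp ℂ 2 (volume : Measure ℝ))
    (hg : ⇑g =ᵐ[volume] fun t => (z / DD z t) * h t + (GG t / DD z t) * h (-t))
    (hk : ⇑k =ᵐ[volume] fun t => GG t * g (-t)) : z • g - k = h := by
  apply Lp.ext
  filter_upwards [hg, qmp_neg.ae hg, hk, Lp.coeFn_sub (z • g) k, Lp.coeFn_smul z g] with t h1 h2 h3 h4 h5
  have h0 : DD z t ≠ 0 := norm_pos_iff.1 (hd.trans_le (DD_ge z t))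
  simp only [Pi.sub_apply, Pi.smul_apply, smul_eq_mul] at h1 h2 h3 h4 h5
  rw [h4, h5, h3, h2, h1, DD_neg, neg_neg]
  field_simp
  unfold DD
  ring

lemma inv_right (z : ℂ) (hd : 0 < Metric.infDist (z ^ 2) (segment ℝ 0 (Complex.I / 2)))
    (g h k : Lp ℂ 2 (volume : Measure ℝ))
    (hg : ⇑g =ᵐ[volume] fun t => (z / DD z t) * (z • h - k : Lp ℂ 2 (volume : Measure ℝ)) t
        + (GG t / DD z t) * (z • h - k : Lp ℂ 2 (volume : Measure ℝ)) (-t))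
    (hk : ⇑k =ᵐ[volume] fun t => GG t * h (-t)) : g = h := by
  apply Lp.ext
  have hs : ⇑(z • h - k) =ᵐ[volume] fun t => z * h t - GG t * h (-t) := by
    filter_upwards [hk, Lp.coeFn_sub (z • h) k, Lp.coeFn_smul z h] with t h3 h4 h5
    simp only [Pi.sub_apply, Pi.smul_apply, smul_eq_mul] at h3 h4 h5
    rw [h4, h5, h3]
  filter_upwards [hg, hs, qmp_neg.ae hs] with t h1 h2 h3
  have h0 : DD z t ≠ 0 := norm_pos_iff.1 (hd.trans_le (DD_ge z t))

  rw [h1, h2, h3, neg_neg]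
  field_simp
  unfold DD
  ring


lemma two_ind_integral (p r : ℝ) (hr : p ≤ r) (u v : ℝ → ℝ) (hu : Continuous u) (hv : Continuous v) :
    ∫ t, ((Icc p r).indicator u t + (Icc (-r) (-p)).indicator v t) = ∫ t in p..r, (u t + v (-t)) := by
  rw [integral_add, integral_indicator measurableSet_Icc, integral_indicator measurableSet_Icc,
    integral_Icc_eq_integral_Ioc, integral_Icc_eq_integral_Ioc,
    ← intervalIntegral.integral_of_le hr, ← intervalIntegral.integral_of_le (by linarith),
    intervalIntegral.integral_add (hu.intervalIntegrable _ _)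
      ((by fun_prop : Continuous fun t => v (-t)).intervalIntegrable _ _), intervalIntegral.integral_comp_neg]
  · exact (hu.continuousOn.integrableOn_Icc).integrable_indicator measurableSet_Icc
  · exact (hv.continuousOn.integrableOn_Icc).integrable_indicator measurableSet_Icc

lemma localize (φ ψ : ℝ → ℂ) (hφ : Continuous φ) (hψ : Continuous ψ)
    (Q : Lp ℂ 2 (volume : Measure ℝ) →L[ℂ] Lp ℂ 2 (volume : Measure ℝ))
    (hQ : ∀ h, ⇑(Q h) =ᵐ[volume] fun t => φ t * h t + ψ t * h (-t))
    (ρ : ℝ) (hρ : ∀ h, ‖Q h‖^2 ≤ ρ * ‖h‖^2) (a b : ℂ) (p : ℝ) (hp : 0 < p) :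
    ‖φ p * a + ψ p * b‖^2 + ‖φ (-p) * b + ψ (-p) * a‖^2 ≤ ρ * (‖a‖^2 + ‖b‖^2) := by
  set g : ℝ → ℝ := fun t => ‖φ t * a + ψ t * b‖^2 + ‖φ (-t) * b + ψ (-t) * a‖^2 with hg
  have gc : Continuous g := by fun_prop
  have main : ∀ r, p ≤ r → ∫ t in p..r, g t ≤ ρ * ((r-p)*(‖a‖^2+‖b‖^2)) := by
    intro r hr
    set h : Lp ℂ 2 (volume : Measure ℝ) :=
      indicatorConstLp 2 (measurableSet_Icc (a := p) (b := r)) (by simp) a +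
      indicatorConstLp 2 (measurableSet_Icc (a := -r) (b := -p)) (by simp) b with hh
    have h1 : ⇑h =ᵐ[volume] fun t => (Icc p r).indicator (fun _ => a) t +
        (Icc (-r) (-p)).indicator (fun _ => b) t := by
      filter_upwards [Lp.coeFn_add (indicatorConstLp 2 (measurableSet_Icc (a := p) (b := r))
          (by simp : volume _ ≠ ⊤) a)
        (indicatorConstLp 2 (measurableSet_Icc (a := -r) (b := -p)) (by simp : volume _ ≠ ⊤) b),
        indicatorConstLp_coeFn (p := 2) (hs := (measurableSet_Icc (a := p) (b := r)))
          (hμs := (by simp : volume _ ≠ ⊤)) (c := a),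
        indicatorConstLp_coeFn (p := 2) (hs := (measurableSet_Icc (a := -r) (b := -p)))
          (hμs := (by simp : volume _ ≠ ⊤)) (c := b)] with t e1 e2 e3
      rw [hh, e1, Pi.add_apply, e2, e3]
    have n1 : ‖h‖^2 = (r-p)*(‖a‖^2+‖b‖^2) := by
      rw [norm_sq_L2]
      have : ∫ t, ‖h t‖^2 = ∫ t, ((Icc p r).indicator (fun _ => ‖a‖^2) t +
          (Icc (-r) (-p)).indicator (fun _ => ‖b‖^2) t) := by
        apply integral_congr_ae
        filter_upwards [h1] with t e1
        rw [e1]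
        by_cases c1 : t ∈ Icc p r
        · have c2 : t ∉ Icc (-r) (-p) := fun c => by linarith [c.2, c1.1]
          simp [c1, c2]
        · by_cases c2 : t ∈ Icc (-r) (-p) <;> simp [c1, c2]
      rw [this, two_ind_integral p r hr _ _ continuous_const continuous_const]
      simp
      ring
    have n2 : ‖Q h‖^2 = ∫ t in p..r, g t := by
      rw [norm_sq_L2]
      have : ∫ t, ‖Q h t‖^2 = ∫ t, ((Icc p r).indicator (fun t => ‖φ t * a + ψ t * b‖^2) t +
          (Icc (-r) (-p)).indicator (fun t => ‖φ t * b + ψ t * a‖^2) t) := by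
        apply integral_congr_ae
        filter_upwards [hQ h, h1, qmp_neg.ae h1] with t e0 e1 e2
        rw [e0, e1, e2]
        by_cases c1 : t ∈ Icc p r
        · have c2 : t ∉ Icc (-r) (-p) := fun c => by linarith [c.2, c1.1]
          have c3 : -t ∉ Icc p r := fun c => by linarith [c.1, c1.1]
          have c4 : -t ∈ Icc (-r) (-p) := ⟨by linarith [c1.2], by linarith [c1.1]⟩
          simp only [indicator_of_mem c1, indicator_of_notMem c2, indicator_of_notMem c3,
            indicator_of_mem c4, add_zero, zero_add]
        · by_cases c2 : t ∈ Icc (-r) (-p)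
          · have c3 : -t ∈ Icc p r := ⟨by linarith [c2.2], by linarith [c2.1]⟩
            have c4 : -t ∉ Icc (-r) (-p) := fun c => by linarith [c.2, c2.2]
            simp only [indicator_of_notMem c1, indicator_of_mem c2, indicator_of_mem c3,
              indicator_of_notMem c4, add_zero, zero_add]
          · have c3 : -t ∉ Icc p r := fun c => c2 ⟨by linarith [c.2], by linarith [c.1]⟩
            have c4 : -t ∉ Icc (-r) (-p) := fun c => c1 ⟨by linarith [c.2], by linarith [c.1]⟩
            simp only [indicator_of_notMem c1, indicator_of_notMem c2, indicator_of_notMem c3,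
              indicator_of_notMem c4, add_zero, mul_zero, norm_zero]
            norm_num
      rw [this, two_ind_integral p r hr _ _ (by fun_prop) (by fun_prop)]
    rw [← n1, ← n2]
    exact hρ h
  by_contra hcon
  push Not at hcon
  obtain ⟨c, hc1, hc2⟩ := exists_between hcon
  have ev : ∀ᶠ t in 𝓝 p, c < g t := gc.continuousAt.eventually (lt_mem_nhds hc2)
  obtain ⟨ε, hε, hb⟩ := Metric.eventually_nhds_iff.1 ev
  have h2 := main (p + ε/2) (by linarith)
  have h3 : ∫ t in p..(p+ε/2), c ≤ ∫ t in p..(p+ε/2), g t := by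
    apply intervalIntegral.integral_mono_on (by linarith) (by simp) (gc.intervalIntegrable _ _)
    intro t ht
    refine (hb ?_).le
    rw [Real.dist_eq, abs_lt]
    constructor <;> linarith [ht.1, ht.2]
  rw [intervalIntegral.integral_const, smul_eq_mul] at h3
  have h4 : (p + ε/2 - p) * c ≤ (p+ε/2-p) * (ρ * (‖a‖^2+‖b‖^2)) := by linarith
  have := le_of_mul_le_mul_left h4 (by linarith)
  linarith

lemma mat_lower (z G G' : ℂ) (R : ℝ) (hG : ‖G‖^2 + ‖G'‖^2 = 1)
    (h : ∀ a b : ℂ, ‖z*a+G*b‖^2 + ‖z*b+G'*a‖^2 ≤ R * (‖a‖^2+‖b‖^2)) :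
    (2*‖z‖^2+1)^2 - 2*‖z^2-G*G'‖^2 ≤ R * (2*‖z‖^2+1) := by
  set β : ℂ := z * (starRingEnd ℂ) G + G' * (starRingEnd ℂ) z with hβ
  set B := ‖β‖^2 with hB
  set α := ‖z‖^2+‖G'‖^2 with hα
  set γ := ‖z‖^2+‖G‖^2 with hγ
  have det : α*γ - B = ‖z^2-G*G'‖^2 := by
    simp only [hα, hγ, hB, hβ, ← Complex.normSq_eq_norm_sq, Complex.normSq_apply]
    simp [pow_two]
    ring
  have quad : ∀ t : ℝ, α*B + γ*t^2+2*t*B ≤ R*(B+t^2) := by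
    intro t
    have := h ((starRingEnd ℂ) β) t
    have e : ‖z*((starRingEnd ℂ) β)+G*t‖^2 + ‖z*t+G'*((starRingEnd ℂ) β)‖^2 = α*B + γ*t^2+2*t*B := by
      simp only [hα, hγ, hB, hβ, ← Complex.normSq_eq_norm_sq, Complex.normSq_apply]
      simp
      ring
    rw [e] at this
    simpa using this
  have hα' : α ≤ R := by
    have := h 1 0
    simp at this
    linarith
  have hγ' : γ ≤ R := by
    have := h 0 1
    simp at this
    linarith
  have hB0 : 0 ≤ B := by positivity
  have hpq : B ≤ (R-α)*(R-γ) := by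
    rcases hB0.eq_or_lt with h0 | h0
    · rw [← h0]; exact mul_nonneg (by linarith) (by linarith)
    · have := discrim_le_zero (a := R-γ) (b := -2*B) (c := (R-α)*B) (fun t => by nlinarith [quad t])
      unfold discrim at this
      have : B * B ≤ B * ((R-α)*(R-γ)) := by nlinarith
      exact le_of_mul_le_mul_left this h0
  rw [← det]
  have hN : α + γ = 2*‖z‖^2+1 := by rw [hα, hγ]; linarith
  rw [← hN]
  have hN0 : 0 < α+γ := by rw [hN]; positivity
  rcases le_or_gt (α+γ) R with h1 | h1
  · nlinarith
  · nlinarith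

lemma lower_all (z : ℂ) (hd : 0 < Metric.infDist (z ^ 2) (segment ℝ 0 (Complex.I / 2)))
    (Q : Lp ℂ 2 (volume : Measure ℝ) →L[ℂ] Lp ℂ 2 (volume : Measure ℝ))
    (hQ : ∀ h, ⇑(Q h) =ᵐ[volume] fun t => (z / DD z t) * h t + (GG t / DD z t) * h (-t))
    (ρ : ℝ) (hρ : ∀ h, ‖Q h‖^2 ≤ ρ * ‖h‖^2) :
    (2 * ‖z‖ ^ 2 + 1) / Metric.infDist (z ^ 2) (segment ℝ 0 (Complex.I / 2)) ^ 2
        - 2 / (2 * ‖z‖ ^ 2 + 1) ≤ ρ := by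
  have D0 : ∀ t, DD z t ≠ 0 := fun t => norm_pos_iff.1 (hd.trans_le (DD_ge z t))
  have c1 : Continuous (fun t => z / DD z t) := continuous_const.div (DD_cont z) D0
  have c2 : Continuous (fun t => GG t / DD z t) := GG_cont.div (DD_cont z) D0
  have step : ∀ ω : ℝ, 0 < ω → (2*‖z‖^2+1)^2 - 2*‖DD z ω‖^2 ≤ (ρ*‖DD z ω‖^2) * (2*‖z‖^2+1) := by
    intro ω hω
    apply mat_lower z (GG ω) (GG (-ω)) _ (GG_sum ω)
    intro a b
    have h := localize _ _ c1 c2 Q hQ ρ hρ a b ω hω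
    have e1 : ∀ G a b : ℂ, z / DD z ω * a + G / DD z ω * b = (z*a+G*b)/ DD z ω := by
      intros; ring
    rw [DD_neg, e1, e1, norm_div, norm_div, div_pow, div_pow, ← add_div, div_le_iff₀] at h
    · linarith
    · have := norm_pos_iff.2 (D0 ω); positivity
  let f : ℝ → ℝ := fun k => ‖z^2 - (k:ℂ)*Complex.I‖^2
  have fc : Continuous f := by fun_prop
  have step2 : Ioo (0:ℝ) (1/2) ⊆ {k | (2*‖z‖^2+1)^2 - 2*f k ≤ (ρ*f k) * (2*‖z‖^2+1)} := by
    rintro k ⟨k0, k1⟩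
    have h1 : 1 < 1/(2*k) := by rw [lt_div_iff₀ (by linarith)]; linarith
    obtain ⟨s, hs0, hs⟩ := Real.cosh_surjOn (show 1/(2*k) ∈ Ici 1 from h1.le)
    have hs0' : 0 < s := by
      rcases (show 0 ≤ s from hs0).eq_or_lt with h | h
      · rw [← h, Real.cosh_zero] at hs; linarith
      · exact h
    have := step (s/(2*Real.pi^2)) (by positivity)
    have e : DD z (s/(2*Real.pi^2)) = z^2 - (k:ℂ)*Complex.I := by
      unfold DD
      rw [GG_mul]
      have : 2*Real.pi^2*(s/(2*Real.pi^2)) = s := by field_simp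
      rw [this, hs]
      have : 1/(2*(1/(2*k))) = k := by field_simp
      rw [this]
    rw [e] at this
    exact this
  have hcl : IsClosed {k | (2*‖z‖^2+1)^2 - 2*f k ≤ (ρ*f k) * (2*‖z‖^2+1)} :=
    isClosed_le (by fun_prop) (by fun_prop)
  have step3 := hcl.closure_subset_iff.2 step2
  rw [closure_Ioo (by norm_num)] at step3
  obtain ⟨y, hy, hyd⟩ := seg_compact.exists_infDist_eq_dist seg_nonempty (z^2)
  obtain ⟨k, k0, k1, rfl⟩ := (seg_mem_iff _).1 hy
  have h := step3 ⟨k0, k1⟩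
  simp only [mem_ofPred_eq, f] at h
  rw [← dist_eq_norm, ← hyd] at h
  set d := Metric.infDist (z ^ 2) (segment ℝ 0 (Complex.I / 2)) with hdd
  have hN : 0 < 2*‖z‖^2+1 := by positivity
  rw [div_sub_div _ _ (by positivity) hN.ne', div_le_iff₀ (by positivity)]
  nlinarith

end Aux

/-- For `z` outside the segment `[−e^{iπ/4}/√2, e^{iπ/4}/√2]`, the operator
`z·I − T` is invertible and, with `d = dist(z², [0, i/2]) > 0`,
`(2|z|²+1)/d² − 2/(2|z|²+1) ≤ ‖(z·I − T)⁻¹‖² ≤ (2|z|²+1)/d²`. -/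
theorem resolvent_bounds_truncated_fourier
    (T : Lp ℂ 2 m0 →L[ℂ] Lp ℂ 2 m0)
    (hT : ∀ x : Lp ℂ 2 m0, Integrable (⇑x) m0 →
      (⇑(T x) : ℝ → ℂ) =ᵐ[m0] fun t =>
        (Real.sqrt (2 * Real.pi) : ℂ)⁻¹ *
          ∫ ξ in Ioi (0:ℝ), x ξ * Complex.exp (Complex.I * t * ξ))
    (z : ℂ)
    (hz : z ∉ segment ℝ (-(Complex.exp (Complex.I * Real.pi / 4) / (Real.sqrt 2 : ℂ)))
      (Complex.exp (Complex.I * Real.pi / 4) / (Real.sqrt 2 : ℂ))) :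
    IsUnit (z • (1 : Lp ℂ 2 m0 →L[ℂ] Lp ℂ 2 m0) - T) ∧
    0 < Metric.infDist (z ^ 2) (segment ℝ 0 (Complex.I / 2)) ∧
    (2 * ‖z‖ ^ 2 + 1) / Metric.infDist (z ^ 2) (segment ℝ 0 (Complex.I / 2)) ^ 2
        - 2 / (2 * ‖z‖ ^ 2 + 1)
      ≤ ‖Ring.inverse (z • (1 : Lp ℂ 2 m0 →L[ℂ] Lp ℂ 2 m0) - T)‖ ^ 2 ∧
    ‖Ring.inverse (z • (1 : Lp ℂ 2 m0 →L[ℂ] Lp ℂ 2 m0) - T)‖ ^ 2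
      ≤ (2 * ‖z‖ ^ 2 + 1) / Metric.infDist (z ^ 2) (segment ℝ 0 (Complex.I / 2)) ^ 2 := by
  have hd := dpos z hz
  obtain ⟨Φ, hΦ⟩ := exists_Phi T hT
  obtain ⟨Q, hQ⟩ := exists_Q z hd
  set A : Lp ℂ 2 m0 →L[ℂ] Lp ℂ 2 m0 := z • (1 : Lp ℂ 2 m0 →L[ℂ] Lp ℂ 2 m0) - T with hA
  let B : Lp ℂ 2 m0 →L[ℂ] Lp ℂ 2 m0 :=
    (Φ.symm.toContinuousLinearEquiv : Lp ℂ 2 (volume : Measure ℝ) →L[ℂ] Lp ℂ 2 m0) ∘L Q ∘L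
      (Φ.toContinuousLinearEquiv : Lp ℂ 2 m0 →L[ℂ] Lp ℂ 2 (volume : Measure ℝ))
  have hB : ∀ x, Φ (B x) = Q (Φ x) := fun x => Φ.apply_symm_apply _
  have hAx : ∀ x, Φ (A x) = z • Φ x - Φ (T x) := by
    intro x
    rw [← map_smul, ← map_sub]
    rfl
  have AB : A * B = 1 := by
    ext1 x
    apply Φ.injective
    change Φ (A (B x)) = Φ x
    rw [hAx]
    refine inv_left z hd _ _ _ ?_ (hΦ (B x))
    rw [hB]
    exact hQ _
  have BA : B * A = 1 := by
    ext1 x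
    apply Φ.injective
    change Φ (B (A x)) = Φ x
    rw [hB, hAx]
    exact inv_right z hd _ _ _ (hQ _) (hΦ x)
  let U : (Lp ℂ 2 m0 →L[ℂ] Lp ℂ 2 m0)ˣ := ⟨A, B, AB, BA⟩
  have hinv : Ring.inverse A = B := Ring.inverse_unit U
  refine ⟨⟨U, rfl⟩, hd, ?_, ?_⟩
  · rw [hinv]
    apply lower_all z hd Q hQ
    intro h
    have e : ‖Q h‖ = ‖B (Φ.symm h)‖ := by
      rw [← Φ.norm_map (B _), hB, Φ.apply_symm_apply]
    have := B.le_opNorm (Φ.symm h)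
    rw [Φ.symm.norm_map] at this
    rw [e, ← mul_pow]
    gcongr
  · rw [hinv]
    have hc : 0 ≤ (2 * ‖z‖ ^ 2 + 1) / Metric.infDist (z ^ 2) (segment ℝ 0 (Complex.I / 2)) ^ 2 := by
      positivity
    have : ‖B‖ ≤ Real.sqrt ((2 * ‖z‖ ^ 2 + 1) /
        Metric.infDist (z ^ 2) (segment ℝ 0 (Complex.I / 2)) ^ 2) := by
      refine B.opNorm_le_bound (Real.sqrt_nonneg _) ?_
      intro x
      have := Q_upper z hd (Φ x) (Q (Φ x)) (hQ _)
      rw [← hB, Φ.norm_map, Φ.norm_map] at this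
      refine abs_le_of_sq_le_sq' ?_ (by positivity) |>.2
      rw [mul_pow, Real.sq_sqrt hc]
      exact this
    calc ‖B‖^2 ≤ _ := by gcongr
      _ = _ := Real.sq_sqrt hc
end

section
/- Let T be the truncated Fourier–Plancherel operator on L²(ℝ⁺). Let ζ be a nonzero point of the segment [−e^{iπ/4}/√2, e^{iπ/4}/√2] and let z = ζ + s·e^{3iπ/4} with s ∈ ℝ, s ≠ 0 (so z lies on the normal to the segment at ζ and z ≠ ζ). Set A(z) = (2|z|² + 1)^{1/2}/2 and B(z) = 4/(2|z|² + 1)^{3/2}. Then z·I − T is invertible and ‖(z·I − T)⁻¹‖ ≤ A(z)/(|ζ|·|z − ζ|); moreover, if in addition |z − ζ| ≤ |ζ|, then also A(z)/(|ζ|·|z − ζ|) − B(z)·|ζ|·|z − ζ| ≤ ‖(z·I − T)⁻¹‖. -/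
open MeasureTheory Set

set_option linter.unusedSectionVars false
set_option linter.unusedSimpArgs false
section Abstract
variable {H : Type*} [NormedAddCommGroup H] [InnerProductSpace ℂ H] [CompleteSpace H]

local notation "⟪" x "," y "⟫" => inner ℂ x y

/-- The structural relations. -/
structure FRel (T S : H →L[ℂ] H) : Prop where
  adj : ∀ x y, ⟪S x, y⟫ = ⟪x, T y⟫
  ts : ∀ x, T (S x) = x - S (T x)
  ss : ∀ x, S (S x) = - T (T x)

lemma FRel.adj' {T S : H →L[ℂ] H} (h : FRel T S) (x y : H) : ⟪T x, y⟫ = ⟪x, S y⟫ := by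
  rw [← inner_conj_symm, ← h.adj, inner_conj_symm]

lemma nsq (x : H) : ((‖x‖:ℂ))^2 = ⟪x, x⟫ := (inner_self_eq_norm_sq_to_K x).symm

lemma FRel.sum_sq {T S : H →L[ℂ] H} (h : FRel T S) (z : ℂ) (x : H) :
    ‖z • x + T x‖^2 + ‖(starRingEnd ℂ z) • x - S x‖^2 = (2*‖z‖^2+1) * ‖x‖^2 := by
  have : (((‖z • x + T x‖^2 + ‖(starRingEnd ℂ z) • x - S x‖^2 : ℝ)) : ℂ)
      = (((2*‖z‖^2+1) * ‖x‖^2 : ℝ) : ℂ) := by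
    push_cast
    rw [← Complex.conj_mul' z, nsq (z • x + T x), nsq (_ - S x), nsq x]
    simp only [inner_add_left, inner_sub_left, inner_add_right, inner_sub_right, inner_smul_left,
      inner_smul_right, h.adj, h.adj', h.ts, Complex.conj_conj]
    ring
  exact_mod_cast this

lemma FRel.skew {T S : H →L[ℂ] H} (h : FRel T S) (x : H) : (⟪x, T (T x)⟫).re = 0 := by
  have h1 : ⟪T (T x), x⟫ = - ⟪x, T (T x)⟫ := by
    rw [h.adj', h.adj', h.ss, inner_neg_right]
  have h2 := congrArg Complex.re h1
  have h3 : (⟪T (T x), x⟫).re = (⟪x, T (T x)⟫).re := by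
    rw [← inner_conj_symm, Complex.conj_re]
  simp only [Complex.neg_re] at h2
  linarith

lemma FRel.low {T S : H →L[ℂ] H} (h : FRel T S) (z : ℂ) (x : H) :
    |(z^2).re| * ‖x‖^2 ≤ ‖⟪z^2 • x - T (T x), x⟫‖ := by
  have h1 : (⟪x, z^2 • x - T (T x)⟫).re = (z^2).re * ‖x‖^2 := by
    rw [inner_sub_right, inner_smul_right, Complex.sub_re, h.skew, ← nsq, ← Complex.ofReal_pow,
      Complex.re_mul_ofReal, sub_zero]
  rw [norm_inner_symm]
  calc _ = |(⟪x, z^2 • x - T (T x)⟫).re| := by rw [h1, abs_mul, abs_of_nonneg (sq_nonneg ‖x‖)]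
    _ ≤ _ := Complex.abs_re_le_norm _

lemma FRel.low' {T S : H →L[ℂ] H} (h : FRel T S) (z : ℂ) (x : H) :
    |(z^2).re| * ‖x‖ ≤ √(2*‖z‖^2+1) * ‖z • x - T x‖ := by
  have h1 : ‖z^2 • x - T (T x)‖ ≤ √(2*‖z‖^2+1) * ‖z • x - T x‖ := by
    have := h.sum_sq z (z • x - T x)
    have e : z • (z • x - T x) + T (z • x - T x) = z^2 • x - T (T x) := by
      simp only [map_sub, map_smul]; module
    rw [e] at this
    apply le_of_sq_le_sq _ (by positivity)
    rw [mul_pow, Real.sq_sqrt (by positivity)]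
    nlinarith [sq_nonneg ‖(starRingEnd ℂ z) • (z • x - T x) - S (z • x - T x)‖]
  refine le_trans ?_ h1
  rcases eq_or_ne x 0 with rfl | hx
  · simp
  have hx : 0 < ‖x‖ := norm_pos_iff.2 hx
  have h2 := (h.low z x).trans (norm_inner_le_norm _ _)
  nlinarith

lemma FRel.isUnit {T S : H →L[ℂ] H} (h : FRel T S) (z : ℂ) (hz : (z^2).re ≠ 0) :
    IsUnit (z • (1 : H →L[ℂ] H) - T) := by
  have h1 : IsUnit ((z • (1 : H →L[ℂ] H) - T) * (z • (1 : H →L[ℂ] H) + T)) := by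
    refine ContinuousLinearMap.isUnit_of_forall_le_norm_inner_map _ (c := ⟨|(z^2).re|, abs_nonneg _⟩)
      (NNReal.coe_pos.1 (abs_pos.2 hz)) ?_
    intro x
    have := h.low z x
    rw [mul_comm] at this
    have e : ((z • (1 : H →L[ℂ] H) - T) * (z • (1 : H →L[ℂ] H) + T)) x = z^2 • x - T (T x) := by
      simp only [mul_apply_eq_comp, sub_apply, add_apply, smul_apply, one_apply_eq_self, map_add, map_smul]
      module
    rw [e]
    exact this
  have hc : Commute (z • (1 : H →L[ℂ] H) - T) (z • (1 : H →L[ℂ] H) + T) := by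
    ext x; simp; module
  exact (hc.isUnit_mul_iff.1 h1).1

lemma approx_aux (P P' : H →L[ℂ] H) (hP : ∀ x y, ⟪P' x, y⟫ = ⟪x, P y⟫) (ρ : ℝ)
    (hρ : ∀ x, ‖x‖ ≤ ρ * ‖P x‖) (g : ℝ) (y : H) :
    (1 - g * ρ^2) * ‖y‖ ≤ ρ^2 * ‖P' (P y) - (g:ℂ) • y‖ := by
  rcases eq_or_ne y 0 with rfl | hy
  · simp
  have hy : 0 < ‖y‖ := norm_pos_iff.2 hy
  have h1 : ‖y‖^2 ≤ ρ^2 * ‖P y‖^2 := by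
    rw [← mul_pow]; exact pow_le_pow_left₀ (norm_nonneg _) (hρ y) 2
  have h2 : ‖P y‖^2 = g * ‖y‖^2 + (⟪P' (P y) - (g:ℂ) • y, y⟫).re := by
    rw [inner_sub_left, hP, inner_smul_left, ← nsq, ← nsq, Complex.sub_re, Complex.conj_ofReal,
      ← Complex.ofReal_pow, ← Complex.ofReal_pow, ← Complex.ofReal_mul, Complex.ofReal_re,
      Complex.ofReal_re]
    ring
  have h3 : (⟪P' (P y) - (g:ℂ) • y, y⟫).re ≤ ‖P' (P y) - (g:ℂ) • y‖ * ‖y‖ :=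
    (Complex.re_le_norm _).trans (norm_inner_le_norm _ _)
  have h4 : ρ^2 * ‖P y‖^2 ≤ ρ^2 * (g * ‖y‖^2 + ‖P' (P y) - (g:ℂ) • y‖ * ‖y‖) := by
    gcongr; rw [h2]; gcongr
  nlinarith

lemma FRel.lower {T S : H →L[ℂ] H} (h : FRel T S) (z : ℂ) (p D gm gp ρ : ℝ)
    (hp0 : 0 ≤ p) (hp : p < 1/2)
    (hz1 : z^2 - (starRingEnd ℂ z)^2 = 2 * Complex.I * p) (hz2 : (‖z‖^2)^2 = D^2 + p^2)
    (hsum : gm + gp = 2*‖z‖^2+1) (hprod : gm * gp = D^2)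
    (hap : ∀ ε > 0, ∃ x : H, x ≠ 0 ∧ ‖T (T x) - (Complex.I * p) • x‖ ≤ ε * ‖x‖)
    (hρ1 : ∀ x, ‖x‖ ≤ ρ * ‖z • x - T x‖)
    (hρ2 : ∀ x, ‖x‖ ≤ ρ * ‖(starRingEnd ℂ z) • x - S x‖) :
    1 ≤ gm * ρ^2 := by
  by_contra! hlt
  set c := starRingEnd ℂ z with hc
  have hzc : z * c = (‖z‖:ℂ)^2 := Complex.mul_conj' z
  have hsum' : (gm:ℂ) + gp = 2 * (z*c) + 1 := by rw [hzc]; exact_mod_cast hsum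
  have hprod' : (gm:ℂ) * gp = (z*c)^2 - p^2 := by
    rw [hzc]; have : gm*gp = (‖z‖^2)^2 - p^2 := by linarith
    exact_mod_cast this
  set N : H →L[ℂ] H := z • (1 : H →L[ℂ] H) - T with hN
  set N' : H →L[ℂ] H := c • (1 : H →L[ℂ] H) - S with hN'
  set κ := 1 - gm*ρ^2 with hκ
  have hκ0 : 0 < κ := by linarith
  have a1 : ∀ y, κ * ‖y‖ ≤ ρ^2 * ‖N' (N y) - (gm:ℂ) • y‖ := by
    apply approx_aux
    · intro x y; simp [hN, hN', inner_sub_left, inner_sub_right, inner_smul_left, inner_smul_right, h.adj, hc, mul_comm]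
    · simpa [hN] using hρ1
  have a2 : ∀ y, κ * ‖y‖ ≤ ρ^2 * ‖N (N' y) - (gm:ℂ) • y‖ := by
    apply approx_aux
    · intro x y; simp [hN, hN', inner_sub_left, inner_sub_right, inner_smul_left, inner_smul_right, h.adj', hc, mul_comm]
    · simpa [hN'] using hρ2
  set L : H →L[ℂ] H := S * T - T * S with hL
  set Q : H →L[ℂ] H := T * T - (Complex.I * p) • (1 : H →L[ℂ] H) with hQ
  have i2 : ∀ x, N' (N (N' (N x) - (gp:ℂ) • x)) - (gm:ℂ) • (N' (N x) - (gp:ℂ) • x) = Q (Q x) := by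
    intro x
    simp only [hN, hN', hQ, mul_apply_eq_comp, sub_apply, add_apply, smul_apply, one_apply_eq_self, map_add, map_sub, map_neg, map_smul, h.ts, h.ss, smul_sub, smul_neg, smul_smul, smul_add]
    match_scalars
    · linear_combination -(z*c)*hsum' + hprod' - p^2 * Complex.I_sq
    · linear_combination z * hsum'
    · linear_combination c * hsum'
    · linear_combination -hsum'
    · linear_combination -hz1
    all_goals ring1
  have i3 : ∀ x, N (N' (L x)) - (gm:ℂ) • L x = - L (N' (N x) - (gp:ℂ) • x) := by
    intro x
    simp only [hN, hN', hL, mul_apply_eq_comp, sub_apply, add_apply, smul_apply, one_apply_eq_self, map_add, map_sub, map_neg, map_smul, h.ts, h.ss, smul_sub, smul_neg, smul_smul, smul_add]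
    match_scalars
    all_goals first | ring1 | linear_combination hsum' | linear_combination -hsum' | linear_combination (-2) * hsum' | linear_combination 2 * hsum'
  have i4 : ∀ x, ‖L x‖^2 + 4 * ‖T (T x)‖^2 = ‖x‖^2 := by
    intro x
    have : (((‖L x‖^2 + 4 * ‖T (T x)‖^2 : ℝ)) : ℂ) = ((‖x‖^2 : ℝ) : ℂ) := by
      push_cast
      rw [nsq, nsq, nsq]
      simp only [hL, sub_apply, mul_apply_eq_comp, inner_sub_left,
        inner_sub_right, h.adj, h.adj', h.ts, h.ss, map_sub, map_neg, inner_neg_right]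
      ring
    exact_mod_cast this
  have b : ∀ x, ‖L x‖ ≤ (ρ^2/κ * (‖L‖ * (ρ^2/κ * ‖Q‖))) * ‖Q x‖ := by
    intro x
    have e1 := a1 (N' (N x) - (gp:ℂ) • x)
    rw [i2] at e1
    have e2 := a2 (L x)
    rw [i3, norm_neg] at e2
    have e3 := L.le_opNorm (N' (N x) - (gp:ℂ) • x)
    have e4 := Q.le_opNorm (Q x)
    calc ‖L x‖ ≤ ρ^2/κ * ‖L (N' (N x) - (gp:ℂ) • x)‖ := by
          rw [div_mul_eq_mul_div, le_div_iff₀ hκ0]; linarith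
      _ ≤ ρ^2/κ * (‖L‖ * ‖(N' (N x) - (gp:ℂ) • x)‖) := by gcongr
      _ ≤ ρ^2/κ * (‖L‖ * (ρ^2/κ * ‖Q (Q x)‖)) := by
          gcongr
          rw [div_mul_eq_mul_div, le_div_iff₀ hκ0]; linarith
      _ ≤ ρ^2/κ * (‖L‖ * (ρ^2/κ * (‖Q‖ * ‖Q x‖))) := by gcongr
      _ = _ := by ring
  set C := (ρ^2/κ * (‖L‖ * (ρ^2/κ * ‖Q‖))) with hC
  have hC0 : 0 ≤ C := by positivity
  have key : ∀ ε > 0, 1 ≤ C^2*ε^2 + 4 * (p+ε)^2 := by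
    intro ε hε
    obtain ⟨x, hx, hxe⟩ := hap ε hε
    have hx : 0 < ‖x‖ := norm_pos_iff.2 hx
    have hQx : ‖Q x‖ ≤ ε * ‖x‖ := by simpa [hQ] using hxe
    have hL1 : ‖L x‖ ≤ C * (ε * ‖x‖) := (b x).trans (by gcongr)
    have hT1 : ‖T (T x)‖ ≤ (p + ε) * ‖x‖ := by
      calc ‖T (T x)‖ = ‖(T (T x) - (Complex.I * p) • x) + (Complex.I * p) • x‖ := by congr 1; module
        _ ≤ ε * ‖x‖ + p * ‖x‖ := by
          refine (norm_add_le _ _).trans (add_le_add hxe ?_)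
          rw [norm_smul]; simp [abs_of_nonneg hp0]
        _ = _ := by ring
    have := i4 x
    have l1 := pow_le_pow_left₀ (norm_nonneg _) hL1 2
    have l2 := pow_le_pow_left₀ (norm_nonneg _) hT1 2
    have : 1 * ‖x‖^2 ≤ (C^2*ε^2 + 4 * (p+ε)^2) * ‖x‖^2 := by nlinarith
    exact le_of_mul_le_mul_right this (by positivity)
  have lim : Filter.Tendsto (fun ε : ℝ => C^2*ε^2 + 4 * (p+ε)^2) (nhdsWithin 0 (Ioi 0))
      (nhds (C^2*0^2 + 4 * (p+0)^2)) := by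
    apply Filter.Tendsto.mono_left _ nhdsWithin_le_nhds
    apply Continuous.tendsto
    fun_prop
  have := ge_of_tendsto lim (by filter_upwards [self_mem_nhdsWithin] with ε hε using key ε hε)
  nlinarith
end Abstract

set_option linter.unusedSectionVars false

section Planch
open scoped FourierTransform ComplexConjugate

lemma fourier_continuous_aux {f : ℝ → ℂ} (hf : Integrable f) : Continuous (𝓕 f) :=
  VectorFourier.fourierIntegral_continuous Real.continuous_fourierChar
    (L := innerₗ ℝ) continuous_inner hf

lemma fourier_L2_eq {f : ℝ → ℂ} (hf : Integrable f) (hf2 : MemLp f 2) :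
    (𝓕 (hf2.toLp f) : Lp ℂ 2 (volume : Measure ℝ)) =ᵐ[volume] 𝓕 f := by
  apply ae_eq_of_integral_contDiff_smul_eq
  · exact (Lp.memLp _).locallyIntegrable (by norm_num)
  · exact (fourier_continuous_aux hf).locallyIntegrable
  intro g g_smooth g_cpt
  have hg₁ : HasCompactSupport (Complex.ofRealCLM ∘ g) := g_cpt.comp_left rfl
  have hg₂ : ContDiff ℝ (↑(⊤:ℕ∞)) (Complex.ofRealCLM ∘ g) := by fun_prop
  set G := hg₁.toSchwartzMap hg₂ with hG
  have h1 := congrArg (fun u => u G) (Lp.fourier_toTemperedDistribution_eq (hf2.toLp f))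
  simp only [TemperedDistribution.fourier_apply, Lp.toTemperedDistribution_apply] at h1
  have h2 : ∫ x, (𝓕 G) x • (hf2.toLp f) x = ∫ x, (𝓕 G) x • f x := by
    apply integral_congr_ae
    filter_upwards [hf2.coeFn_toLp] with x hx
    rw [hx]
  have h3 : ∫ x, (𝓕 G) x • f x = ∫ x, G x • 𝓕 f x := by
    rw [SchwartzMap.fourier_coe]
    have := VectorFourier.integral_fourierIntegral_smul_eq_flip (L := innerₗ ℝ)
      (μ := volume) (ν := volume)
      Real.continuous_fourierChar continuous_inner G.integrable hf
    rw [flip_innerₗ] at this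
    exact this
  rw [h2, h3] at h1
  simpa [hG] using h1.symm

/-- unnormalised Fourier integral -/
noncomputable def Phi (f : ℝ → ℂ) (t : ℝ) : ℂ := ∫ ξ, f ξ * Complex.exp (Complex.I * t * ξ)

lemma Phi_eq (f : ℝ → ℂ) (t : ℝ) : Phi f t = 𝓕 f ((-(2*Real.pi)⁻¹) * t) := by
  rw [Real.fourier_real_eq_integral_exp_smul, Phi]
  congr 1; ext ξ
  rw [smul_eq_mul, mul_comm]
  congr 2
  push_cast
  have : (Real.pi:ℂ) ≠ 0 := by exact_mod_cast Real.pi_ne_zero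
  field_simp

lemma plancherel {f g : ℝ → ℂ} (hf : Integrable f) (hf2 : MemLp f 2) (hg : Integrable g)
    (hg2 : MemLp g 2) : Integrable (fun t => conj (Phi f t) * Phi g t) ∧
    ∫ t, conj (Phi f t) * Phi g t = (2*Real.pi) * ∫ x, conj (f x) * g x := by
  have e : ∀ᵐ x, inner ℂ ((𝓕 (hf2.toLp f) : Lp ℂ 2 (volume : Measure ℝ)) x)
      ((𝓕 (hg2.toLp g) : Lp ℂ 2 (volume : Measure ℝ)) x) = conj (𝓕 f x) * 𝓕 g x := by
    filter_upwards [fourier_L2_eq hf hf2, fourier_L2_eq hg hg2] with x h1 h2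
    rw [h1, h2, RCLike.inner_apply, mul_comm]
  have hi : Integrable (fun x => conj (𝓕 f x) * 𝓕 g x) :=
    (L2.integrable_inner (𝕜 := ℂ) _ _).congr e
  have h1 := Lp.inner_fourier_eq (hf2.toLp f) (hg2.toLp g)
  rw [L2.inner_def, L2.inner_def, integral_congr_ae e] at h1
  have h2 : ∫ x, inner ℂ ((hf2.toLp f) x) ((hg2.toLp g) x) = ∫ x, conj (f x) * g x := by
    apply integral_congr_ae
    filter_upwards [hf2.coeFn_toLp, hg2.coeFn_toLp] with x h1 h2
    rw [h1, h2, RCLike.inner_apply, mul_comm]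
  rw [h2] at h1
  constructor
  · simp only [Phi_eq]
    exact hi.comp_mul_left' (R := (-(2*Real.pi)⁻¹)) (by simp [Real.pi_ne_zero])
  · simp only [Phi_eq]
    rw [Measure.integral_comp_mul_left (fun x => conj (𝓕 f x) * 𝓕 g x), h1]
    simp [abs_of_pos Real.pi_pos]
end Planch

section Link
open scoped ComplexConjugate

lemma dense_int : Dense {x : Lp ℂ 2 m0 | Integrable (⇑x) m0} := by
  refine (Lp.simpleFunc.dense (E := ℂ) (p := 2) (μ := m0) (by norm_num)).mono ?_
  intro x hx
  have h := Lp.simpleFunc.toSimpleFunc_eq_toFun (⟨x, hx⟩ : Lp.simpleFunc ℂ 2 m0)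
  have h2 := Lp.simpleFunc.memLp (⟨x, hx⟩ : Lp.simpleFunc ℂ 2 m0)
  rw [SimpleFunc.memLp_iff_integrable (by norm_num) (by norm_num)] at h2
  exact h2.congr h

/-- extension by zero -/
noncomputable def ext0 (x : ℝ → ℂ) : ℝ → ℂ := (Ioi (0:ℝ)).indicator x

lemma ext0_int {x : ℝ → ℂ} (hx : Integrable x m0) : Integrable (ext0 x) :=
  (integrable_indicator_iff measurableSet_Ioi).2 hx

lemma ext0_mem {x : ℝ → ℂ} (hx : MemLp x 2 m0) : MemLp (ext0 x) 2 :=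
  (memLp_indicator_iff_restrict measurableSet_Ioi).2 hx

lemma Phi_ext0 (x : ℝ → ℂ) (t : ℝ) :
    Phi (ext0 x) t = ∫ ξ in Ioi (0:ℝ), x ξ * Complex.exp (Complex.I * t * ξ) := by
  rw [Phi, ← integral_indicator measurableSet_Ioi]
  congr 1; ext ξ
  by_cases h : ξ ∈ Ioi (0:ℝ) <;> simp [ext0, h]

lemma Phi_ext0_congr {x y : ℝ → ℂ} (h : x =ᵐ[m0] y) : Phi (ext0 x) = Phi (ext0 y) := by
  ext t
  rw [Phi_ext0, Phi_ext0]
  apply integral_congr_ae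
  filter_upwards [h] with ξ hξ
  rw [hξ]

lemma Phi_conj (f : ℝ → ℂ) (t : ℝ) : conj (Phi f t) = Phi (fun x => conj (f x)) (-t) := by
  rw [Phi, Phi, ← integral_conj]
  congr 1; ext ξ
  rw [map_mul, ← Complex.exp_conj]
  simp

lemma Phi_neg (f : ℝ → ℂ) (t : ℝ) : Phi f (-t) = Phi (fun x => f (-x)) t := by
  rw [Phi, Phi, ← integral_neg_eq_self]
  congr 1; ext ξ
  simp

lemma ext0_conj (x : ℝ → ℂ) : (fun ξ => conj (ext0 x ξ)) = ext0 (fun ξ => conj (x ξ)) := by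
  ext ξ
  by_cases h : ξ ∈ Ioi (0:ℝ) <;> simp [ext0, h]

lemma int_exp_s16 {α : Type*} [MeasurableSpace α] {μ : Measure α} {F : α → ℂ} (hF : Integrable F μ)
    {θ : α → ℝ} (hθ : Measurable θ) : Integrable (fun p => F p * Complex.exp (Complex.I * θ p)) μ := by
  refine hF.mul_bdd (c := 1) (by fun_prop) ?_
  filter_upwards with p
  rw [mul_comm, Complex.norm_exp_ofReal_mul_I]

lemma Phi_symm {f g : ℝ → ℂ} (hf : Integrable f) (hg : Integrable g) :
    ∫ t, Phi f t * g t = ∫ ξ, f ξ * Phi g ξ := by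
  have h1 : Integrable (fun p : ℝ × ℝ => (g p.1 * f p.2) * Complex.exp (Complex.I * ((p.1*p.2 : ℝ) : ℂ)))
      (volume.prod volume) := int_exp_s16 (hg.mul_prod hf) (by fun_prop)
  have := integral_integral_swap (f := fun t ξ : ℝ => (g t * f ξ) * Complex.exp (Complex.I * ((t*ξ : ℝ) : ℂ))) h1
  refine Eq.trans ?_ (this.trans ?_)
  · congr 1; ext t
    rw [Phi, ← integral_mul_const]
    congr 1; ext ξ; push_cast; ring_nf
  · congr 1; ext t
    rw [Phi, ← integral_const_mul]
    congr 1; ext ξ; push_cast; ring_nf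

lemma int_ext0 (A B : ℝ → ℂ) : ∫ t, A t * ext0 B t = ∫ t, A t * B t ∂m0 := by
  unfold m0
  rw [← integral_indicator measurableSet_Ioi]
  congr 1; ext ξ
  by_cases h : ξ ∈ Ioi (0:ℝ) <;> simp [ext0, h]

noncomputable abbrev c0 : ℂ := (Real.sqrt (2 * Real.pi) : ℂ)⁻¹

lemma c0_conj : conj c0 = c0 := by simp [c0]

lemma c0_sq : c0 * c0 * (2 * Real.pi) = 1 := by
  have h : ((Real.sqrt (2 * Real.pi) : ℝ):ℂ) * (Real.sqrt (2 * Real.pi) : ℝ) = 2 * Real.pi := by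
    rw [← Complex.ofReal_mul, Real.mul_self_sqrt (by positivity)]; simp
  have hp : (2 * Real.pi : ℂ) ≠ 0 := by simp [Real.pi_ne_zero]
  rw [c0, ← mul_inv, h, inv_mul_cancel₀ hp]

lemma half_line {h : ℝ → ℂ} (hh : Integrable h) :
    (∫ t in Ioi (0:ℝ), h t) + ∫ t in Ioi (0:ℝ), h (-t) = ∫ t, h t := by
  rw [integral_comp_neg_Ioi, neg_zero, add_comm, ← compl_Iic]
  exact integral_add_compl measurableSet_Iic hh

variable (T : Lp ℂ 2 m0 →L[ℂ] Lp ℂ 2 m0)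
    (hT : ∀ x : Lp ℂ 2 m0, Integrable (⇑x) m0 →
      (⇑(T x) : ℝ → ℂ) =ᵐ[m0] fun t =>
        (Real.sqrt (2 * Real.pi) : ℂ)⁻¹ *
          ∫ ξ in Ioi (0:ℝ), x ξ * Complex.exp (Complex.I * t * ξ))

section
include hT

lemma T_form (x : Lp ℂ 2 m0) (hx : Integrable (⇑x) m0) :
    (⇑(T x) : ℝ → ℂ) =ᵐ[m0] fun t => c0 * Phi (ext0 x) t := by
  simp only [Phi_ext0]; exact hT x hx

lemma S_form (y : Lp ℂ 2 m0) (hy : Integrable (⇑y) m0) :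
    (⇑(T.adjoint y) : ℝ → ℂ) =ᵐ[m0] fun t => c0 * Phi (ext0 y) (-t) := by
  have hsy : (⇑(star y) : ℝ → ℂ) =ᵐ[m0] fun t => conj (y t) := Lp.coeFn_star y
  have hyc : Integrable (fun t => conj (y t)) m0 :=
    (LinearIsometryEquiv.integrable_comp_iff Complex.conjLIE).2 hy
  have hs : Integrable (⇑(star y)) m0 := hyc.congr hsy.symm
  have h1 : (⇑(star (T (star y))) : ℝ → ℂ) =ᵐ[m0] fun t => c0 * Phi (ext0 y) (-t) := by
    filter_upwards [Lp.coeFn_star (T (star y)), T_form T hT _ hs] with t h1 h2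
    rw [h1, Pi.star_apply, h2, Complex.star_def, map_mul, c0_conj, Phi_conj, ext0_conj]
    congr 1
    refine congrFun (Phi_ext0_congr ?_) _
    filter_upwards [hsy] with ξ h; rw [h, Complex.conj_conj]
  suffices T.adjoint y = star (T (star y)) by rw [this]; exact h1
  refine dense_int.eq_of_inner_right ℂ ?_
  intro x hx
  rw [ContinuousLinearMap.adjoint_inner_right, L2.inner_def, L2.inner_def]
  have e1 : ∫ t, inner ℂ (T x t) (y t) ∂m0
      = conj (c0 * ∫ t, Phi (ext0 x) t * ext0 (fun t => conj (y t)) t) := by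
    rw [int_ext0, ← integral_const_mul, ← integral_conj]
    apply integral_congr_ae
    filter_upwards [T_form T hT x hx] with t ht
    rw [ht, RCLike.inner_apply]
    simp only [map_mul, c0_conj, Complex.conj_conj]
    ring
  have e2 : ∫ t, inner ℂ (x t) (star (T (star y)) t) ∂m0
      = conj (c0 * ∫ t, ext0 x t * Phi (ext0 (fun t => conj (y t))) t) := by
    simp only [mul_comm (ext0 x _)]
    rw [int_ext0, ← integral_const_mul, ← integral_conj]
    apply integral_congr_ae
    filter_upwards [h1] with t ht
    rw [ht, RCLike.inner_apply]
    simp only [map_mul, c0_conj]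
    rw [Phi_conj, ext0_conj]
    simp only [Complex.conj_conj]
    ring
  rw [e1, e2, Phi_symm (ext0_int hx) (ext0_int hyc)]

lemma frel : FRel T T.adjoint := by
  have key1 : ∀ x y : Lp ℂ 2 m0, Integrable (⇑x) m0 → Integrable (⇑y) m0 →
      inner ℂ (T y) (T x) + inner ℂ (T.adjoint y) (T.adjoint x) = inner ℂ y x := by
    intro x y hx hy
    obtain ⟨p1, p2⟩ := plancherel (ext0_int hy) (ext0_mem (Lp.memLp y)) (ext0_int hx) (ext0_mem (Lp.memLp x))
    simp only [L2.inner_def]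
    have e1 : ∫ t, inner ℂ (T y t) (T x t) ∂m0
        = c0 * c0 * ∫ t in Ioi (0:ℝ), conj (Phi (ext0 y) t) * Phi (ext0 x) t := by
      rw [← integral_const_mul]
      apply integral_congr_ae
      filter_upwards [T_form T hT x hx, T_form T hT y hy] with t h1 h2
      rw [h1, h2, RCLike.inner_apply, map_mul, c0_conj]; ring
    have e2 : ∫ t, inner ℂ (T.adjoint y t) (T.adjoint x t) ∂m0
        = c0 * c0 * ∫ t in Ioi (0:ℝ), conj (Phi (ext0 y) (-t)) * Phi (ext0 x) (-t) := by
      rw [← integral_const_mul]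
      apply integral_congr_ae
      filter_upwards [S_form T hT x hx, S_form T hT y hy] with t h1 h2
      rw [h1, h2, RCLike.inner_apply, map_mul, c0_conj]; ring
    rw [e1, e2, ← mul_add, half_line p1, p2, ← mul_assoc, c0_sq, one_mul, int_ext0]
    apply integral_congr_ae
    filter_upwards [ae_restrict_mem (measurableSet_Ioi (a := (0:ℝ)))] with t ht
    rw [RCLike.inner_apply, ext0, indicator_of_mem ht, mul_comm]
  have key2 : ∀ x y : Lp ℂ 2 m0, Integrable (⇑x) m0 → Integrable (⇑y) m0 →
      inner ℂ (T y) (T.adjoint x) + inner ℂ (T.adjoint y) (T x) = 0 := by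
    intro x y hx hy
    obtain ⟨p1, p2⟩ := plancherel (ext0_int hy) (ext0_mem (Lp.memLp y)) (ext0_int hx).comp_neg
      ((ext0_mem (Lp.memLp x)).comp_measurePreserving (Measure.measurePreserving_neg volume))
    simp only [L2.inner_def]
    have e1 : ∫ t, inner ℂ (T y t) (T.adjoint x t) ∂m0
        = c0 * c0 * ∫ t in Ioi (0:ℝ), conj (Phi (ext0 y) t) * Phi (fun t => ext0 x (-t)) t := by
      rw [← integral_const_mul]
      apply integral_congr_ae
      filter_upwards [S_form T hT x hx, T_form T hT y hy] with t h1 h2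
      rw [h1, h2, RCLike.inner_apply, map_mul, c0_conj, Phi_neg]; ring
    have e2 : ∫ t, inner ℂ (T.adjoint y t) (T x t) ∂m0
        = c0 * c0 * ∫ t in Ioi (0:ℝ), conj (Phi (ext0 y) (-t)) * Phi (fun t => ext0 x (-t)) (-t) := by
      rw [← integral_const_mul]
      apply integral_congr_ae
      filter_upwards [T_form T hT x hx, S_form T hT y hy] with t h1 h2
      rw [h1, h2, RCLike.inner_apply, map_mul, c0_conj, Phi_neg (fun t => ext0 x (-t))]
      simp only [neg_neg]; ring
    have z : ∫ t, conj (ext0 (⇑y) t) * ext0 (⇑x) (-t) = 0 := by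
      rw [← integral_zero ℝ ℂ]
      congr 1; ext t
      by_cases h : t ∈ Ioi (0:ℝ)
      · have : -t ∉ Ioi (0:ℝ) := by simp at h ⊢; linarith
        simp [ext0, this]
      · simp [ext0, h]
    rw [e1, e2, ← mul_add, half_line p1]
    refine (congrArg _ (p2.trans (congrArg _ z))).trans (by simp)
  have t1 : (fun x => T (T.adjoint x)) = fun x => x - T.adjoint (T x) := by
    refine Continuous.ext_on dense_int (by fun_prop) (by fun_prop) ?_
    intro x hx
    refine dense_int.eq_of_inner_right ℂ ?_
    intro y hy
    have := key1 x y hx hy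
    rw [inner_sub_right, ContinuousLinearMap.adjoint_inner_right,
      ← ContinuousLinearMap.adjoint_inner_left]
    linear_combination this
  have t2 : (fun x => T.adjoint (T.adjoint x)) = fun x => - T (T x) := by
    refine Continuous.ext_on dense_int (by fun_prop) (by fun_prop) ?_
    intro x hx
    refine dense_int.eq_of_inner_right ℂ ?_
    intro y hy
    have := key2 x y hx hy
    rw [inner_neg_right, ContinuousLinearMap.adjoint_inner_right,
      ← ContinuousLinearMap.adjoint_inner_left T (T x) y]
    linear_combination this
  exact ⟨fun x y => ContinuousLinearMap.adjoint_inner_left _ _ _, congrFun t1, congrFun t2⟩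

end
end Link

section Kern
open scoped ComplexConjugate
open Filter Topology

lemma Phi_prod (u v : ℝ → ℂ) (t : ℝ) :
    Phi u t * Phi v t = ∫ p : ℝ × ℝ, (u p.1 * v p.2) * Complex.exp (Complex.I * t * (p.1 + p.2))
      ∂(volume.prod volume) := by
  rw [Phi, Phi, ← integral_prod_mul]
  congr 1; ext p
  rw [mul_add, Complex.exp_add]; ring

lemma kern_delta {u v : ℝ → ℂ} (hu : Integrable u) (hv : Integrable v) {δ : ℝ} (hδ : 0 < δ) :
    ∫ t in Ioi (0:ℝ), Complex.exp (-δ * t) * (Phi u t * Phi v t)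
      = ∫ p : ℝ × ℝ, (u p.1 * v p.2) * (1 / (δ - Complex.I * (p.1 + p.2))) ∂(volume.prod volume) := by
  have hre : ∀ p : ℝ × ℝ, (Complex.I * (p.1 + p.2) - δ : ℂ).re < 0 := by
    intro p; simp [hδ]
  have h0 : IntegrableOn (fun t : ℝ => Complex.exp (-δ * t)) (Ioi 0) :=
    integrableOn_exp_mul_complex_Ioi (by simpa using hδ) 0
  have h1 : Integrable (fun q : ℝ × (ℝ × ℝ) => (Complex.exp (-δ * q.1) * (u q.2.1 * v q.2.2))
      * Complex.exp (Complex.I * ((q.1 * (q.2.1+q.2.2) : ℝ) : ℂ)))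
      ((volume.restrict (Ioi 0)).prod (volume.prod volume)) :=
    int_exp_s16 (h0.mul_prod (hu.mul_prod hv)) (by fun_prop)
  have h2 := integral_integral_swap (f := fun (t : ℝ) (p : ℝ × ℝ) => (Complex.exp (-δ * t) * (u p.1 * v p.2))
      * Complex.exp (Complex.I * ((t * (p.1+p.2) : ℝ) : ℂ))) h1
  refine Eq.trans ?_ (h2.trans ?_)
  · congr 1; ext t
    rw [Phi_prod, ← integral_const_mul]
    congr 1; ext p; push_cast; ring_nf
  · congr 1; ext p
    have h3 := integral_exp_mul_complex_Ioi (hre p) 0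
    have : ∀ t : ℝ, (Complex.exp (-δ * t) * (u p.1 * v p.2))
      * Complex.exp (Complex.I * ((t * (p.1+p.2) : ℝ) : ℂ)) =
        (u p.1 * v p.2) * Complex.exp ((Complex.I * (p.1 + p.2) - δ) * t) := by
      intro t
      rw [mul_comm (Complex.exp _), mul_assoc, ← Complex.exp_add]
      congr 2; push_cast; ring
    simp only [this]
    rw [integral_const_mul, h3]
    congr 1
    rw [Complex.ofReal_zero, mul_zero, Complex.exp_zero, ← neg_sub, neg_div_neg_eq]

lemma kern {u v : ℝ → ℂ} (hu : Integrable u) (hv : Integrable v)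
    (hu0 : ∀ x ≤ 0, u x = 0) (hv0 : ∀ x < 1, v x = 0)
    (hi : IntegrableOn (fun t => Phi u t * Phi v t) (Ioi 0)) :
    ∫ t in Ioi (0:ℝ), Phi u t * Phi v t
      = ∫ p : ℝ × ℝ, (u p.1 * v p.2) * (Complex.I / (p.1 + p.2)) ∂(volume.prod volume) := by
  have hW := hu.mul_prod hv
  have l1 : Tendsto (fun δ : ℝ => ∫ t in Ioi (0:ℝ), Complex.exp (-δ * t) * (Phi u t * Phi v t))
      (𝓝[>] 0) (𝓝 (∫ t in Ioi (0:ℝ), Phi u t * Phi v t)) := by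
    refine tendsto_integral_filter_of_dominated_convergence (fun t => ‖Phi u t * Phi v t‖) ?_ ?_ hi.norm ?_
    · filter_upwards with δ
      exact (Continuous.aestronglyMeasurable (by fun_prop)).mul hi.aestronglyMeasurable
    · filter_upwards [self_mem_nhdsWithin] with δ hδ
      filter_upwards [ae_restrict_mem measurableSet_Ioi] with t ht
      rw [norm_mul]
      refine mul_le_of_le_one_left (norm_nonneg _) ?_
      rw [Complex.norm_exp]
      simp only [mem_Ioi] at hδ ht
      have : 0 ≤ δ * t := by positivity
      simpa using this
    · filter_upwards with t
      have : Tendsto (fun δ : ℝ => Complex.exp (-δ * t) * (Phi u t * Phi v t)) (𝓝 0)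
        (𝓝 (Complex.exp (-(0:ℝ) * t) * (Phi u t * Phi v t))) := by
        apply Continuous.tendsto (f := fun δ : ℝ => Complex.exp (-δ * t) * (Phi u t * Phi v t))
        fun_prop
      simp only [Complex.ofReal_zero, neg_zero, zero_mul, Complex.exp_zero, one_mul] at this
      exact this.mono_left nhdsWithin_le_nhds
  have l2 : Tendsto (fun δ : ℝ => ∫ p : ℝ × ℝ, (u p.1 * v p.2) * (1 / (δ - Complex.I * (p.1 + p.2))) ∂(volume.prod volume))
      (𝓝[>] 0) (𝓝 (∫ p : ℝ × ℝ, (u p.1 * v p.2) * (Complex.I / (p.1 + p.2)) ∂(volume.prod volume))) := by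
    refine tendsto_integral_filter_of_dominated_convergence (fun p => ‖u p.1 * v p.2‖) ?_ ?_ hW.norm ?_
    · filter_upwards with δ
      refine hW.aestronglyMeasurable.mul (Measurable.aestronglyMeasurable (by fun_prop))
    · filter_upwards with δ
      filter_upwards with p
      by_cases h1 : p.1 ≤ 0
      · simp [hu0 _ h1]
      by_cases h2 : p.2 < 1
      · simp [hv0 _ h2]
      rw [norm_mul]
      refine mul_le_of_le_one_right (norm_nonneg _) ?_
      rw [norm_div, norm_one]
      refine div_le_one_of_le₀ ?_ (norm_nonneg _)
      refine le_trans ?_ (Complex.abs_im_le_norm _)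
      simp only [Complex.sub_im, Complex.ofReal_im, Complex.mul_im, Complex.I_re, Complex.I_im, Complex.add_re, Complex.ofReal_re]
      rw [le_abs]; right; simp; linarith
    · filter_upwards with p
      by_cases h1 : p.1 ≤ 0
      · simp [hu0 _ h1]
      by_cases h2 : p.2 < 1
      · simp [hv0 _ h2]
      have hne : ((p.1 : ℂ) + p.2) ≠ 0 := by
        rw [← Complex.ofReal_add]
        exact_mod_cast (by linarith : (0:ℝ) < p.1 + p.2).ne'
      have : Tendsto (fun δ : ℝ => (u p.1 * v p.2) * (1 / (δ - Complex.I * (p.1 + p.2)))) (𝓝 0)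
        (𝓝 ((u p.1 * v p.2) * (1 / ((0:ℝ) - Complex.I * (p.1 + p.2))))) := by
        refine Tendsto.const_mul _ (Tendsto.div tendsto_const_nhds ?_ ?_)
        · apply Continuous.tendsto (f := fun δ : ℝ => (δ - Complex.I * (p.1 + p.2) : ℂ))
          fun_prop
        · simpa using hne
      convert this.mono_left nhdsWithin_le_nhds using 3
      have := Complex.I_ne_zero
      rw [Complex.ofReal_zero, zero_sub]
      field_simp
      simp
  refine tendsto_nhds_unique l1 (l2.congr' ?_)
  filter_upwards [self_mem_nhdsWithin] with δ hδ
  exact (kern_delta hu hv hδ).symm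

end Kern

section TT
open scoped ComplexConjugate
open Filter Topology

lemma TT_form (T : Lp ℂ 2 m0 →L[ℂ] Lp ℂ 2 m0)
    (hT : ∀ x : Lp ℂ 2 m0, Integrable (⇑x) m0 →
      (⇑(T x) : ℝ → ℂ) =ᵐ[m0] fun t =>
        (Real.sqrt (2 * Real.pi) : ℂ)⁻¹ *
          ∫ ξ in Ioi (0:ℝ), x ξ * Complex.exp (Complex.I * t * ξ))
    (x w : Lp ℂ 2 m0) (f : ℝ → ℂ) (hxf : x =ᵐ[m0] f) (hf : Integrable f) (hf0 : ∀ ξ < 1, f ξ = 0)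
    (hw : w =ᵐ[m0] fun η => (2 * Real.pi : ℂ)⁻¹ * ∫ ξ, f ξ / (ξ + η)) :
    T (T x) = Complex.I • w := by
  have hfe : ext0 f = f := by
    ext ξ
    by_cases h : ξ ∈ Ioi (0:ℝ)
    · simp [ext0, h]
    · simp [ext0, h]; rw [hf0]; simp at h; linarith
  have hx : Integrable (⇑x) m0 := (hf.mono_measure Measure.restrict_le_self).congr hxf.symm
  refine dense_int.eq_of_inner_right ℂ ?_
  intro y hy
  have hyc : Integrable (fun t => conj (y t)) m0 :=
    (LinearIsometryEquiv.integrable_comp_iff Complex.conjLIE).2 hy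
  set u := ext0 (fun t => conj (y t)) with hu
  have hui : Integrable u := ext0_int hyc
  have hu0 : ∀ x ≤ 0, u x = 0 := by
    intro x hx; simp [hu, ext0, hx]
  rw [← ContinuousLinearMap.adjoint_inner_left T (T x) y, inner_smul_right, L2.inner_def, L2.inner_def]
  have ae1 : (fun t => (inner ℂ (T.adjoint y t) (T x t) : ℂ)) =ᵐ[m0] fun t => c0 * c0 * (Phi u t * Phi f t) := by
    filter_upwards [T_form T hT x hx, S_form T hT y hy] with t h1 h2
    rw [h1, h2, RCLike.inner_apply, map_mul, c0_conj, Phi_conj, ext0_conj, neg_neg, Phi_ext0_congr hxf, hfe]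
    ring
  have hi : IntegrableOn (fun t => Phi u t * Phi f t) (Ioi 0) := by
    have h1 : Integrable (fun t => (inner ℂ (T.adjoint y t) (T x t) : ℂ)) m0 :=
      L2.integrable_inner (𝕜 := ℂ) (T.adjoint y) (T x)
    have h2 := (h1.congr ae1).const_mul (2 * Real.pi)
    refine h2.congr ?_
    filter_upwards with t
    linear_combination (Phi u t * Phi f t) * c0_sq
  have hk := kern hui hf hu0 hf0 hi
  have hi2 : Integrable (fun p : ℝ × ℝ => (u p.1 * f p.2) * (Complex.I / (p.1 + p.2))) (volume.prod volume) := by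
    refine (hui.mul_prod hf).mono ((hui.mul_prod hf).aestronglyMeasurable.mul (Measurable.aestronglyMeasurable (by fun_prop))) ?_
    filter_upwards with p
    by_cases h1 : p.1 ≤ 0
    · simp [hu0 _ h1]
    by_cases h2 : p.2 < 1
    · simp [hf0 _ h2]
    rw [norm_mul]
    refine mul_le_of_le_one_right (norm_nonneg _) ?_
    rw [norm_div, Complex.norm_I, ← Complex.ofReal_add, Complex.norm_real]
    refine div_le_one_of_le₀ ?_ (norm_nonneg _)
    refine le_trans ?_ (le_abs_self _)
    linarith
  rw [integral_congr_ae ae1, integral_const_mul]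
  have : ∫ t, Phi u t * Phi f t ∂m0 = ∫ t in Ioi 0, Phi u t * Phi f t := rfl
  rw [this, hk, integral_prod _ hi2, ← integral_const_mul, ← integral_const_mul]
  have hcc : c0 * c0 = (2 * Real.pi : ℂ)⁻¹ := by
    have := c0_sq
    exact eq_inv_of_mul_eq_one_left this
  trans ∫ η : ℝ, (Complex.I * ((2 * Real.pi : ℂ)⁻¹ * ∫ ξ, f ξ / (ξ + η))) * u η
  · congr 1; ext η
    have : ∀ ξ : ℝ, u η * f ξ * (Complex.I / (η + ξ)) = (u η * Complex.I) * (f ξ / (ξ + η)) := by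
      intro ξ; rw [add_comm (η : ℂ)]; ring
    simp only [this]
    rw [integral_const_mul, hcc]; ring
  · rw [hu, int_ext0]
    apply integral_congr_ae
    filter_upwards [hw] with η h
    rw [h, RCLike.inner_apply]; ring
end TT

section Mellin
open Filter Topology

lemma mellin_aux {s : ℂ} (hs0 : 0 < s.re) (hs1 : s.re < 1) {η : ℝ} (hη : 0 < η) :
    Integrable (fun q : ℝ × ℝ => (q.1 : ℂ) ^ (s - 1) * Complex.exp (-(q.2 * (q.1 + η))))
      ((volume.restrict (Ioi 0)).prod (volume.restrict (Ioi 0))) := by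
  have hn : ∀ ξ r : ℝ, 0 < ξ → ‖(ξ : ℂ) ^ (s - 1) * Complex.exp (-(r * (ξ + η)))‖
      = Real.exp (-(r * η)) * (ξ ^ (s.re - 1) * Real.exp (-(r * ξ))) := by
    intro ξ r hξ
    rw [norm_mul, Complex.norm_cpow_eq_rpow_re_of_pos hξ, Complex.norm_exp]
    have : (-(r * (ξ + η)) : ℂ).re = -(r * η) + -(r * ξ) := by
      rw [← Complex.ofReal_add, ← Complex.ofReal_mul, Complex.neg_re, Complex.ofReal_re]; ring
    rw [this, Real.exp_add]; simp; ring
  have hm : AEStronglyMeasurable (fun q : ℝ × ℝ => (q.1 : ℂ) ^ (s - 1) * Complex.exp (-(q.2 * (q.1 + η))))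
      ((volume.restrict (Ioi 0)).prod (volume.restrict (Ioi 0))) := by
    apply Measurable.aestronglyMeasurable
    fun_prop
  rw [integrable_prod_iff' hm]
  constructor
  · filter_upwards [ae_restrict_mem (measurableSet_Ioi (a := (0:ℝ)))] with r hr
    have h1 := (integrableOn_rpow_mul_exp_neg_mul_rpow (p := 1) (s := s.re - 1) (b := r) (by linarith) one_pos hr).const_mul
      (Real.exp (-(r * η)))
    refine h1.mono (Measurable.aestronglyMeasurable (by fun_prop)) ?_
    filter_upwards [ae_restrict_mem (measurableSet_Ioi (a := (0:ℝ)))] with ξ hξ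
    rw [hn ξ r hξ]
    refine le_of_eq_of_le ?_ (le_abs_self _)
    simp
  · have h1 := (integrableOn_rpow_mul_exp_neg_mul_rpow (p := 1) (s := -s.re) (b := η) (by linarith) one_pos hη).const_mul
      (Real.Gamma s.re)
    refine h1.congr ?_
    filter_upwards [ae_restrict_mem (measurableSet_Ioi (a := (0:ℝ)))] with r hr
    rw [setIntegral_congr_fun measurableSet_Ioi (fun ξ hξ => hn ξ r hξ), integral_const_mul,
      Real.integral_rpow_mul_exp_neg_mul_Ioi hs0 hr, Real.rpow_neg (le_of_lt hr), one_div, Real.inv_rpow (le_of_lt hr), Real.rpow_one]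
    ring_nf

lemma mellin_in {s : ℂ} {η ξ : ℝ} (hη : 0 < η) (hξ : 0 < ξ) :
    ∫ r in Ioi (0:ℝ), (ξ : ℂ) ^ (s - 1) * Complex.exp (-(r * (ξ + η))) = (ξ : ℂ) ^ (s - 1) / (ξ + η) := by
  have hre : (-(ξ + η) : ℂ).re < 0 := by simp; linarith
  have h3 := integral_exp_mul_complex_Ioi hre 0
  rw [integral_const_mul]
  have : ∀ r : ℝ, Complex.exp (-(r * (ξ + η))) = Complex.exp (-(ξ + η) * r) := by
    intro r; congr 1; ring
  simp only [this]
  rw [h3, Complex.ofReal_zero, mul_zero, Complex.exp_zero, neg_div_neg_eq, mul_one_div]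

lemma mellin_int {s : ℂ} (hs0 : 0 < s.re) (hs1 : s.re < 1) {η : ℝ} (hη : 0 < η) :
    IntegrableOn (fun ξ : ℝ => (ξ : ℂ) ^ (s - 1) / (ξ + η)) (Ioi 0) := by
  refine (mellin_aux hs0 hs1 hη).integral_prod_left.congr ?_
  filter_upwards [ae_restrict_mem (measurableSet_Ioi (a := (0:ℝ)))] with ξ hξ
  exact mellin_in hη hξ

lemma mellin_eq {s : ℂ} (hs0 : 0 < s.re) (hs1 : s.re < 1) {η : ℝ} (hη : 0 < η) :
    ∫ ξ in Ioi (0:ℝ), (ξ : ℂ) ^ (s - 1) / (ξ + η) = (η : ℂ) ^ (s - 1) * (Real.pi / Complex.sin (Real.pi * s)) := by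
  rw [← setIntegral_congr_fun measurableSet_Ioi (fun ξ hξ => mellin_in (s := s) hη hξ)]
  rw [integral_integral_swap (f := fun (ξ r : ℝ) => (ξ : ℂ) ^ (s - 1) * Complex.exp (-(r * (ξ + η))))
    (mellin_aux hs0 hs1 hη)]
  have : ∀ r ∈ Ioi (0:ℝ), ∫ ξ in Ioi (0:ℝ), (ξ : ℂ) ^ (s - 1) * Complex.exp (-(r * (ξ + η)))
      = Complex.Gamma s * ((r:ℂ) ^ ((1 - s) - 1) * Complex.exp (-(η * r))) := by
    intro r hr
    have e : ∀ ξ : ℝ, (ξ : ℂ) ^ (s - 1) * Complex.exp (-(r * (ξ + η))) =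
      Complex.exp (-(η * r)) * ((ξ : ℂ) ^ (s - 1) * Complex.exp (-(r * ξ))) := by
      intro ξ
      rw [mul_left_comm, ← Complex.exp_add]; congr 2; ring
    simp only [e]
    rw [integral_const_mul, Complex.integral_cpow_mul_exp_neg_mul_Ioi hs0 hr]
    have : (1 / (r:ℂ)) ^ s = (r:ℂ) ^ ((1 - s) - 1) := by
      rw [one_div, Complex.inv_cpow _ _ (by rw [Complex.arg_ofReal_of_nonneg (le_of_lt hr)]; exact Real.pi_pos.ne), ← Complex.cpow_neg]
      congr 1; ring
    rw [this]; ring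
  rw [setIntegral_congr_fun measurableSet_Ioi this, integral_const_mul,
    Complex.integral_cpow_mul_exp_neg_mul_Ioi (by simp; linarith) hη, ← Complex.Gamma_mul_Gamma_one_sub]
  have : (1 / (η:ℂ)) ^ (1 - s) = (η:ℂ) ^ (s - 1) := by
    rw [one_div, Complex.inv_cpow _ _ (by rw [Complex.arg_ofReal_of_nonneg (le_of_lt hη)]; exact Real.pi_pos.ne), ← Complex.cpow_neg]
    congr 1; ring
  rw [this]; ring

end Mellin

section Appr
open Filter Topology

lemma norm_sq_Lp {w : Lp ℂ 2 m0} {f : ℝ → ℂ} (hf : w =ᵐ[m0] f) : ‖w‖ ^ 2 = ∫ t, ‖f t‖ ^ 2 ∂m0 := by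
  have h := inner_self_eq_norm_sq_to_K (𝕜 := ℂ) w
  rw [L2.inner_def] at h
  have h2 : ∫ t, inner ℂ (w t) (w t) ∂m0 = ((∫ t, ‖f t‖ ^ 2 ∂m0 : ℝ) : ℂ) := by
    refine Eq.trans ?_ (integral_ofReal (𝕜 := ℂ) (μ := m0) (f := fun t => ‖f t‖ ^ 2))
    apply integral_congr_ae
    filter_upwards [hf] with t ht
    rw [ht, inner_self_eq_norm_sq_to_K]; simp
  rw [h2] at h
  apply Complex.ofReal_injective
  rw [Complex.ofReal_pow]
  exact h.symm

noncomputable def hh (μ : ℝ) (ξ : ℝ) : ℂ := (ξ : ℂ) ^ ((1/2 + μ * Complex.I : ℂ) - 1)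

lemma hh_meas (μ : ℝ) : Measurable (hh μ) := by unfold hh; fun_prop

lemma hh_norm (μ : ℝ) {ξ : ℝ} (hξ : 0 < ξ) : ‖hh μ ξ‖ = ξ ^ (-1/2 : ℝ) := by
  rw [hh, Complex.norm_cpow_eq_rpow_re_of_pos hξ]
  congr 1; simp; norm_num

lemma hh_int (μ : ℝ) {η : ℝ} (hη : 0 < η) :
    IntegrableOn (fun ξ : ℝ => hh μ ξ / (ξ + η)) (Ioi 0) :=
  mellin_int (by simp) (by simp; norm_num) hη

lemma hh_eq (μ : ℝ) {η : ℝ} (hη : 0 < η) :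
    ∫ ξ in Ioi (0:ℝ), hh μ ξ / (ξ + η) = hh μ η * (Real.pi / Real.cosh (Real.pi * μ)) := by
  have := mellin_eq (s := 1/2 + μ * Complex.I) (by simp) (by simp; norm_num) hη
  rw [hh]
  refine this.trans ?_
  congr 2
  rw [mul_add, add_comm, ← mul_assoc, mul_one_div, Complex.sin_add_pi_div_two, Complex.cos_mul_I]
  push_cast; rfl

lemma hh_norm_div (μ : ℝ) {ξ η : ℝ} (hξ : 0 < ξ) (hη : 0 < η) :
    ‖hh μ ξ / (ξ + η)‖ = ξ ^ (-1/2 : ℝ) / (ξ + η) := by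
  rw [norm_div, hh_norm μ hξ, ← Complex.ofReal_add, Complex.norm_real, Real.norm_of_nonneg (by positivity)]

lemma boundU (μ : ℝ) {a η : ℝ} (ha : 0 < a) (hη : 0 < η) {A : Set ℝ} (hA : A ⊆ Ioi a) (hAm : MeasurableSet A) :
    ‖∫ ξ in A, hh μ ξ / (ξ + η)‖ ≤ 2 / √a := by
  have hi := integrableOn_Ioi_rpow_of_lt (a := -3/2) (by norm_num) ha
  have h1 : ‖∫ ξ in A, hh μ ξ / (ξ + η)‖ ≤ ∫ ξ in A, ξ ^ (-3/2 : ℝ) := by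
    refine norm_integral_le_of_norm_le (hi.mono_set hA) ?_
    filter_upwards [ae_restrict_mem hAm] with ξ hξ
    have hξ0 : 0 < ξ := ha.trans (hA hξ)
    rw [hh_norm_div μ hξ0 hη]
    have : ξ ^ (-3/2 : ℝ) = ξ ^ (-1/2 : ℝ) / ξ := by
      rw [← Real.rpow_sub_one hξ0.ne']; norm_num
    rw [this]
    gcongr; linarith
  have h2 : ∫ ξ in A, ξ ^ (-3/2 : ℝ) ≤ ∫ ξ in Ioi a, ξ ^ (-3/2 : ℝ) := by
    refine setIntegral_mono_set hi ?_ (LE.le.eventuallyLE hA)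
    filter_upwards [ae_restrict_mem measurableSet_Ioi] with ξ hξ
    exact Real.rpow_nonneg (ha.trans hξ).le _
  refine h1.trans (h2.trans ?_)
  rw [integral_Ioi_rpow_of_lt (by norm_num) ha]
  have : a ^ (-3/2 + 1 : ℝ) = (√a)⁻¹ := by
    rw [Real.sqrt_eq_rpow, ← Real.rpow_neg ha.le]; norm_num
  rw [this]; apply le_of_eq; ring

lemma boundV (μ : ℝ) {b η : ℝ} (hb : 0 < b) (hη : 0 < η) {A : Set ℝ} (hA : A ⊆ Ioc 0 b) (hAm : MeasurableSet A) :
    ‖∫ ξ in A, hh μ ξ / (ξ + η)‖ ≤ 2 * √b / η := by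
  have hi : IntegrableOn (fun ξ : ℝ => ξ ^ (-1/2 : ℝ) / η) (Ioc 0 b) := by
    have := intervalIntegral.intervalIntegrable_rpow' (a := 0) (b := b) (r := -1/2) (by norm_num)
    rw [intervalIntegrable_iff_integrableOn_Ioc_of_le hb.le] at this
    exact this.div_const _
  have h1 : ‖∫ ξ in A, hh μ ξ / (ξ + η)‖ ≤ ∫ ξ in A, ξ ^ (-1/2 : ℝ) / η := by
    refine norm_integral_le_of_norm_le (hi.mono_set hA) ?_
    filter_upwards [ae_restrict_mem hAm] with ξ hξ
    have hξ0 : 0 < ξ := (hA hξ).1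
    rw [hh_norm_div μ hξ0 hη]
    gcongr; linarith
  have h2 : ∫ ξ in A, ξ ^ (-1/2 : ℝ) / η ≤ ∫ ξ in Ioc 0 b, ξ ^ (-1/2 : ℝ) / η := by
    refine setIntegral_mono_set hi ?_ (LE.le.eventuallyLE hA)
    filter_upwards [ae_restrict_mem measurableSet_Ioc] with ξ hξ
    exact div_nonneg (Real.rpow_nonneg hξ.1.le _) hη.le
  refine h1.trans (h2.trans ?_)
  rw [← intervalIntegral.integral_of_le hb.le, intervalIntegral.integral_div, integral_rpow (by norm_num)]
  have : b ^ (-1/2 + 1 : ℝ) = √b := by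
    rw [Real.sqrt_eq_rpow]; norm_num
  rw [this, Real.zero_rpow (by norm_num)]; apply le_of_eq; ring

noncomputable def ff (μ R : ℝ) : ℝ → ℂ := (Ioc 1 R).indicator (hh μ)

noncomputable def gg (μ R : ℝ) (η : ℝ) : ℂ := (2 * Real.pi : ℂ)⁻¹ * ∫ ξ, ff μ R ξ / (ξ + η)

noncomputable def ee (μ R : ℝ) (η : ℝ) : ℂ := gg μ R η - (1 / (2 * Real.cosh (Real.pi * μ)) : ℝ) * ff μ R η

lemma gg_eq (μ R η : ℝ) : gg μ R η = (2 * Real.pi : ℂ)⁻¹ * ∫ ξ in Ioc 1 R, hh μ ξ / (ξ + η) := by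
  rw [gg, ← integral_indicator measurableSet_Ioc]
  congr 2; ext ξ
  by_cases h : ξ ∈ Ioc 1 R <;> simp [ff, h]

lemma two_pi_norm : ‖(2 * Real.pi : ℂ)⁻¹‖ ≤ 1 := by
  rw [norm_inv, norm_mul, Complex.norm_real, Real.norm_of_nonneg Real.pi_pos.le]
  simp only [Complex.norm_ofNat]
  apply inv_le_one_of_one_le₀
  linarith [Real.two_le_pi]

noncomputable def BB (R : ℝ) (η : ℝ) : ℝ :=
  (Ioc 0 1).indicator (fun _ => 4) η + (Ioc 1 R).indicator (fun _ => 8 / R) η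
    + (Ioi 1).indicator (fun η => 8 * η ^ (-2 : ℝ)) η + (Ioi R).indicator (fun η => 4 * R * η ^ (-2 : ℝ)) η

lemma mid_eq (μ : ℝ) {R η : ℝ} (hR : 1 < R) (hη : η ∈ Ioc 1 R) :
    ee μ R η = -((2 * Real.pi : ℂ)⁻¹ * ((∫ ξ in Ioc 0 1, hh μ ξ / (ξ + η)) + ∫ ξ in Ioi R, hh μ ξ / (ξ + η))) := by
  have hη0 : 0 < η := by linarith [hη.1]
  have hi := hh_int μ hη0
  have e1 := hh_eq μ hη0
  have s1 : ∫ ξ in Ioi (0:ℝ), hh μ ξ / (ξ + η) = (∫ ξ in Ioc 0 1, hh μ ξ / (ξ + η)) + ∫ ξ in Ioi 1, hh μ ξ / (ξ + η) := by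
    rw [← setIntegral_union (Ioc_disjoint_Ioi le_rfl) measurableSet_Ioi
      (hi.mono_set Ioc_subset_Ioi_self) (hi.mono_set (Ioi_subset_Ioi zero_le_one)), Ioc_union_Ioi_eq_Ioi zero_le_one]
  have s2 : ∫ ξ in Ioi (1:ℝ), hh μ ξ / (ξ + η) = (∫ ξ in Ioc 1 R, hh μ ξ / (ξ + η)) + ∫ ξ in Ioi R, hh μ ξ / (ξ + η) := by
    rw [← setIntegral_union (Ioc_disjoint_Ioi le_rfl) measurableSet_Ioi
      (hi.mono_set (Ioc_subset_Ioi_self.trans (Ioi_subset_Ioi zero_le_one))) (hi.mono_set (Ioi_subset_Ioi (by linarith))), Ioc_union_Ioi_eq_Ioi hR.le]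
  rw [ee, gg_eq, ff, indicator_of_mem hη]
  rw [s1, s2] at e1
  have hc : (Real.cosh (Real.pi * μ) : ℂ) ≠ 0 := by exact_mod_cast (Real.cosh_pos _).ne'
  have hp : (Real.pi : ℂ) ≠ 0 := by exact_mod_cast Real.pi_ne_zero
  have : ((1 / (2 * Real.cosh (Real.pi * μ)) : ℝ) : ℂ) * hh μ η
      = (2 * Real.pi : ℂ)⁻¹ * (hh μ η * (Real.pi / Real.cosh (Real.pi * μ))) := by
    push_cast
    push_cast at hc
    field_simp
  rw [this, ← e1]; ring

lemma ee_bound (μ : ℝ) {R η : ℝ} (hR : 1 < R) (hη : 0 < η) : ‖ee μ R η‖ ^ 2 ≤ BB R η := by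
  have hR0 : 0 < R := by linarith
  have hsq := Real.sq_sqrt hR0.le
  have hsp := Real.sqrt_pos.2 hR0
  have hη2 : η ^ (-2 : ℝ) = (η ^ 2)⁻¹ := by
    rw [Real.rpow_neg hη.le]; norm_num
  rcases le_or_gt η 1 with h1 | h1
  · have n1 : η ∉ Ioc 1 R := fun h => by linarith [h.1]
    have n2 : η ∉ Ioi R := fun h => by linarith [mem_Ioi.1 h]
    have n3 : η ∉ Ioi (1:ℝ) := fun h => by linarith [mem_Ioi.1 h]
    have n4 : η ∈ Ioc (0:ℝ) 1 := ⟨hη, h1⟩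
    have hb : ‖ee μ R η‖ ≤ 2 := by
      rw [ee, gg_eq, ff, indicator_of_notMem n1, mul_zero, sub_zero, norm_mul]
      have := boundU μ one_pos hη (A := Ioc 1 R) Ioc_subset_Ioi_self measurableSet_Ioc
      rw [Real.sqrt_one, div_one] at this
      nlinarith [two_pi_norm, norm_nonneg (∫ ξ in Ioc 1 R, hh μ ξ / (ξ + η))]
    simp only [BB, n1, n2, n3, n4, not_false_eq_true, indicator_of_notMem, indicator_of_mem]
    nlinarith [norm_nonneg (ee μ R η)]
  rcases le_or_gt η R with h2 | h2
  · have n1 : η ∈ Ioc 1 R := ⟨h1, h2⟩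
    have n2 : η ∉ Ioi R := fun h => by linarith [mem_Ioi.1 h]
    have n3 : η ∈ Ioi (1:ℝ) := h1
    have n4 : η ∉ Ioc (0:ℝ) 1 := fun h => by linarith [h.2]
    have hb : ‖ee μ R η‖ ≤ 2 / η + 2 / √R := by
      rw [mid_eq μ hR n1, norm_neg, norm_mul]
      have v := boundV μ one_pos hη (A := Ioc 0 1) subset_rfl measurableSet_Ioc
      have u := boundU μ hR0 hη (A := Ioi R) subset_rfl measurableSet_Ioi
      rw [Real.sqrt_one, mul_one] at v
      have := norm_add_le (∫ ξ in Ioc 0 1, hh μ ξ / (ξ + η)) (∫ ξ in Ioi R, hh μ ξ / (ξ + η))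
      refine (mul_le_of_le_one_left (norm_nonneg _) two_pi_norm).trans ?_
      linarith
    simp only [BB, n1, n2, n3, n4, not_false_eq_true, indicator_of_notMem, indicator_of_mem, hη2]
    have h3 : ‖ee μ R η‖ ^ 2 ≤ (2 / η + 2 / √R) ^ 2 := by gcongr
    have h4 : (2 / η) ^ 2 = 4 * (η ^ 2)⁻¹ := by rw [div_pow]; ring
    have h5 : (2 / √R) ^ 2 = 4 / R := by rw [div_pow, hsq]; norm_num
    have h6 : 8 / R = 2 * (4 / R) := by ring
    rw [h6]
    nlinarith [sq_nonneg (2 / η - 2 / √R)]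
  · have n1 : η ∉ Ioc 1 R := fun h => by linarith [h.2]
    have n2 : η ∈ Ioi R := h2
    have n3 : η ∈ Ioi (1:ℝ) := h1
    have n4 : η ∉ Ioc (0:ℝ) 1 := fun h => by linarith [h.2]
    have hb : ‖ee μ R η‖ ≤ 2 * √R / η := by
      rw [ee, gg_eq, ff, indicator_of_notMem n1, mul_zero, sub_zero, norm_mul]
      have := boundV μ hR0 hη (A := Ioc 1 R) (Ioc_subset_Ioc_left zero_le_one) measurableSet_Ioc
      exact (mul_le_of_le_one_left (norm_nonneg _) two_pi_norm).trans this
    simp only [BB, n1, n2, n3, n4, not_false_eq_true, indicator_of_notMem, indicator_of_mem, hη2]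
    have h3 : ‖ee μ R η‖ ^ 2 ≤ (2 * √R / η) ^ 2 := by gcongr
    have h4 : (2 * √R / η) ^ 2 = 4 * R * (η ^ 2)⁻¹ := by rw [div_pow, mul_pow, hsq]; ring
    have : 0 < (η ^ 2)⁻¹ := by positivity
    linarith

lemma BB_int {R : ℝ} (hR : 1 < R) : Integrable (BB R) m0 ∧ ∫ η, BB R η ∂m0 ≤ 24 := by
  have hR0 : 0 < R := by linarith
  have i1 : Integrable ((Ioc (0:ℝ) 1).indicator (fun _ => (4:ℝ))) := by
    rw [integrable_indicator_iff measurableSet_Ioc]; exact integrableOn_const (by simp)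
  have i2 : Integrable ((Ioc 1 R).indicator (fun _ => (8 / R:ℝ))) := by
    rw [integrable_indicator_iff measurableSet_Ioc]; exact integrableOn_const (by simp)
  have i3 : Integrable ((Ioi (1:ℝ)).indicator (fun η => 8 * η ^ (-2 : ℝ))) := by
    rw [integrable_indicator_iff measurableSet_Ioi]
    exact (integrableOn_Ioi_rpow_of_lt (by norm_num) one_pos).const_mul _
  have i4 : Integrable ((Ioi R).indicator (fun η => 4 * R * η ^ (-2 : ℝ))) := by
    rw [integrable_indicator_iff measurableSet_Ioi]
    exact (integrableOn_Ioi_rpow_of_lt (by norm_num) hR0).const_mul _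
  have hi : Integrable (BB R) := ((i1.add i2).add i3).add i4
  refine ⟨hi.mono_measure Measure.restrict_le_self, ?_⟩
  have hnn : 0 ≤ BB R := by
    intro η
    have : ∀ (S : Set ℝ) (φ : ℝ → ℝ), (∀ x ∈ S, 0 ≤ φ x) → 0 ≤ S.indicator φ η := fun S φ h => indicator_nonneg h η
    refine add_nonneg (add_nonneg (add_nonneg (this _ _ ?_) (this _ _ ?_)) (this _ _ ?_)) (this _ _ ?_)
    · intros; norm_num
    · intros; positivity
    · intro x hx; have : 0 < x := one_pos.trans hx
      positivity
    · intro x hx; have : 0 < x := hR0.trans hx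
      positivity
  have h1 : ∫ η, BB R η ∂m0 ≤ ∫ η, BB R η := setIntegral_le_integral hi (Eventually.of_forall hnn)
  refine h1.trans ?_
  have : ∫ η, BB R η = (∫ η, (Ioc (0:ℝ) 1).indicator (fun _ => (4:ℝ)) η) + (∫ η, (Ioc 1 R).indicator (fun _ => (8 / R:ℝ)) η)
    + (∫ η, (Ioi (1:ℝ)).indicator (fun η => 8 * η ^ (-2 : ℝ)) η) + ∫ η, (Ioi R).indicator (fun η => 4 * R * η ^ (-2 : ℝ)) η := by
    rw [← integral_add' i1 i2, ← integral_add' (i1.add i2) i3, ← integral_add' ((i1.add i2).add i3) i4]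
    rfl
  rw [this, integral_indicator measurableSet_Ioc, integral_indicator measurableSet_Ioc, integral_indicator measurableSet_Ioi,
    integral_indicator measurableSet_Ioi, integral_const_mul, integral_const_mul,
    integral_Ioi_rpow_of_lt (by norm_num) one_pos, integral_Ioi_rpow_of_lt (by norm_num) hR0]
  have : R ^ (-2 + 1 : ℝ) = R⁻¹ := by norm_num [Real.rpow_neg_one]
  rw [this]
  simp only [setIntegral_const, Real.volume_real_Ioc, Real.one_rpow, smul_eq_mul]
  rw [max_eq_left (by linarith), max_eq_left (by linarith)]
  have e1 : (R - 1) * (8 / R) ≤ 8 := by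
    rw [mul_div_assoc', div_le_iff₀ hR0]; linarith
  have e2 : 4 * R * (-R⁻¹ / (-2 + 1)) = 4 := by field_simp; norm_num
  rw [e2]; norm_num; linarith

lemma gg_meas (μ R : ℝ) : Measurable (gg μ R) := by
  have hf : Measurable (ff μ R) := (hh_meas μ).indicator measurableSet_Ioc
  refine Measurable.const_mul ?_ _
  refine (StronglyMeasurable.integral_prod_right (f := fun (η ξ : ℝ) => ff μ R ξ / (ξ + η)) ?_).measurable
  apply Measurable.stronglyMeasurable
  unfold Function.uncurry
  fun_prop

lemma ff_sq (μ : ℝ) {R : ℝ} (ξ : ℝ) : ‖ff μ R ξ‖ ^ 2 = (Ioc 1 R).indicator (fun ξ => ξ⁻¹) ξ := by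
  by_cases h : ξ ∈ Ioc 1 R
  · have h0 : 0 < ξ := by linarith [h.1]
    rw [ff, indicator_of_mem h, indicator_of_mem h, hh_norm μ h0, ← Real.rpow_natCast, ← Real.rpow_mul h0.le, ← Real.rpow_neg_one]
    norm_num
  · simp [ff, h]

lemma inv_int {R : ℝ} (hR : 1 < R) : IntegrableOn (fun ξ : ℝ => ξ⁻¹) (Ioc 1 R) := by
  rw [← intervalIntegrable_iff_integrableOn_Ioc_of_le hR.le]
  apply intervalIntegral.intervalIntegrable_inv (f := fun x => x)
  · intro x hx; rw [uIcc_of_le hR.le] at hx; linarith [hx.1]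
  · fun_prop

lemma ff_integrable (μ : ℝ) {R : ℝ} : Integrable (ff μ R) := by
  rw [ff, integrable_indicator_iff measurableSet_Ioc]
  refine Measure.integrableOn_of_bounded (M := 1) (by simp) (hh_meas μ).aestronglyMeasurable ?_
  filter_upwards [ae_restrict_mem measurableSet_Ioc] with ξ hξ
  rw [hh_norm μ (by linarith [hξ.1])]
  exact Real.rpow_le_one_of_one_le_of_nonpos hξ.1.le (by norm_num)

lemma approx_R (T : Lp ℂ 2 m0 →L[ℂ] Lp ℂ 2 m0)
    (hT : ∀ x : Lp ℂ 2 m0, Integrable (⇑x) m0 →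
      (⇑(T x) : ℝ → ℂ) =ᵐ[m0] fun t =>
        (Real.sqrt (2 * Real.pi) : ℂ)⁻¹ *
          ∫ ξ in Ioi (0:ℝ), x ξ * Complex.exp (Complex.I * t * ξ))
    (μ : ℝ) {R : ℝ} (hR : 1 < R) : ∃ x : Lp ℂ 2 m0, ‖x‖ ^ 2 = Real.log R ∧
      ‖T (T x) - (Complex.I * (1 / (2 * Real.cosh (Real.pi * μ)) : ℝ)) • x‖ ^ 2 ≤ 24 := by
  set q : ℝ := 1 / (2 * Real.cosh (Real.pi * μ)) with hq
  have hfm : Measurable (ff μ R) := (hh_meas μ).indicator measurableSet_Ioc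
  have hem : Measurable (ee μ R) := (gg_meas μ R).sub (hfm.const_mul _)
  obtain ⟨hB1, hB2⟩ := BB_int hR
  have hf2 : MemLp (ff μ R) 2 m0 := by
    rw [memLp_two_iff_integrable_sq_norm hfm.aestronglyMeasurable]
    simp only [ff_sq]
    refine Integrable.mono_measure ?_ Measure.restrict_le_self
    rw [integrable_indicator_iff measurableSet_Ioc]
    exact inv_int hR
  have hae : ∀ᵐ η ∂m0, ‖ee μ R η‖ ^ 2 ≤ BB R η := by
    filter_upwards [ae_restrict_mem (measurableSet_Ioi (a := (0:ℝ)))] with η hη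
    exact ee_bound μ hR hη
  have hesq : Integrable (fun η => ‖ee μ R η‖ ^ 2) m0 := by
    refine hB1.mono' (by fun_prop) ?_
    filter_upwards [hae] with η h
    rw [Real.norm_of_nonneg (by positivity)]; exact h
  have he2 : MemLp (ee μ R) 2 m0 := (memLp_two_iff_integrable_sq_norm hem.aestronglyMeasurable).2 hesq
  refine ⟨hf2.toLp _, ?_, ?_⟩
  · rw [norm_sq_Lp hf2.coeFn_toLp]
    simp only [ff_sq]
    rw [m0, integral_indicator measurableSet_Ioc, Measure.restrict_restrict measurableSet_Ioc,
      inter_eq_left.2 (Ioc_subset_Ioi_self.trans (Ioi_subset_Ioi zero_le_one)),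
      ← intervalIntegral.integral_of_le hR.le, integral_inv_of_pos one_pos (by linarith), div_one]
  · have hw : ⇑(he2.toLp _ + (q:ℂ) • hf2.toLp _) =ᵐ[m0] gg μ R := by
      filter_upwards [Lp.coeFn_add (he2.toLp _) ((q:ℂ) • hf2.toLp _), Lp.coeFn_smul (q:ℂ) (hf2.toLp _),
        hf2.coeFn_toLp, he2.coeFn_toLp] with η h1 h2 h3 h4
      rw [h1, Pi.add_apply, h2, Pi.smul_apply, h3, h4, ee, smul_eq_mul]
      ring
    have := TT_form T hT (hf2.toLp _) _ (ff μ R) hf2.coeFn_toLp (ff_integrable μ)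
      (fun ξ hξ => by rw [ff, indicator_of_notMem]; intro h; linarith [h.1]) hw
    rw [this, smul_add, smul_smul, add_sub_cancel_right, norm_smul, Complex.norm_I, one_mul,
      norm_sq_Lp he2.coeFn_toLp]
    exact (integral_mono_ae hesq hB1 hae).trans hB2

lemma approx_eig (T : Lp ℂ 2 m0 →L[ℂ] Lp ℂ 2 m0)
    (hT : ∀ x : Lp ℂ 2 m0, Integrable (⇑x) m0 →
      (⇑(T x) : ℝ → ℂ) =ᵐ[m0] fun t =>
        (Real.sqrt (2 * Real.pi) : ℂ)⁻¹ *
          ∫ ξ in Ioi (0:ℝ), x ξ * Complex.exp (Complex.I * t * ξ))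
    {p : ℝ} (hp0 : 0 ≤ p) (hp : p < 1/2) {ε : ℝ} (hε : 0 < ε) :
    ∃ x : Lp ℂ 2 m0, x ≠ 0 ∧ ‖T (T x) - (Complex.I * p) • x‖ ≤ ε * ‖x‖ := by
  have hpos : ∀ {p : ℝ}, 0 < p → p < 1/2 → ∀ {ε : ℝ}, 0 < ε →
      ∃ x : Lp ℂ 2 m0, x ≠ 0 ∧ ‖T (T x) - (Complex.I * p) • x‖ ≤ ε * ‖x‖ := by
    intro p hp0 hp ε hε
    obtain ⟨x, hx, he⟩ := approx_R T hT (Real.arcosh (1 / (2 * p)) / Real.pi) (R := Real.exp (24 / ε ^ 2))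
      (Real.one_lt_exp_iff.2 (by positivity))
    have hcosh : 1 / (2 * Real.cosh (Real.pi * (Real.arcosh (1 / (2 * p)) / Real.pi))) = p := by
      rw [mul_div_cancel₀ _ Real.pi_ne_zero, Real.cosh_arcosh]
      · field_simp
      · rw [le_div_iff₀ (by positivity)]; linarith
    rw [hcosh] at he
    rw [Real.log_exp] at hx
    refine ⟨x, ?_, ?_⟩
    · rintro rfl
      have : 0 < 24 / ε ^ 2 := by positivity
      rw [norm_zero] at hx; linarith
    · refine abs_le_of_sq_le_sq' ?_ (by positivity) |>.2
      refine he.trans (le_of_eq ?_)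
      rw [mul_pow, hx]; field_simp
  rcases hp0.eq_or_lt with rfl | h
  · set q := min (ε / 2) (1 / 4) with hq
    have hq0 : 0 < q := by positivity
    obtain ⟨x, hx, he⟩ := hpos hq0 (lt_of_le_of_lt (min_le_right _ _) (by norm_num)) (half_pos hε)
    refine ⟨x, hx, ?_⟩
    have h1 : T (T x) - (Complex.I * (0:ℝ)) • x = (T (T x) - (Complex.I * q) • x) + (Complex.I * q) • x := by simp
    rw [h1]
    refine (norm_add_le _ _).trans ?_
    rw [norm_smul, norm_mul, Complex.norm_I, one_mul, Complex.norm_real, Real.norm_of_nonneg hq0.le]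
    have : q * ‖x‖ ≤ ε / 2 * ‖x‖ := by gcongr; exact min_le_left _ _
    linarith
  · exact hpos h hp hε

end Appr

section Final
open scoped ComplexConjugate

lemma real_final {F D r ρ : ℝ} (hD : 0 < D) (hF : 2 * D ≤ F) (hr : r = √(F ^ 2 / 4 - D ^ 2)) (hρ : 0 ≤ ρ)
    (h : 1 ≤ (F / 2 - r) * ρ ^ 2) : √F / D - 2 * D / √(F ^ 3) ≤ ρ := by
  have hF0 : 0 < F := by linarith
  have hr0 : 0 ≤ r := hr ▸ Real.sqrt_nonneg _
  have hr2 : r ^ 2 = F ^ 2 / 4 - D ^ 2 := by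
    rw [hr]; exact Real.sq_sqrt (by nlinarith)
  have hrF : r ≤ F / 2 := by
    by_contra hc; push Not at hc; nlinarith
  have h1 : F / 2 + r ≤ D ^ 2 * ρ ^ 2 := by
    have : (F / 2 + r) * 1 ≤ (F / 2 + r) * ((F / 2 - r) * ρ ^ 2) := by gcongr
    nlinarith
  set f := √F with hf
  have hf0 : 0 < f := Real.sqrt_pos.2 hF0
  have hff : F = f ^ 2 := (Real.sq_sqrt hF0.le).symm
  have hF3 : √(F ^ 3) = f ^ 3 := by
    rw [hff, ← pow_mul, mul_comm, pow_mul, Real.sqrt_sq (by positivity)]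
  rw [hF3]
  have e : f / D - 2 * D / f ^ 3 = (F ^ 2 - 2 * D ^ 2) / (D * f ^ 3) := by
    rw [hff]; field_simp
  rw [e, div_le_iff₀ (by positivity)]
  have h2 : F ^ 2 - 2 * D ^ 2 ≤ F * (F / 2 + r) := by nlinarith
  have h3 : 0 ≤ F ^ 2 - 2 * D ^ 2 := by nlinarith
  refine abs_le_of_sq_le_sq' ?_ (by positivity) |>.2
  calc (F ^ 2 - 2 * D ^ 2) ^ 2 = (F ^ 2 - 2 * D ^ 2) * (F ^ 2 - 2 * D ^ 2) := sq _
    _ ≤ F ^ 2 * (F * (F / 2 + r)) := by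
        refine mul_le_mul (by nlinarith) h2 h3 (by positivity)
    _ ≤ F ^ 2 * (F * (D ^ 2 * ρ ^ 2)) := by gcongr
    _ = (ρ * (D * f ^ 3)) ^ 2 := by rw [hff]; ring

lemma final_geom {ζ z : ℂ} (hζ0 : ζ ≠ 0)
    (hζ : ζ ∈ segment ℝ (-(Complex.exp (Complex.I * Real.pi / 4) / (Real.sqrt 2 : ℂ)))
      (Complex.exp (Complex.I * Real.pi / 4) / (Real.sqrt 2 : ℂ)))
    (s : ℝ)
    (hz : z = ζ + s * Complex.exp (3 * Real.pi * Complex.I / 4)) :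
    ∃ a : ℝ, a ≠ 0 ∧ a ^ 2 ≤ 1 / 2 ∧ ‖ζ‖ = |a| ∧ ‖z - ζ‖ = |s| ∧ ‖z‖ ^ 2 = a ^ 2 + s ^ 2 ∧
      z ^ 2 = Complex.I * ((a ^ 2 - s ^ 2 : ℝ) : ℂ) - ((2 * a * s : ℝ) : ℂ) := by
  obtain ⟨t1, t2, h1, h2, h3, rfl⟩ := hζ
  set e := Complex.exp (Complex.I * Real.pi / 4) with he
  have hen : ‖e‖ = 1 := by
    rw [he, show (Complex.I * Real.pi / 4 : ℂ) = ((Real.pi / 4 : ℝ) : ℂ) * Complex.I by push_cast; ring,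
      Complex.norm_exp_ofReal_mul_I]
  have he2 : e ^ 2 = Complex.I := by
    rw [he, ← Complex.exp_nat_mul, show ((2:ℕ) * (Complex.I * Real.pi / 4) : ℂ) = Real.pi / 2 * Complex.I by push_cast; ring,
      Complex.exp_pi_div_two_mul_I]
  have he3 : Complex.exp (3 * Real.pi * Complex.I / 4) = Complex.I * e := by
    have h4 : Complex.exp (Real.pi / 2 * Complex.I) * e = Complex.I * e := by
      rw [Complex.exp_pi_div_two_mul_I]
    rw [← h4, he, ← Complex.exp_add]; congr 1; ring
  have hs2 : (√2 : ℂ) ≠ 0 := by simp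
  have hζ : t1 • -(e / (√2 : ℂ)) + t2 • (e / (√2 : ℂ)) = (((t2 - t1) / √2 : ℝ) : ℂ) * e := by
    rw [Complex.real_smul, Complex.real_smul]; push_cast; ring
  rw [hζ] at hζ0 hz ⊢
  set a : ℝ := (t2 - t1) / √2 with ha
  have hz' : z = e * ⟨a, s⟩ := by
    rw [hz, he3, Complex.mk_eq_add_mul_I]; ring
  refine ⟨a, ?_, ?_, ?_, ?_, ?_, ?_⟩
  · rintro h; rw [h] at hζ0; simp at hζ0
  · rw [ha, div_pow, Real.sq_sqrt (by norm_num)]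
    nlinarith
  · rw [norm_mul, hen, mul_one, Complex.norm_real, Real.norm_eq_abs]
  · rw [hz, he3, add_sub_cancel_left, norm_mul, norm_mul, hen, Complex.norm_I, Complex.norm_real, Real.norm_eq_abs]; ring
  · rw [hz', norm_mul, hen, one_mul, Complex.sq_norm, Complex.normSq_mk]; ring
  · rw [hz', mul_pow, he2]
    apply Complex.ext <;> simp [sq] <;> ring

end Final

/-- Let `ζ ≠ 0` lie on the segment `[−e^{iπ/4}/√2, e^{iπ/4}/√2]` and let
`z = ζ + s·e^{3iπ/4}` with `s ∈ ℝ`, `s ≠ 0`. With `A(z) = (2|z|²+1)^{1/2}/2` and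
`B(z) = 4/(2|z|²+1)^{3/2}`: `z·I − T` is invertible,
`‖(z·I − T)⁻¹‖ ≤ A(z)/(|ζ||z−ζ|)`, and if moreover `|z−ζ| ≤ |ζ|` then
`A(z)/(|ζ||z−ζ|) − B(z)|ζ||z−ζ| ≤ ‖(z·I − T)⁻¹‖`. -/
theorem resolvent_bounds_on_normal
    (T : Lp ℂ 2 m0 →L[ℂ] Lp ℂ 2 m0)
    (hT : ∀ x : Lp ℂ 2 m0, Integrable (⇑x) m0 →
      (⇑(T x) : ℝ → ℂ) =ᵐ[m0] fun t =>
        (Real.sqrt (2 * Real.pi) : ℂ)⁻¹ *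
          ∫ ξ in Ioi (0:ℝ), x ξ * Complex.exp (Complex.I * t * ξ))
    (ζ : ℂ) (hζ0 : ζ ≠ 0)
    (hζ : ζ ∈ segment ℝ (-(Complex.exp (Complex.I * Real.pi / 4) / (Real.sqrt 2 : ℂ)))
      (Complex.exp (Complex.I * Real.pi / 4) / (Real.sqrt 2 : ℂ)))
    (s : ℝ) (hs : s ≠ 0) (z : ℂ)
    (hz : z = ζ + s * Complex.exp (3 * Real.pi * Complex.I / 4)) :
    IsUnit (z • (1 : Lp ℂ 2 m0 →L[ℂ] Lp ℂ 2 m0) - T) ∧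
    ‖Ring.inverse (z • (1 : Lp ℂ 2 m0 →L[ℂ] Lp ℂ 2 m0) - T)‖
      ≤ (Real.sqrt (2 * ‖z‖ ^ 2 + 1) / 2) / (‖ζ‖ * ‖z - ζ‖) ∧
    (‖z - ζ‖ ≤ ‖ζ‖ →
      (Real.sqrt (2 * ‖z‖ ^ 2 + 1) / 2) / (‖ζ‖ * ‖z - ζ‖)
          - (4 / Real.sqrt ((2 * ‖z‖ ^ 2 + 1) ^ 3)) * (‖ζ‖ * ‖z - ζ‖)
        ≤ ‖Ring.inverse (z • (1 : Lp ℂ 2 m0 →L[ℂ] Lp ℂ 2 m0) - T)‖) := by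
  obtain ⟨a, ha0, ha, n1, n2, n3, hz2⟩ := final_geom hζ0 hζ s hz
  have hF := frel T hT
  have hre : (z ^ 2).re = -(2 * a * s) := by
    rw [hz2]; simp [-Complex.ofReal_mul, -Complex.ofReal_sub, -Complex.ofReal_pow]
  have hre0 : (z ^ 2).re ≠ 0 := by
    rw [hre]; exact neg_ne_zero.2 (mul_ne_zero (mul_ne_zero two_ne_zero ha0) hs)
  have hu : IsUnit (z • (1 : Lp ℂ 2 m0 →L[ℂ] Lp ℂ 2 m0) - T) := hF.isUnit z hre0
  have hinv1 := Ring.mul_inverse_cancel _ hu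
  have hinv2 := Ring.inverse_mul_cancel _ hu
  set R := Ring.inverse (z • (1 : Lp ℂ 2 m0 →L[ℂ] Lp ℂ 2 m0) - T) with hR
  set D := 2 * |a| * |s| with hD
  have hDpos : 0 < D := by positivity
  have hDre : |(z ^ 2).re| = D := by
    rw [hre, abs_neg, abs_mul, abs_mul, abs_two]
  have hDn : ‖ζ‖ * ‖z - ζ‖ = D / 2 := by rw [n1, n2, hD]; ring
  set F := 2 * ‖z‖ ^ 2 + 1 with hFd
  have hFpos : 0 < F := by positivity
  have e1 : √F / 2 / (D / 2) = √F / D := by field_simp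
  have e2 : 4 / √(F ^ 3) * (D / 2) = 2 * D / √(F ^ 3) := by ring
  rw [hDn, e1, e2]
  have happ1 : ∀ y, z • R y - T (R y) = y := by
    intro y
    have := congrArg (fun A : Lp ℂ 2 m0 →L[ℂ] Lp ℂ 2 m0 => A y) hinv1
    simpa using this
  have happ2 : ∀ x, R (z • x - T x) = x := by
    intro x
    have := congrArg (fun A : Lp ℂ 2 m0 →L[ℂ] Lp ℂ 2 m0 => A x) hinv2
    simpa using this
  refine ⟨hu, ?_, ?_⟩
  · refine ContinuousLinearMap.opNorm_le_bound _ (by positivity) ?_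
    intro y
    have := hF.low' z (R y)
    rw [happ1, hDre] at this
    rw [div_mul_eq_mul_div, le_div_iff₀ hDpos]; linarith
  · intro hle
    rw [n1, n2] at hle
    have hsa : s ^ 2 ≤ a ^ 2 := sq_le_sq.2 hle
    have hs2 : 0 < s ^ 2 := by positivity
    have hD2 : D ^ 2 = 4 * a ^ 2 * s ^ 2 := by rw [hD, mul_pow, mul_pow, sq_abs, sq_abs]; ring
    have h2D : 2 * D ≤ F := by
      have h : D ≤ a ^ 2 + s ^ 2 := by
        rw [hD, ← sq_abs a, ← sq_abs s]; nlinarith [sq_nonneg (|a| - |s|)]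
      rw [hFd, n3]; linarith
    set r := √(F ^ 2 / 4 - D ^ 2) with hr
    have hr2 : r ^ 2 = F ^ 2 / 4 - D ^ 2 := Real.sq_sqrt (by nlinarith)
    refine real_final hDpos h2D hr (norm_nonneg _) ?_
    refine hF.lower z (a ^ 2 - s ^ 2) D (F / 2 - r) (F / 2 + r) ‖R‖ (by linarith) (by linarith) ?_ ?_ ?_ ?_ ?_ ?_ ?_
    · rw [← map_pow, hz2]
      apply Complex.ext <;> simp [-Complex.ofReal_mul, -Complex.ofReal_sub, -Complex.ofReal_pow] <;> ring
    · rw [n3, hD2]; ring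
    · ring
    · linear_combination -hr2
    · intro ε hε
      exact approx_eig T hT (by linarith) (by linarith) hε
    · intro x
      have := R.le_opNorm (z • x - T x)
      rwa [happ2] at this
    · intro x
      have h1 := (ContinuousLinearMap.adjoint R).le_opNorm ((starRingEnd ℂ) z • x - ContinuousLinearMap.adjoint T x)
      have h2 : ContinuousLinearMap.adjoint R ((starRingEnd ℂ) z • x - ContinuousLinearMap.adjoint T x) = x := by
        refine ext_inner_right ℂ ?_
        intro y
        rw [ContinuousLinearMap.adjoint_inner_left, inner_sub_left, inner_smul_left, Complex.conj_conj,
          ContinuousLinearMap.adjoint_inner_left, ← inner_smul_right, ← inner_sub_right, happ1]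
      rw [h2] at h1
      simpa using h1
end

section
/- Let T be the truncated Fourier–Plancherel operator on L²(ℝ⁺). Then T is not similar to any normal operator: there do not exist bounded linear operators S, N on L²(ℝ⁺) with S invertible (as a bounded operator with bounded inverse) and N normal (N commutes with its Hilbert-space adjoint N*) such that T = S ∘ N ∘ S⁻¹. -/
open MeasureTheory Set ContinuousLinearMap

open Complex FourierTransform in
lemma aux_ptwise (n : ℝ) (w : ℝ) : ((1:ℂ) + I * n - I * w) ≠ 0 := by
  intro h
  have := congrArg Complex.re h
  simp at this

lemma aux_normf (n w : ℝ) : ‖(((1:ℂ) + Complex.I * n - Complex.I * w)^2)⁻¹‖ = (1 + (w - n)^2)⁻¹ := by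
  rw [norm_inv, norm_pow, ← Complex.normSq_eq_norm_sq, Complex.normSq_apply]
  simp
  ring

/-- the test function -/
noncomputable def gfun (n : ℝ) (ξ : ℝ) : ℂ :=
  ((max ξ 0 : ℝ) : ℂ) * Complex.exp (-((1:ℂ) + Complex.I * n) * ξ)

lemma gfun_cont (n : ℝ) : Continuous (gfun n) := by
  unfold gfun
  fun_prop

lemma gfun_norm (n ξ : ℝ) : ‖gfun n ξ‖ = max ξ 0 * Real.exp (-ξ) := by
  unfold gfun
  rw [norm_mul, Complex.norm_exp, Complex.norm_real, Real.norm_of_nonneg (le_max_right _ _)]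
  simp

lemma aux_int1 : IntegrableOn (fun ξ : ℝ => ξ * Real.exp (-ξ)) (Ioi 0) := by
  have := Real.GammaIntegral_convergent (s := 2) (by norm_num)
  refine this.congr_fun (fun x hx => ?_) measurableSet_Ioi
  simp only
  norm_num
  ring


lemma gfun_integrable (n : ℝ) : Integrable (gfun n) := by
  have h : IntegrableOn (gfun n) (Ioi 0) := by
    refine aux_int1.mono' (gfun_cont n).aestronglyMeasurable ?_
    filter_upwards [ae_restrict_mem measurableSet_Ioi] with x hx
    rw [gfun_norm, max_eq_left (le_of_lt hx)]
  have := (integrable_indicator_iff measurableSet_Ioi).2 h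
  refine this.congr (Filter.Eventually.of_forall fun x => ?_)
  by_cases hx : 0 < x
  · simp [hx]
  · simp [hx, gfun, max_eq_right (not_lt.1 hx)]

lemma gfun_memLp (n : ℝ) : MemLp (gfun n) 2 m0 := by
  rw [memLp_two_iff_integrable_sq_norm (gfun_cont n).aestronglyMeasurable]
  refine (gfun_integrable n).norm.restrict.mono' (by have := gfun_cont n; fun_prop) ?_
  filter_upwards with x
  rw [Real.norm_of_nonneg (by positivity), gfun_norm, pow_two]
  have h1 : max x 0 * Real.exp (-x) ≤ 1 := by
    rcases le_total x 0 with h | h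
    · simp [max_eq_right h]
    · rw [max_eq_left h, Real.exp_neg, mul_inv_le_iff₀ (Real.exp_pos x)]
      linarith [Real.add_one_le_exp x]
  have h0 : 0 ≤ max x 0 * Real.exp (-x) := by positivity
  nlinarith

lemma laplace {w : ℂ} (hw : 0 < w.re) :
    ∫ ξ in Ioi (0:ℝ), (ξ:ℂ) * Complex.exp (-w * ξ) = (w^2)⁻¹ := by
  have hw0 : w ≠ 0 := by rintro rfl; simp at hw
  have hlim : Filter.Tendsto (fun x : ℝ => -((x:ℂ) / w + (w^2)⁻¹) * Complex.exp (-w * x))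
      Filter.atTop (nhds 0) := by
    have e1 : Filter.Tendsto (fun x : ℝ => x * Real.exp (-(w.re * x))) Filter.atTop (nhds 0) := by
      have := (Real.tendsto_pow_mul_exp_neg_atTop_nhds_zero 1).comp
        (Filter.tendsto_id.const_mul_atTop hw)
      have := this.const_mul (w.re⁻¹)
      simp only [mul_zero] at this
      refine this.congr (fun x => ?_)
      simp
      field_simp
    have e2 : Filter.Tendsto (fun x : ℝ => Real.exp (-(w.re * x))) Filter.atTop (nhds 0) :=
      Real.tendsto_exp_neg_atTop_nhds_zero.comp (Filter.tendsto_id.const_mul_atTop hw)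
    have c1 : Filter.Tendsto (fun x : ℝ => (x:ℂ) * Complex.exp (-w * x)) Filter.atTop (nhds 0) := by
      rw [tendsto_zero_iff_norm_tendsto_zero]
      have := e1.norm
      simp only [norm_zero] at this
      refine this.congr (fun x => ?_)
      simp [Complex.norm_exp]
    have c2 : Filter.Tendsto (fun x : ℝ => Complex.exp (-w * x)) Filter.atTop (nhds 0) := by
      rw [tendsto_zero_iff_norm_tendsto_zero]
      refine e2.congr (fun x => ?_)
      simp [Complex.norm_exp]
    have := (c1.const_mul (-w⁻¹)).add (c2.const_mul (-(w^2)⁻¹))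
    simp only [mul_zero, add_zero] at this
    refine this.congr (fun x => ?_)
    ring
  have hint : IntegrableOn (fun ξ : ℝ => (ξ:ℂ) * Complex.exp (-w * ξ)) (Ioi 0) := by
    have h1 : IntegrableOn (fun ξ : ℝ => w.re⁻¹ * ((w.re * ξ) * Real.exp (-(w.re * ξ)))) (Ioi 0) := by
      have := (integrableOn_Ioi_comp_mul_left_iff (fun ξ : ℝ => ξ * Real.exp (-ξ)) 0 hw).2
        (by simpa using aux_int1)
      exact this.const_mul _
    refine h1.mono' (by fun_prop) ?_
    filter_upwards [ae_restrict_mem measurableSet_Ioi] with x hx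
    rw [norm_mul, Complex.norm_exp, Complex.norm_real, Real.norm_of_nonneg (le_of_lt hx)]
    simp
    field_simp
    rfl
  have := integral_Ioi_of_hasDerivAt_of_tendsto' (a := 0)
    (f := fun x : ℝ => -((x:ℂ) / w + (w^2)⁻¹) * Complex.exp (-w * x))
    (f' := fun ξ : ℝ => (ξ:ℂ) * Complex.exp (-w * ξ)) ?_ hint hlim
  · rw [this]; simp
  · intro x _
    have hd : HasDerivAt (fun x : ℂ => -(x / w + (w^2)⁻¹) * Complex.exp (-w * x))
        ((x:ℂ) * Complex.exp (-w * x)) (x:ℂ) := by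
      have a1 := (((hasDerivAt_id (x:ℂ)).div_const w).add_const ((w^2)⁻¹)).neg
      have a2 := ((hasDerivAt_id (x:ℂ)).const_mul (-w)).cexp
      convert! a1.mul a2 using 1
      simp
      field_simp
      ring
    exact hd.comp_ofReal

lemma gfun_transform (n t : ℝ) :
    ∫ ξ in Ioi (0:ℝ), gfun n ξ * Complex.exp (Complex.I * t * ξ) =
      (((1:ℂ) + Complex.I * n - Complex.I * t)^2)⁻¹ := by
  rw [← laplace (w := (1:ℂ) + Complex.I * n - Complex.I * t) (by simp)]
  refine setIntegral_congr_fun measurableSet_Ioi (fun x hx => ?_)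
  have hx' : max x 0 = x := max_eq_left (le_of_lt (mem_Ioi.1 hx))
  simp only [gfun, hx', mul_assoc, ← Complex.exp_add]
  congr 2
  ring

lemma ffun_integrable (n : ℝ) :
    Integrable (fun t : ℝ => (((1:ℂ) + Complex.I * n - Complex.I * t)^2)⁻¹) := by
  have h := integrable_inv_one_add_sq.comp_sub_right n
  refine h.mono' ?_ ?_
  · refine Continuous.aestronglyMeasurable ?_
    refine Continuous.inv₀ (by fun_prop) (fun t => pow_ne_zero _ (aux_ptwise n t))
  · filter_upwards with t
    rw [aux_normf]

open FourierTransform in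
lemma fourier_gfun (n w : ℝ) : 𝓕 (gfun n) w =
    (((1:ℂ) + Complex.I * n - Complex.I * ((-(2 * Real.pi)) * w : ℝ))^2)⁻¹ := by
  rw [← gfun_transform, Real.fourier_real_eq_integral_exp_smul, ← integral_indicator measurableSet_Ioi]
  congr 1
  ext x
  by_cases hx : 0 < x
  · simp only [mem_Ioi, hx, indicator_of_mem, smul_eq_mul]
    rw [mul_comm]
    congr 2
    push_cast
    ring
  · simp [hx, gfun, max_eq_right (not_lt.1 hx)]

open FourierTransform in
lemma inversion (n s : ℝ) (hs : 0 < s) :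
    ∫ t : ℝ, (((1:ℂ) + Complex.I * n - Complex.I * t)^2)⁻¹ * Complex.exp (Complex.I * s * t) = 0 := by
  have hF : 𝓕 (gfun n) = fun w : ℝ => (fun t : ℝ => (((1:ℂ) + Complex.I * n - Complex.I * t)^2)⁻¹)
      ((-(2 * Real.pi)) * w) := by
    ext w; exact fourier_gfun n w
  have hpi : -(2 * Real.pi) ≠ 0 := by have := Real.pi_pos; intro h; linarith
  have hI : Integrable (𝓕 (gfun n)) := by
    rw [hF]
    exact (ffun_integrable n).comp_mul_left' hpi
  have h := congrFun ((gfun_cont n).fourierInv_fourier_eq (gfun_integrable n) hI) (-s)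
  rw [Real.fourierInv_eq_fourier_neg, Real.fourier_real_eq_integral_exp_smul, hF] at h
  have h2 := Measure.integral_comp_mul_left (fun t : ℝ => (((1:ℂ) + Complex.I * n - Complex.I * t)^2)⁻¹ * Complex.exp (Complex.I * s * t)) (-(2 * Real.pi))
  have h3 : gfun n (-s) = 0 := by simp [gfun, max_eq_right (by linarith : -s ≤ 0)]
  rw [h3] at h
  have h4 : (∫ x : ℝ, (fun t : ℝ => (((1:ℂ) + Complex.I * n - Complex.I * t)^2)⁻¹ * Complex.exp (Complex.I * s * t)) ((-(2 * Real.pi)) * x)) = 0 := by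
    rw [← h]
    congr 1
    ext x
    simp only [smul_eq_mul]
    rw [mul_comm]
    congr 2
    push_cast
    ring
  rw [h4] at h2
  have h5 := smul_eq_zero.1 h2.symm
  rcases h5 with h5 | h5
  · exact absurd h5 (by simp [Real.pi_ne_zero])
  · exact h5

/-- reflected part -/
noncomputable def hfun (n t : ℝ) : ℂ := (((1:ℂ) - Complex.I * n - Complex.I * t)^2)⁻¹

lemma hfun_eq (n t : ℝ) : hfun n t = (((1:ℂ) + Complex.I * (-n : ℝ) - Complex.I * t)^2)⁻¹ := by
  simp [hfun]; ring_nf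

lemma half (n s : ℝ) (hs : 0 < s) :
    ∫ t in Ioi (0:ℝ), (((1:ℂ) + Complex.I * n - Complex.I * t)^2)⁻¹ * Complex.exp (Complex.I * s * t)
     = - (starRingEnd ℂ) (∫ t in Ioi (0:ℝ), hfun n t * Complex.exp (Complex.I * s * t)) := by
  have hi : Integrable (fun t : ℝ => (((1:ℂ) + Complex.I * n - Complex.I * t)^2)⁻¹ * Complex.exp (Complex.I * s * t)) := by
    refine (ffun_integrable n).mul_bdd (c := 1) (by fun_prop) ?_
    filter_upwards with t
    simp [Complex.norm_exp]
  have h := inversion n s hs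
  rw [← intervalIntegral.integral_Iic_add_Ioi (b := 0) hi.integrableOn hi.integrableOn] at h
  rw [eq_neg_of_add_eq_zero_right h, ← integral_conj]
  congr 1
  have := integral_comp_neg_Ioi 0 (fun t : ℝ => (((1:ℂ) + Complex.I * n - Complex.I * t)^2)⁻¹ * Complex.exp (Complex.I * s * t))
  rw [neg_zero] at this
  rw [← this]
  congr 1
  ext t
  simp only [hfun, map_mul, map_inv₀, map_pow, ← Complex.exp_conj, map_sub, map_one, Complex.conj_I, Complex.conj_ofReal]
  push_cast
  congr 2
  · ring
  · ring
lemma normal_ineq {H : Type*} [NormedAddCommGroup H] [InnerProductSpace ℂ H] [CompleteSpace H]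
    (N : H →L[ℂ] H) (hN : N ∘L ContinuousLinearMap.adjoint N = ContinuousLinearMap.adjoint N ∘L N)
    (y : H) : ‖N y‖^2 ≤ ‖N (N y)‖ * ‖y‖ := by
  have hs : IsStarNormal N := ⟨by
    rw [ContinuousLinearMap.star_eq_adjoint]; exact hN.symm⟩
  have h1 := ContinuousLinearMap.isStarNormal_iff_norm_eq_adjoint.1 hs (N y)
  rw [h1]
  have h2 := ContinuousLinearMap.apply_norm_sq_eq_inner_adjoint_left N y
  rw [h2]
  refine (Complex.re_le_norm _).trans (norm_inner_le_norm _ _)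

lemma sim_ineq {H : Type*} [NormedAddCommGroup H] [InnerProductSpace ℂ H] [CompleteSpace H]
    (T S N R : H →L[ℂ] H) (hRS : R ∘L S = 1)
    (hN : N ∘L ContinuousLinearMap.adjoint N = ContinuousLinearMap.adjoint N ∘L N)
    (hT : T = S ∘L N ∘L R) (x : H) :
    ‖T x‖^2 ≤ ‖S‖^2 * ‖R‖^2 * (‖T (T x)‖ * ‖x‖) := by
  have hR : ∀ y, R (S y) = y := fun y => by
    have := congrArg (fun A : H →L[ℂ] H => A y) hRS
    simpa using this
  have h1 : ‖T x‖ ≤ ‖S‖ * ‖N (R x)‖ := by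
    rw [hT]; exact S.le_opNorm _
  have h2 : N (N (R x)) = R (T (T x)) := by
    rw [hT]; simp [hR]
  have h3 := normal_ineq N hN (R x)
  rw [h2] at h3
  have h4 := R.le_opNorm (T (T x))
  have h5 := R.le_opNorm x
  calc ‖T x‖^2 ≤ (‖S‖ * ‖N (R x)‖)^2 := by gcongr
    _ = ‖S‖^2 * ‖N (R x)‖^2 := by ring
    _ ≤ ‖S‖^2 * ((‖R‖ * ‖T (T x)‖) * (‖R‖ * ‖x‖)) := by
        gcongr
        exact h3.trans (by gcongr)
    _ = _ := by ring
lemma ffun_memLp (n : ℝ) :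
    MemLp (fun t : ℝ => (((1:ℂ) + Complex.I * n - Complex.I * t)^2)⁻¹) 2 m0 := by
  have hc : Continuous (fun t : ℝ => (((1:ℂ) + Complex.I * n - Complex.I * t)^2)⁻¹) :=
    Continuous.inv₀ (by fun_prop) (fun t => pow_ne_zero _ (aux_ptwise n t))
  rw [memLp_two_iff_integrable_sq_norm hc.aestronglyMeasurable]
  refine (ffun_integrable n).norm.restrict.mono' (by fun_prop) ?_
  filter_upwards with x
  rw [Real.norm_of_nonneg (by positivity), aux_normf, pow_two]
  have h1 : (1 + (x - n)^2)⁻¹ ≤ 1 := inv_le_one_of_one_le₀ (by nlinarith [sq_nonneg (x - n)])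
  have h0 : 0 ≤ (1 + (x - n)^2)⁻¹ := by positivity
  nlinarith

lemma hfun_memLp (n : ℝ) : MemLp (hfun n) 2 m0 := by
  have := ffun_memLp (-n)
  refine this.congr_norm ?_ ?_
  · exact this.1.congr (Filter.Eventually.of_forall fun t => (hfun_eq n t).symm)
  · exact Filter.Eventually.of_forall fun t => by rw [hfun_eq]

lemma hfun_integrable (n : ℝ) : Integrable (hfun n) m0 :=
  (ffun_integrable (-n)).restrict.congr (Filter.Eventually.of_forall fun t => (hfun_eq n t).symm)

lemma kfun_memLp : MemLp (fun t : ℝ => (1 + t)⁻¹) 2 m0 := by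
  have hm : AEStronglyMeasurable (fun t : ℝ => (1 + t)⁻¹) m0 := by
    refine Measurable.aestronglyMeasurable (by fun_prop)
  rw [memLp_two_iff_integrable_sq_norm hm]
  refine integrable_inv_one_add_sq.restrict.mono' (by fun_prop) ?_
  filter_upwards [ae_restrict_mem measurableSet_Ioi] with x hx
  have hx : 0 < x := hx
  rw [Real.norm_of_nonneg (by positivity), Real.norm_of_nonneg (by positivity), inv_pow]
  apply inv_anti₀ (by positivity)
  nlinarith

lemma T_toLp (T : Lp ℂ 2 m0 →L[ℂ] Lp ℂ 2 m0)
    (hT : ∀ x : Lp ℂ 2 m0, Integrable (⇑x) m0 →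
      (⇑(T x) : ℝ → ℂ) =ᵐ[m0] fun t =>
        (Real.sqrt (2 * Real.pi) : ℂ)⁻¹ *
          ∫ ξ in Ioi (0:ℝ), x ξ * Complex.exp (Complex.I * t * ξ))
    (g : ℝ → ℂ) (hg : MemLp g 2 m0) (hi : Integrable g m0) :
    (⇑(T (hg.toLp g)) : ℝ → ℂ) =ᵐ[m0] fun t =>
        (Real.sqrt (2 * Real.pi) : ℂ)⁻¹ *
          ∫ ξ in Ioi (0:ℝ), g ξ * Complex.exp (Complex.I * t * ξ) := by
  have hc := hg.coeFn_toLp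
  refine (hT _ (hi.congr hc.symm)).trans (Filter.Eventually.of_forall fun t => ?_)
  simp only
  congr 1
  refine integral_congr_ae ?_
  have hc' : (⇑(hg.toLp g) : ℝ → ℂ) =ᵐ[volume.restrict (Ioi 0)] g := hc
  filter_upwards [hc'] with x hx
  rw [hx]

theorem not_similar_to_normal
    (T : Lp ℂ 2 m0 →L[ℂ] Lp ℂ 2 m0)
    (hT : ∀ x : Lp ℂ 2 m0, Integrable (⇑x) m0 →
      (⇑(T x) : ℝ → ℂ) =ᵐ[m0] fun t =>
        (Real.sqrt (2 * Real.pi) : ℂ)⁻¹ *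
          ∫ ξ in Ioi (0:ℝ), x ξ * Complex.exp (Complex.I * t * ξ)) :
    ¬ ∃ S N Sinv : Lp ℂ 2 m0 →L[ℂ] Lp ℂ 2 m0,
        S ∘L Sinv = 1 ∧ Sinv ∘L S = 1 ∧
        N ∘L ContinuousLinearMap.adjoint N = ContinuousLinearMap.adjoint N ∘L N ∧
        T = S ∘L N ∘L Sinv := by
  rintro ⟨S, N, R, -, hRS, hN, hTS⟩
  set c : ℝ := (Real.sqrt (2 * Real.pi))⁻¹ with hcdef
  have hc0 : 0 < c := by
    have := Real.pi_pos
    positivity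
  have hcc : (Real.sqrt (2 * Real.pi) : ℂ)⁻¹ = (c : ℂ) := by rw [hcdef]; push_cast; rfl
  set X : ℝ → Lp ℂ 2 m0 := fun n => (gfun_memLp n).toLp (gfun n) with hX
  set Hn : ℝ → Lp ℂ 2 m0 := fun n => (hfun_memLp n).toLp (hfun n) with hHn
  set K : Lp ℝ 2 m0 := kfun_memLp.toLp _ with hK
  -- norm of `X n`
  have hXn : ∀ n, ‖X n‖ ≤ ‖X 0‖ := by
    intro n
    apply Lp.norm_le_norm_of_ae_le
    filter_upwards [(gfun_memLp n).coeFn_toLp, (gfun_memLp 0).coeFn_toLp] with t h1 h2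
    rw [h1, h2, gfun_norm, gfun_norm]
  -- formula for `T X`
  have hTX : ∀ n : ℝ, T (X n) = (c : ℂ) • (ffun_memLp n).toLp _ := by
    intro n
    apply Lp.ext
    refine (T_toLp T hT _ (gfun_memLp n) (gfun_integrable n).restrict).trans ?_
    filter_upwards [Lp.coeFn_smul (c : ℂ) ((ffun_memLp n).toLp _), (ffun_memLp n).coeFn_toLp]
      with t h1 h2
    rw [h1, Pi.smul_apply, h2, gfun_transform, hcc, smul_eq_mul]
  -- lower bound
  have hlow : ∀ n : ℝ, 0 ≤ n → c / 2 ≤ ‖T (X n)‖ := by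
    intro n hn
    have hs : MeasurableSet (Ioc n (n+1)) := measurableSet_Ioc
    have hm : m0 (Ioc n (n+1)) = 1 := by
      rw [m0, Measure.restrict_apply hs, inter_eq_left.2]
      · simp
      · intro t ht
        exact lt_of_le_of_lt hn ht.1
    have hm' : m0 (Ioc n (n+1)) ≠ ⊤ := by rw [hm]; simp
    have h1 : ‖indicatorConstLp 2 hs hm' ((c/2 : ℝ) : ℂ)‖ = c / 2 := by
      rw [norm_indicatorConstLp (by simp) (by simp), measureReal_def, hm]
      simp [abs_of_pos hc0]
    rw [← h1, hTX]
    apply Lp.norm_le_norm_of_ae_le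
    filter_upwards [Lp.coeFn_smul (c : ℂ) ((ffun_memLp n).toLp _), (ffun_memLp n).coeFn_toLp,
      indicatorConstLp_coeFn (p := 2) (hs := hs) (hμs := hm') (c := ((c/2 : ℝ) : ℂ))] with t h1 h2 h3
    rw [h1, Pi.smul_apply, h2, h3, norm_smul, aux_normf, Complex.norm_real,
      Real.norm_of_nonneg hc0.le]
    by_cases ht : t ∈ Ioc n (n+1)
    · rw [indicator_of_mem ht, Complex.norm_real, Real.norm_of_nonneg (by positivity), div_eq_mul_inv]
      gcongr
      nlinarith [ht.1, ht.2]
    · rw [indicator_of_notMem ht, norm_zero]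
      positivity
  -- upper bound
  have hup : ∀ n : ℝ, 1 ≤ n → ‖T (T (X n))‖ ≤ c * (‖T‖ * (n⁻¹ * ‖K‖)) := by
    intro n hn
    have hH : ‖Hn n‖ ≤ n⁻¹ * ‖K‖ := by
      apply Lp.norm_le_mul_norm_of_ae_le_mul
      have hpos : ∀ᵐ t ∂m0, 0 < t := ae_restrict_mem measurableSet_Ioi
      filter_upwards [(hfun_memLp n).coeFn_toLp, kfun_memLp.coeFn_toLp, hpos] with t h1 h2 ht
      rw [h1, h2, hfun_eq, aux_normf, Real.norm_of_nonneg (by positivity), ← mul_inv]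
      apply inv_anti₀ (by positivity)
      nlinarith [mul_pos (lt_of_lt_of_le one_pos hn) ht]
    have h2 : ‖T (T (X n))‖ ≤ c * ‖T (Hn n)‖ := by
      apply Lp.norm_le_mul_norm_of_ae_le_mul
      have hpos : ∀ᵐ t ∂m0, 0 < t := ae_restrict_mem measurableSet_Ioi
      rw [hTX, map_smul]
      filter_upwards [Lp.coeFn_smul (c : ℂ) (T ((ffun_memLp n).toLp _)),
        T_toLp T hT _ (ffun_memLp n) (ffun_integrable n).restrict,
        T_toLp T hT _ (hfun_memLp n) (hfun_integrable n), hpos] with s h1 h2 h3 hs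
      rw [h1, Pi.smul_apply, h2, h3, half n s hs, hcc, norm_smul, norm_mul, norm_mul, norm_neg,
        RCLike.norm_conj, Complex.norm_real, Real.norm_of_nonneg hc0.le]
    calc _ ≤ _ := h2
      _ ≤ c * (‖T‖ * ‖Hn n‖) := by gcongr; exact T.le_opNorm _
      _ ≤ _ := by gcongr
  -- conclusion
  set C : ℝ := ‖S‖^2 * ‖R‖^2 * (c * (‖T‖ * ‖K‖) * ‖X 0‖) with hC
  have hC0 : 0 ≤ C := by positivity
  have key : ∀ n : ℝ, 1 ≤ n → (c/2)^2 * n ≤ C := by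
    intro n hn
    have hn0 : 0 < n := by linarith
    have : (c/2)^2 ≤ C * n⁻¹ := by
      calc (c/2)^2 ≤ ‖T (X n)‖^2 := by
            have := hlow n hn0.le
            gcongr
        _ ≤ ‖S‖^2 * ‖R‖^2 * (‖T (T (X n))‖ * ‖X n‖) := sim_ineq T S N R hRS hN hTS (X n)
        _ ≤ ‖S‖^2 * ‖R‖^2 * (c * (‖T‖ * (n⁻¹ * ‖K‖)) * ‖X 0‖) := by
            gcongr
            · exact hup n hn
            · exact hXn n
        _ = _ := by rw [hC]; ring
    rwa [← div_eq_mul_inv, le_div_iff₀ hn0] at this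
  have h := key (C / (c/2)^2 + 1) (by have : 0 ≤ C / (c/2)^2 := by positivity
                                      linarith)
  have hp : 0 < (c/2)^2 := by positivity
  rw [mul_add, mul_div_cancel₀ _ hp.ne'] at h
  linarith
end
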